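/- arXiv:2308.02301 — 2 statements merged into one kernel-verified Lean document; each statement's English description precedes it below -/
import Mathlib

section
/- Conversely, if a continuous curve m(·):[s,r]→P²(K) and a Borel velocity field v:[s,r]×ℝ^d→ℝ^d satisfy: (V1) v(t,x) ∈ co{f(t,x,m(t),u) : u∈U} for almost every t∈[s,r] and m(t)-almost every x∈ℝ^d, and (V2) for every continuously differentiable function φ with compact support contained in (s,r)×ℝ^d, ∫_s^r ∫_{ℝ^d} (∂_tφ(t,x) + ⟨∇φ(t,x), v(t,x)⟩) m(t,dx) dt = 0, then there exists a distribution of controls α ∈ A_{s,r}[m(s)] such that m(·) = m(·,s,α). -/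
open MeasureTheory Set
open scoped ENNReal NNReal

noncomputable section

/-- Euclidean space `ℝ^d`. -/
abbrev Euc (d : ℕ) := EuclideanSpace ℝ (Fin d)

/-- Probability measures on `ℝ^d` with finite second moment (`P²(ℝ^d)`). -/
def MemP2 {d : ℕ} (m : Measure (Euc d)) : Prop :=
  IsProbabilityMeasure m ∧ ∫⁻ x, (‖x‖₊ : ℝ≥0∞) ^ 2 ∂m < ⊤

/-- The measure `m` is supported in the (closed) set `K`. -/
def SuppIn {d : ℕ} (K : Set (Euc d)) (m : Measure (Euc d)) : Prop := m Kᶜ = 0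

/-- `P²(K)`: probability measures with finite second moment supported in `K`. -/
def MemP2K {d : ℕ} (K : Set (Euc d)) (m : Measure (Euc d)) : Prop := MemP2 m ∧ SuppIn K m

/-- Couplings (transport plans) between two measures on `ℝ^d`. -/
def Couplings {d : ℕ} (m₁ m₂ : Measure (Euc d)) : Set (Measure (Euc d × Euc d)) :=
  {π | IsProbabilityMeasure π ∧ π.map Prod.fst = m₁ ∧ π.map Prod.snd = m₂}

/-- Squared 2-Wasserstein distance. -/
def W2sq {d : ℕ} (m₁ m₂ : Measure (Euc d)) : ℝ :=
  sInf ((fun π : Measure (Euc d × Euc d) => ∫ p, ‖p.1 - p.2‖ ^ 2 ∂π) '' Couplings m₁ m₂)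

/-- 2-Wasserstein distance `W₂`. -/
def W2 {d : ℕ} (m₁ m₂ : Measure (Euc d)) : ℝ := Real.sqrt (W2sq m₁ m₂)

/-- An optimal plan between `m₁` and `m₂`. -/
def IsOptimalPlan {d : ℕ} (m₁ m₂ : Measure (Euc d)) (π : Measure (Euc d × Euc d)) : Prop :=
  π ∈ Couplings m₁ m₂ ∧ ∫ p, ‖p.1 - p.2‖ ^ 2 ∂π = W2sq m₁ m₂

/-- Standing assumptions (C1)–(C5) on the dynamics `f`. -/
structure DynHyp {d : ℕ} {U : Type} [TopologicalSpace U] (T R Cf : ℝ) (K : Set (Euc d))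
    (f : ℝ → Euc d → Measure (Euc d) → U → Euc d) : Prop where
  cont : ∀ m, Continuous fun p : ℝ × Euc d × U => f p.1 p.2.1 m p.2.2
  zero_outside : ∀ t x m u, SuppIn K m → x ∉ K → f t x m u = 0
  bounded : ∀ t x m u, t ∈ Icc 0 T → x ∈ K → MemP2K K m → ‖f t x m u‖ ≤ R
  lipschitz : ∀ t x x' m m' u, t ∈ Icc 0 T → x ∈ K → x' ∈ K → MemP2K K m → MemP2K K m' →
    ‖f t x m u - f t x' m' u‖ ≤ Cf * (‖x - x'‖ + W2 m m')

/-- Relaxed controls `U_{s,r}`: measures on `[s,r] × U` whose time marginal is Lebesgue. -/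
def RelaxedControls {U : Type} [MeasurableSpace U] (s r : ℝ) : Set (Measure (ℝ × U)) :=
  {ξ | ξ.map Prod.fst = volume.restrict (Icc s r)}

/-- `x(·) = x(·,s,y,m(·),ξ)` solves `ẋ(t) = ∫_U f(t,x(t),m(t),u) ξ(du|t)`, `x(s)=y`,
written in the equivalent integral form against the relaxed control `ξ`. -/
def IsTraj {d : ℕ} {U : Type} [MeasurableSpace U]
    (f : ℝ → Euc d → Measure (Euc d) → U → Euc d) (s r : ℝ)
    (m : ℝ → Measure (Euc d)) (ξ : Measure (ℝ × U)) (y : Euc d) (x : ℝ → Euc d) : Prop :=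
  Continuous x ∧ x s = y ∧ ∀ t ∈ Icc s r,
    x t = y + ∫ p in (Icc s t ×ˢ (univ : Set U)), f p.1 (x p.1) (m p.1) p.2 ∂ξ

/-- `A_{s,r}[m]`: distributions of pairs (initial state, relaxed control) with first marginal `m`. -/
def ControlDistrs {d : ℕ} (U : Type) [MeasurableSpace U] (s r : ℝ) (m : Measure (Euc d)) :
    Set (Measure (Euc d × Measure (ℝ × U))) :=
  {α | IsProbabilityMeasure α ∧ α.map Prod.fst = m ∧ ∀ᵐ p ∂α, p.2 ∈ RelaxedControls (U := U) s r}

/-- `m(·) = m(·,s,α)` is the motion of the mean field type control system produced by the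
initial time `s` and the distribution of controls `α`. -/
def IsMotion {d : ℕ} {U : Type} [MeasurableSpace U]
    (f : ℝ → Euc d → Measure (Euc d) → U → Euc d) (s r : ℝ) (mstar : Measure (Euc d))
    (α : Measure (Euc d × Measure (ℝ × U))) (m : ℝ → Measure (Euc d)) : Prop :=
  m s = mstar ∧ ∃ traj : Euc d × Measure (ℝ × U) → ℝ → Euc d,
    (∀ᵐ p ∂α, IsTraj f s r m p.2 p.1 (traj p)) ∧
    ∀ t ∈ Icc s r, m t = α.map fun p => traj p t

/-- Concatenation `ξ₀ ⋄_{s₁} ξ₁` of relaxed controls. -/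
def concatControl {U : Type} [MeasurableSpace U] (s₁ : ℝ) (ξ₀ ξ₁ : Measure (ℝ × U)) :
    Measure (ℝ × U) :=
  ξ₀.restrict ((Iio s₁) ×ˢ (univ : Set U)) + ξ₁.restrict ((Ici s₁) ×ˢ (univ : Set U))

/-- `α` is the concatenation `α₀ ⋄_{s₁} α₁` of distributions of controls: there are a motion of
`α₀` with trajectories `traj`, and a disintegration `β` of `α₁` w.r.t. its first marginal `m₁`,
such that `α` is obtained by concatenating controls along the trajectories. -/
def IsConcatDistr {d : ℕ} {U : Type} [MeasurableSpace U]
    (f : ℝ → Euc d → Measure (Euc d) → U → Euc d) (s₀ s₁ : ℝ) (m₀ m₁ : Measure (Euc d))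
    (α₀ α₁ α : Measure (Euc d × Measure (ℝ × U))) : Prop :=
  ∃ (mflow : ℝ → Measure (Euc d)) (traj : Euc d × Measure (ℝ × U) → ℝ → Euc d)
    (β : Euc d → Measure (Measure (ℝ × U))),
    IsMotion f s₀ s₁ m₀ α₀ mflow ∧
    (∀ᵐ p ∂α₀, IsTraj f s₀ s₁ mflow p.2 p.1 (traj p)) ∧
    α₁ = m₁.bind (fun y => (β y).map fun ξ => (y, ξ)) ∧
    α = α₀.bind fun p => (β (traj p s₁)).map fun ξ₁ => (p.1, concatControl s₁ p.2 ξ₁)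

/-- A (relaxed) feedback control at a single state: a weakly measurable family of probabilities
on `U`, i.e. the disintegration `ζ(du|t)` of an element of `U_{s,r}`. -/
def IsFeedback {U : Type} [MeasurableSpace U] [TopologicalSpace U] (ζ : ℝ → Measure U) : Prop :=
  (∀ t, IsProbabilityMeasure (ζ t)) ∧ ∀ g : C(U, ℝ), Measurable fun t => ∫ u, g u ∂(ζ t)

/-- Trajectory driven by a feedback (kernel-form) relaxed control `ζ(du|t)`. -/
def IsTrajKer {d : ℕ} {U : Type} [MeasurableSpace U]
    (f : ℝ → Euc d → Measure (Euc d) → U → Euc d) (s r : ℝ)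
    (m : ℝ → Measure (Euc d)) (ζ : ℝ → Measure U) (y : Euc d) (x : ℝ → Euc d) : Prop :=
  Continuous x ∧ x s = y ∧ ∀ t ∈ Icc s r,
    x t = y + ∫ t' in Icc s t, ∫ u, f t' (x t') (m t') u ∂(ζ t')

/-! ### Mean field Markov chains -/

/-- `Σ²`: summable nonnegative weights with total mass one and finite second moment. -/
def InSigma2 {d : ℕ} (S : Set (Euc d)) (μ : S → ℝ) : Prop :=
  (∀ x, 0 ≤ μ x) ∧ HasSum μ 1 ∧ Summable fun x : S => ‖(x : Euc d)‖ ^ 2 * μ x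

/-- The embedding `I : Σ² → P²(ℝ^d)`, `I(μ) = Σ_x̄ μ_x̄ δ_x̄`. -/
def Imeas {d : ℕ} (S : Set (Euc d)) (μ : S → ℝ) : Measure (Euc d) :=
  Measure.sum fun x : S => (Real.toNNReal (μ x)) • Measure.dirac (x : Euc d)

/-- `Q` is a Kolmogorov matrix (on the relevant domain). -/
def IsKolmogorov {d : ℕ} {U : Type} (S : Set (Euc d)) (T : ℝ)
    (Q : ℝ → (S → ℝ) → U → S → S → ℝ) : Prop :=
  ∀ t ∈ Icc 0 T, ∀ μ : S → ℝ, InSigma2 S μ → ∀ (u : U) (x : S),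
    (∀ y, x ≠ y → 0 ≤ Q t μ u x y) ∧ HasSum (Q t μ u x) 0

/-- The relaxed transition rate `𝒬_{x̄,ȳ}(t,μ,ζ_S) = ∫_U Q_{x̄,ȳ}(t,μ,u) ζ_x̄(du|t)`. -/
def Qbar {d : ℕ} {U : Type} [MeasurableSpace U] (S : Set (Euc d))
    (Q : ℝ → (S → ℝ) → U → S → S → ℝ) (ζ : S → ℝ → Measure U)
    (t : ℝ) (μ : S → ℝ) (x y : S) : ℝ :=
  ∫ u, Q t μ u x y ∂(ζ x t)

/-- Motion of the mean field Markov chain: the (integral form of the) nonlinear Kolmogorov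
equation `dμ_ȳ(t)/dt = Σ_x̄ μ_x̄(t) 𝒬_{x̄,ȳ}(t,μ(t),ζ_S)`, `μ(s) = μ*`. -/
def IsChainMotion {d : ℕ} {U : Type} [MeasurableSpace U] (S : Set (Euc d))
    (Q : ℝ → (S → ℝ) → U → S → S → ℝ) (s r : ℝ) (μstar : S → ℝ)
    (ζ : S → ℝ → Measure U) (μ : ℝ → S → ℝ) : Prop :=
  μ s = μstar ∧ ∀ t ∈ Icc s r, ∀ y : S,
    μ t y = μstar y + ∫ t' in Icc s t, ∑' x : S, μ t' x * Qbar S Q ζ t' (μ t') x y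

/-- (A1): `S` is an `ε`-net of `K`. -/
def CondA1 {d : ℕ} (S K : Set (Euc d)) (ε : ℝ) : Prop :=
  ∀ x ∈ K, ∃ y ∈ S, ‖x - y‖ ≤ ε

/-- (A2): the entries of `Q` are bounded by `B`. -/
def CondA2 {d : ℕ} {U : Type} (S : Set (Euc d)) (T : ℝ)
    (Q : ℝ → (S → ℝ) → U → S → S → ℝ) (B : ℝ) : Prop :=
  ∀ t ∈ Icc 0 T, ∀ μ : S → ℝ, InSigma2 S μ → ∀ (u : U) (x y : S), |Q t μ u x y| ≤ B

/-- (A3): the expected drift of the chain approximates `f` up to `ε`. -/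
def CondA3 {d : ℕ} {U : Type} (S : Set (Euc d)) (T : ℝ)
    (f : ℝ → Euc d → Measure (Euc d) → U → Euc d)
    (Q : ℝ → (S → ℝ) → U → S → S → ℝ) (ε : ℝ) : Prop :=
  ∀ t ∈ Icc 0 T, ∀ μ : S → ℝ, InSigma2 S μ → ∀ (u : U) (x : S),
    ‖f t (x : Euc d) (Imeas S μ) u - ∑' y : S, Q t μ u x y • ((y : Euc d) - (x : Euc d))‖ ≤ ε

/-- (A4): the quadratic variation rate of the chain is at most `ε²`. -/
def CondA4 {d : ℕ} {U : Type} (S : Set (Euc d)) (T : ℝ)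
    (Q : ℝ → (S → ℝ) → U → S → S → ℝ) (ε : ℝ) : Prop :=
  ∀ t ∈ Icc 0 T, ∀ μ : S → ℝ, InSigma2 S μ → ∀ (u : U) (x : S),
    ∑' y : S, Q t μ u x y * ‖(y : Euc d) - (x : Euc d)‖ ^ 2 ≤ ε ^ 2

/-- The generator `L_t[μ,ζ_S]φ` of the mean field Markov chain, extended by `0` off `S`. -/
def chainGen {d : ℕ} {U : Type} [MeasurableSpace U] (S : Set (Euc d))
    (Q : ℝ → (S → ℝ) → U → S → S → ℝ) (ζ : S → ℝ → Measure U) (μflow : ℝ → S → ℝ)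
    (φ : Euc d → ℝ) (t : ℝ) (z : Euc d) : ℝ :=
  open scoped Classical in
  if h : z ∈ S then ∑' y : S, Qbar S Q ζ t (μflow t) ⟨z, h⟩ y * φ (y : Euc d) else 0

/-- A realization of the flow `μ(·)` of the mean field Markov chain on `[s,r]`: a filtered
probability space with an adapted `S`-valued process `X` whose one-dimensional laws are `μ(·)`
and such that `φ(X(t)) - ∫_s^t L_{t'}[μ(t'),ζ_S]φ(X(t')) dt'` is a martingale for every
bounded `φ`. -/
def IsRealization {d : ℕ} {U : Type} [MeasurableSpace U] (S : Set (Euc d))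
    (Q : ℝ → (S → ℝ) → U → S → S → ℝ) (s r : ℝ) (ζ : S → ℝ → Measure U) (μ : ℝ → S → ℝ)
    {Ω : Type} [inst : MeasurableSpace Ω] (ℱ : ℝ → MeasurableSpace Ω) (P : Measure Ω)
    (X : ℝ → Ω → Euc d) : Prop :=
  IsProbabilityMeasure P ∧
  (∀ t, ℱ t ≤ inst) ∧ Monotone ℱ ∧
  (∀ t ∈ Icc s r, ∀ ω, X t ω ∈ S) ∧
  (∀ t ∈ Icc s r, Measurable[ℱ t] (X t)) ∧
  (∀ t ∈ Icc s r, ∀ x : S, μ t x = (P {ω | X t ω = (x : Euc d)}).toReal) ∧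
  ∀ φ : Euc d → ℝ, (∃ C, ∀ z, |φ z| ≤ C) →
    (∀ t ∈ Icc s r,
      Integrable (fun ω => φ (X t ω) - ∫ t' in Icc s t, chainGen S Q ζ μ φ t' (X t' ω)) P) ∧
    (∀ t₁ ∈ Icc s r, ∀ t₂ ∈ Icc s r, t₁ ≤ t₂ → ∀ A, MeasurableSet[ℱ t₁] A →
      ∫ ω in A, (φ (X t₂ ω) - ∫ t' in Icc s t₂, chainGen S Q ζ μ φ t' (X t' ω)) ∂P
        = ∫ ω in A, (φ (X t₁ ω) - ∫ t' in Icc s t₁, chainGen S Q ζ μ φ t' (X t' ω)) ∂P)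

/-- The model predictive flow (rules (D1)–(D2)) for the deterministic system, built from the
feedback strategy `ζ` of the chain and its motion `μ(·)` along the partition `σ`. -/
def IsMPCFlow {d : ℕ} {U : Type} [MeasurableSpace U]
    (f : ℝ → Euc d → Measure (Euc d) → U → Euc d) (S : Set (Euc d))
    (ζ : S → ℝ → Measure U) (μ : ℝ → S → ℝ) (n : ℕ) (σ : Fin (n + 1) → ℝ)
    (m₀ : Measure (Euc d)) (m : ℝ → Measure (Euc d)) : Prop :=
  m (σ 0) = m₀ ∧ ∀ k : Fin n,
    ∃ π : Measure (Euc d × Euc d),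
      IsOptimalPlan (m (σ k.castSucc)) (Imeas S (μ (σ k.castSucc))) π ∧
      ∃ x : Euc d × Euc d → ℝ → Euc d,
        (∀ᵐ p ∂π, ∃ h : p.2 ∈ S,
          IsTrajKer f (σ k.castSucc) (σ k.succ) m (ζ ⟨p.2, h⟩) p.1 (x p)) ∧
        ∀ t ∈ Icc (σ k.castSucc) (σ k.succ), m t = π.map fun p => x p t

/-- `m(·)` is continuous on `[s,r]` with respect to the 2-Wasserstein distance. -/
def W2Continuous {d : ℕ} (s r : ℝ) (m : ℝ → Measure (Euc d)) : Prop :=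
  ∀ t ∈ Icc s r, ∀ ε > (0 : ℝ), ∃ δ > (0 : ℝ), ∀ t' ∈ Icc s r, |t' - t| < δ →
    W2 (m t) (m t') < ε

lemma continuous_of_norm_sub_le {X : Type*} [SeminormedAddCommGroup X] {γ : ℝ → X} {R : ℝ}
    (hR : 0 ≤ R) (h : ∀ a b, ‖γ b - γ a‖ ≤ R * |b - a|) : Continuous γ := by
  refine (LipschitzWith.of_dist_le_mul (K := R.toNNReal) fun a b => ?_).continuous
  rw [dist_eq_norm, Real.dist_eq, Real.coe_toNNReal _ hR]
  exact h b a

section CaratheodoryFlow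

variable {E U : Type*} [NormedAddCommGroup E] [NormedSpace ℝ E] [MeasurableSpace U]

/-- A velocity field with control parameter, continuous, bounded by `R` and `L`-Lipschitz in the
state. -/
structure ControlledField [TopologicalSpace U] (F : ℝ → E → U → E) (R L : ℝ) : Prop where
  cont : Continuous fun p : ℝ × E × U => F p.1 p.2.1 p.2.2
  bound : ∀ t x u, ‖F t x u‖ ≤ R
  lip : ∀ t x x' u, ‖F t x u - F t x' u‖ ≤ L * ‖x - x'‖
  R_nonneg : 0 ≤ R
  L_pos : 0 < L

/-- The time marginal of `μ` is dominated by Lebesgue measure. -/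
def TimeDominated (μ : Measure (ℝ × U)) : Prop := μ.map Prod.fst ≤ volume

lemma TimeDominated.map_restrict_le {μ : Measure (ℝ × U)} (hμ : TimeDominated μ) (a b : ℝ) :
    (μ.restrict (Ioc a b ×ˢ univ)).map Prod.fst ≤ volume.restrict (Ioc a b) := by
  have : (Ioc a b ×ˢ univ : Set (ℝ × U)) = Prod.fst ⁻¹' Ioc a b := by ext; simp
  rw [this, ← Measure.restrict_map measurable_fst measurableSet_Ioc]
  exact Measure.restrict_mono_measure hμ _

lemma TimeDominated.isFiniteMeasure_restrict {μ : Measure (ℝ × U)} (hμ : TimeDominated μ)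
    (a b : ℝ) : IsFiniteMeasure (μ.restrict (Ioc a b ×ˢ univ)) := by
  constructor
  have h := hμ.map_restrict_le a b univ
  rw [Measure.map_apply measurable_fst MeasurableSet.univ] at h
  simp only [preimage_univ] at h
  exact h.trans_lt (by simp)

lemma TimeDominated.norm_integral_le {μ : Measure (ℝ × U)} (hμ : TimeDominated μ) (a b : ℝ)
    {g : ℝ × U → E} {k : ℝ → ℝ} (hk : Continuous k) (hk0 : ∀ t ∈ Ioc a b, 0 ≤ k t)
    (hg : ∀ p : ℝ × U, p.1 ∈ Ioc a b → ‖g p‖ ≤ k p.1) :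
    ‖∫ p in Ioc a b ×ˢ univ, g p ∂μ‖ ≤ ∫ t in Ioc a b, k t := by
  have hmeas : MeasurableSet (Ioc a b ×ˢ univ : Set (ℝ × U)) :=
    measurableSet_Ioc.prod MeasurableSet.univ
  have hki : Integrable k (volume.restrict (Ioc a b)) :=
    (hk.integrableOn_Icc (a := a) (b := b)).mono_set Ioc_subset_Icc_self
  have hki' : Integrable k ((μ.restrict (Ioc a b ×ˢ univ)).map Prod.fst) :=
    hki.mono_measure (hμ.map_restrict_le a b)
  have h1 : ‖∫ p in Ioc a b ×ˢ univ, g p ∂μ‖ ≤ ∫ p in Ioc a b ×ˢ univ, k p.1 ∂μ := by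
    refine norm_integral_le_of_norm_le ?_ ?_
    · exact (integrable_map_measure hk.aestronglyMeasurable measurable_fst.aemeasurable).1 hki'
    · filter_upwards [ae_restrict_mem hmeas] with p hp using hg p hp.1
  refine h1.trans ?_
  rw [← integral_map (f := k) measurable_fst.aemeasurable hk.aestronglyMeasurable]
  refine integral_mono_measure (hμ.map_restrict_le a b) ?_ hki
  filter_upwards [ae_restrict_mem measurableSet_Ioc] with t ht using hk0 t ht

/-- The Picard operator of the integral equation driven by the relaxed control `μ`. -/
def picardMap (F : ℝ → E → U → E) (t₀ : ℝ) (y : E) (μ : Measure (ℝ × U)) (γ : ℝ → E) (t : ℝ) : E :=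
  y + ∫ p in Ioc t₀ t ×ˢ univ, F p.1 (γ p.1) p.2 ∂μ

/-- The Picard iterates started from the constant curve. -/
def picardIter (F : ℝ → E → U → E) (t₀ : ℝ) (y : E) (μ : Measure (ℝ × U)) (n : ℕ) : ℝ → E :=
  (picardMap F t₀ y μ)^[n] fun _ => y

/-- The solution of the integral equation driven by the relaxed control `μ`. -/
def controlFlow (F : ℝ → E → U → E) (t₀ : ℝ) (y : E) (μ : Measure (ℝ × U)) (t : ℝ) : E :=
  Filter.limUnder Filter.atTop fun n : ℕ => picardIter F t₀ y μ n t

lemma picardIter_zero (F : ℝ → E → U → E) (t₀ : ℝ) (y : E) (μ : Measure (ℝ × U)) :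
    picardIter F t₀ y μ 0 = fun _ => y := rfl

lemma picardIter_succ (F : ℝ → E → U → E) (t₀ : ℝ) (y : E) (μ : Measure (ℝ × U)) (n : ℕ) :
    picardIter F t₀ y μ (n + 1) = picardMap F t₀ y μ (picardIter F t₀ y μ n) :=
  Function.iterate_succ_apply' _ _ _

lemma picardMap_of_le {F : ℝ → E → U → E} {t₀ t : ℝ} (h : t ≤ t₀) (y : E)
    (μ : Measure (ℝ × U)) (γ : ℝ → E) :
    picardMap F t₀ y μ γ t = y := by
  simp [picardMap, Ioc_eq_empty (not_lt.2 h)]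

lemma picardIter_of_le {F : ℝ → E → U → E} {t₀ t : ℝ} (h : t ≤ t₀) (y : E)
    (μ : Measure (ℝ × U)) (n : ℕ) :
    picardIter F t₀ y μ n t = y := by
  cases n with
  | zero => rfl
  | succ n => rw [picardIter_succ, picardMap_of_le h]

variable [TopologicalSpace U] [BorelSpace U] [SecondCountableTopology U]
  [FiniteDimensional ℝ E]
variable {F : ℝ → E → U → E} {R L : ℝ}

lemma ControlledField.integrableOn (hF : ControlledField F R L) {μ : Measure (ℝ × U)}
    (hμ : TimeDominated μ) {γ : ℝ → E} (hγ : Continuous γ) (a b : ℝ) :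
    IntegrableOn (fun p : ℝ × U => F p.1 (γ p.1) p.2) (Ioc a b ×ˢ univ) μ := by
  have := hμ.isFiniteMeasure_restrict a b
  refine Integrable.of_bound (C := R) ?_ (Filter.Eventually.of_forall fun p => hF.bound _ _ _)
  exact (hF.cont.comp (continuous_fst.prodMk ((hγ.comp continuous_fst).prodMk
    continuous_snd))).aestronglyMeasurable

lemma picardMap_sub (hF : ControlledField F R L) {μ : Measure (ℝ × U)} (hμ : TimeDominated μ)
    {γ : ℝ → E} (hγ : Continuous γ) {t₀ a b : ℝ} (y : E) (ha : t₀ ≤ a) (hab : a ≤ b) :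
    picardMap F t₀ y μ γ b - picardMap F t₀ y μ γ a
      = ∫ p in Ioc a b ×ˢ univ, F p.1 (γ p.1) p.2 ∂μ := by
  have hu : (Ioc t₀ b ×ˢ univ : Set (ℝ × U)) = (Ioc t₀ a ×ˢ univ) ∪ (Ioc a b ×ˢ univ) := by
    rw [← union_prod, Ioc_union_Ioc_eq_Ioc ha hab]
  have hd : Disjoint (Ioc t₀ a ×ˢ univ : Set (ℝ × U)) (Ioc a b ×ˢ univ) := by
    rw [Set.disjoint_left]
    rintro p hp hq
    exact absurd hp.1.2 (not_le.2 hq.1.1)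
  unfold picardMap
  rw [hu, setIntegral_union hd (measurableSet_Ioc.prod MeasurableSet.univ)
    (hF.integrableOn hμ hγ _ _) (hF.integrableOn hμ hγ _ _)]
  abel

lemma norm_picardMap_sub_le (hF : ControlledField F R L) {μ : Measure (ℝ × U)}
    (hμ : TimeDominated μ) {γ : ℝ → E} (hγ : Continuous γ) (t₀ : ℝ) (y : E) (a b : ℝ) :
    ‖picardMap F t₀ y μ γ b - picardMap F t₀ y μ γ a‖ ≤ R * |b - a| := by
  have key : ∀ a b, t₀ ≤ a → a ≤ b →
      ‖picardMap F t₀ y μ γ b - picardMap F t₀ y μ γ a‖ ≤ R * |b - a| := by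
    intro a b ha hab
    rw [picardMap_sub hF hμ hγ y ha hab]
    refine (hμ.norm_integral_le a b (k := fun _ => R) continuous_const (fun _ _ => hF.R_nonneg)
      fun p _ => hF.bound _ _ _).trans (le_of_eq ?_)
    simp [abs_of_nonneg (sub_nonneg.2 hab), hab, mul_comm]
  have key2 : ∀ a b, a ≤ b →
      ‖picardMap F t₀ y μ γ b - picardMap F t₀ y μ γ a‖ ≤ R * |b - a| := by
    intro a b hab
    rcases le_total t₀ a with h | h
    · exact key a b h hab
    rcases le_total t₀ b with h' | h'
    · have := key t₀ b le_rfl h'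
      rw [picardMap_of_le le_rfl] at this
      rw [picardMap_of_le h]
      refine this.trans (mul_le_mul_of_nonneg_left ?_ hF.R_nonneg)
      rw [abs_of_nonneg (by linarith), abs_of_nonneg (by linarith)]
      linarith
    · rw [picardMap_of_le h, picardMap_of_le h']
      simpa using mul_nonneg hF.R_nonneg (abs_nonneg _)
  rcases le_total a b with h | h
  · exact key2 a b h
  · rw [norm_sub_rev, abs_sub_comm]
    exact key2 b a h

lemma continuous_picardMap (hF : ControlledField F R L) {μ : Measure (ℝ × U)}
    (hμ : TimeDominated μ) {γ : ℝ → E} (hγ : Continuous γ) (t₀ : ℝ) (y : E) :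
    Continuous (picardMap F t₀ y μ γ) :=
  continuous_of_norm_sub_le hF.R_nonneg (norm_picardMap_sub_le hF hμ hγ t₀ y)

lemma continuous_picardIter (hF : ControlledField F R L) {μ : Measure (ℝ × U)}
    (hμ : TimeDominated μ) (t₀ : ℝ) (y : E) (n : ℕ) : Continuous (picardIter F t₀ y μ n) := by
  induction n with
  | zero => exact continuous_const
  | succ n ih => rw [picardIter_succ]; exact continuous_picardMap hF hμ ih t₀ y

lemma norm_picardIter_sub_le (hF : ControlledField F R L) {μ : Measure (ℝ × U)}
    (hμ : TimeDominated μ) (t₀ : ℝ) (y : E) (n : ℕ) (a b : ℝ) :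
    ‖picardIter F t₀ y μ n b - picardIter F t₀ y μ n a‖ ≤ R * |b - a| := by
  cases n with
  | zero => simpa [picardIter_zero] using mul_nonneg hF.R_nonneg (abs_nonneg _)
  | succ n =>
    rw [picardIter_succ]
    exact norm_picardMap_sub_le hF hμ (continuous_picardIter hF hμ t₀ y n) t₀ y a b

lemma norm_picardMap_sub_picardMap_le (hF : ControlledField F R L) {μ : Measure (ℝ × U)}
    (hμ : TimeDominated μ) {γ γ' : ℝ → E} (hγ : Continuous γ) (hγ' : Continuous γ')
    {t₀ t A : ℝ} (y y' : E) (hA : 0 ≤ A) (ht : t₀ ≤ t)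
    (h : ∀ τ, t₀ ≤ τ → ‖γ τ - γ' τ‖ ≤ A * Real.exp (2 * L * (τ - t₀))) :
    ‖picardMap F t₀ y μ γ t - picardMap F t₀ y' μ γ' t‖
      ≤ ‖y - y'‖ + A / 2 * (Real.exp (2 * L * (t - t₀)) - 1) := by
  have hL := hF.L_pos
  have e : picardMap F t₀ y μ γ t - picardMap F t₀ y' μ γ' t = (y - y') +
      ∫ p in Ioc t₀ t ×ˢ univ, (F p.1 (γ p.1) p.2 - F p.1 (γ' p.1) p.2) ∂μ := by
    rw [integral_sub (hF.integrableOn hμ hγ _ _) (hF.integrableOn hμ hγ' _ _)]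
    unfold picardMap
    abel
  rw [e]
  refine (norm_add_le _ _).trans (add_le_add le_rfl ?_)
  refine (hμ.norm_integral_le t₀ t (k := fun τ => L * (A * Real.exp (2 * L * (τ - t₀))))
    (by fun_prop) (fun _ _ => by positivity) fun p hp => ?_).trans (le_of_eq ?_)
  · exact (hF.lip _ _ _ _).trans (mul_le_mul_of_nonneg_left (h _ hp.1.le) hL.le)
  · rw [← intervalIntegral.integral_of_le ht]
    have hd : ∀ τ ∈ uIcc t₀ t, HasDerivAt (fun τ => A / 2 * Real.exp (2 * L * (τ - t₀)))
        (L * (A * Real.exp (2 * L * (τ - t₀)))) τ := by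
      intro τ _
      have h1 : HasDerivAt (fun τ : ℝ => 2 * L * (τ - t₀)) (2 * L) τ := by
        simpa using ((hasDerivAt_id τ).sub_const t₀).const_mul (2 * L)
      have := (h1.exp).const_mul (A / 2)
      exact this.congr_deriv (by ring)
    rw [intervalIntegral.integral_eq_sub_of_hasDerivAt hd
      (Continuous.intervalIntegrable (by fun_prop) _ _)]
    simp
    ring

/-- A solution of the integral equation driven by the relaxed control `μ`. -/
def IsControlSol (F : ℝ → E → U → E) (t₀ : ℝ) (y : E) (μ : Measure (ℝ × U)) (γ : ℝ → E) : Prop :=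
  Continuous γ ∧ ∀ t, t₀ ≤ t → γ t = picardMap F t₀ y μ γ t

lemma norm_picardIter_sub_sol_le (hF : ControlledField F R L) {μ : Measure (ℝ × U)}
    (hμ : TimeDominated μ) {t₀ : ℝ} {y : E} {γ : ℝ → E} (hγ : IsControlSol F t₀ y μ γ) (n : ℕ)
    {t : ℝ} (ht : t₀ ≤ t) :
    ‖picardIter F t₀ y μ n t - γ t‖ ≤ R / (2 * L) * (1 / 2) ^ n * Real.exp (2 * L * (t - t₀)) := by
  have hL := hF.L_pos
  have hR := hF.R_nonneg
  induction n generalizing t with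
  | zero =>
    have h0 : picardIter F t₀ y μ 0 t = picardMap F t₀ y μ γ t₀ := by
      rw [picardMap_of_le le_rfl]; rfl
    rw [h0, hγ.2 t ht, norm_sub_rev]
    refine (norm_picardMap_sub_le hF hμ hγ.1 _ _ _ _).trans ?_
    rw [abs_of_nonneg (sub_nonneg.2 ht)]
    have := Real.add_one_le_exp (2 * L * (t - t₀))
    calc R * (t - t₀) = R / (2 * L) * (2 * L * (t - t₀)) := by field_simp
      _ ≤ R / (2 * L) * Real.exp (2 * L * (t - t₀)) :=
          mul_le_mul_of_nonneg_left (by linarith) (by positivity)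
      _ = _ := by ring
  | succ n ih =>
    rw [picardIter_succ, hγ.2 t ht]
    refine (norm_picardMap_sub_picardMap_le hF hμ (continuous_picardIter hF hμ _ _ _) hγ.1 y y
      (A := R / (2 * L) * (1 / 2) ^ n) (by positivity) ht fun τ hτ => ih hτ).trans ?_
    rw [sub_self, norm_zero, zero_add, pow_succ]
    have : 0 ≤ R / (2 * L) * (1 / 2 : ℝ) ^ n := by positivity
    nlinarith

lemma norm_picardIter_succ_sub_le (hF : ControlledField F R L) {μ : Measure (ℝ × U)}
    (hμ : TimeDominated μ) {t₀ : ℝ} (y : E) (n : ℕ) {t : ℝ} (ht : t₀ ≤ t) :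
    ‖picardIter F t₀ y μ (n + 1) t - picardIter F t₀ y μ n t‖
      ≤ R / (2 * L) * (1 / 2) ^ n * Real.exp (2 * L * (t - t₀)) := by
  have hL := hF.L_pos
  have hR := hF.R_nonneg
  induction n generalizing t with
  | zero =>
    have h0 : picardIter F t₀ y μ 0 t = picardMap F t₀ y μ (picardIter F t₀ y μ 0) t₀ := by
      rw [picardMap_of_le le_rfl]; rfl
    rw [h0, picardIter_succ]
    refine (norm_picardMap_sub_le hF hμ (continuous_picardIter hF hμ _ _ _) _ _ _ _).trans ?_
    rw [abs_of_nonneg (sub_nonneg.2 ht)]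
    have := Real.add_one_le_exp (2 * L * (t - t₀))
    calc R * (t - t₀) = R / (2 * L) * (2 * L * (t - t₀)) := by field_simp
      _ ≤ R / (2 * L) * Real.exp (2 * L * (t - t₀)) :=
          mul_le_mul_of_nonneg_left (by linarith) (by positivity)
      _ = _ := by ring
  | succ n ih =>
    rw [picardIter_succ _ _ _ _ (n + 1), picardIter_succ _ _ _ _ n]
    refine (norm_picardMap_sub_picardMap_le hF hμ
      (continuous_picardMap hF hμ (continuous_picardIter hF hμ _ _ _) _ _)
      (continuous_picardIter hF hμ _ _ _) y y
      (A := R / (2 * L) * (1 / 2) ^ n) (by positivity) ht fun τ hτ => ?_).trans ?_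
    · rw [← picardIter_succ]; exact ih hτ
    rw [sub_self, norm_zero, zero_add, pow_succ]
    have : 0 ≤ R / (2 * L) * (1 / 2 : ℝ) ^ n := by positivity
    nlinarith

lemma tendsto_picardIter (hF : ControlledField F R L) {μ : Measure (ℝ × U)}
    (hμ : TimeDominated μ) (t₀ : ℝ) (y : E) (t : ℝ) :
    Filter.Tendsto (fun n => picardIter F t₀ y μ n t) Filter.atTop
      (nhds (controlFlow F t₀ y μ t)) := by
  have : CompleteSpace E := FiniteDimensional.complete ℝ E
  refine CauchySeq.tendsto_limUnder ?_
  rcases le_total t t₀ with h | h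
  · simp only [picardIter_of_le h]
    exact tendsto_const_nhds.cauchySeq
  · refine cauchySeq_of_le_geometric (1 / 2) (R / (2 * L) * Real.exp (2 * L * (t - t₀)))
      (by norm_num) fun n => ?_
    rw [dist_comm, dist_eq_norm]
    refine (norm_picardIter_succ_sub_le hF hμ y n h).trans (le_of_eq (by ring))

lemma norm_controlFlow_sub_le (hF : ControlledField F R L) {μ : Measure (ℝ × U)}
    (hμ : TimeDominated μ) (t₀ : ℝ) (y : E) (a b : ℝ) :
    ‖controlFlow F t₀ y μ b - controlFlow F t₀ y μ a‖ ≤ R * |b - a| :=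
  le_of_tendsto' ((tendsto_picardIter hF hμ t₀ y b).sub (tendsto_picardIter hF hμ t₀ y a)).norm
    fun n => norm_picardIter_sub_le hF hμ t₀ y n a b

lemma continuous_controlFlow (hF : ControlledField F R L) {μ : Measure (ℝ × U)}
    (hμ : TimeDominated μ) (t₀ : ℝ) (y : E) : Continuous (controlFlow F t₀ y μ) :=
  continuous_of_norm_sub_le hF.R_nonneg (norm_controlFlow_sub_le hF hμ t₀ y)

lemma controlFlow_of_le (hF : ControlledField F R L) {μ : Measure (ℝ × U)}
    (hμ : TimeDominated μ) {t₀ t : ℝ} (h : t ≤ t₀) (y : E) : controlFlow F t₀ y μ t = y := by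
  have := tendsto_picardIter hF hμ t₀ y t
  simp only [picardIter_of_le h] at this
  exact (tendsto_nhds_unique this tendsto_const_nhds)

lemma controlFlow_eq_picardMap (hF : ControlledField F R L) {μ : Measure (ℝ × U)}
    (hμ : TimeDominated μ) (t₀ : ℝ) (y : E) (t : ℝ) :
    controlFlow F t₀ y μ t = picardMap F t₀ y μ (controlFlow F t₀ y μ) t := by
  refine tendsto_nhds_unique ((Filter.tendsto_add_atTop_iff_nat 1).2
    (tendsto_picardIter hF hμ t₀ y t)) ?_
  simp only [picardIter_succ]
  have := hμ.isFiniteMeasure_restrict t₀ t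
  refine tendsto_const_nhds.add (tendsto_integral_of_dominated_convergence (fun _ => R)
    (fun n => (hF.integrableOn hμ (continuous_picardIter hF hμ t₀ y n) t₀ t).1)
    (integrable_const _) (fun n => Filter.Eventually.of_forall fun p => hF.bound _ _ _)
    (Filter.Eventually.of_forall fun p => ?_))
  have hc : Continuous fun x => F p.1 x p.2 :=
    hF.cont.comp (continuous_const.prodMk (continuous_id.prodMk continuous_const))
  exact (hc.tendsto _).comp (tendsto_picardIter hF hμ t₀ y p.1)

lemma isControlSol_controlFlow (hF : ControlledField F R L) {μ : Measure (ℝ × U)}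
    (hμ : TimeDominated μ) (t₀ : ℝ) (y : E) : IsControlSol F t₀ y μ (controlFlow F t₀ y μ) :=
  ⟨continuous_controlFlow hF hμ t₀ y, fun t _ => controlFlow_eq_picardMap hF hμ t₀ y t⟩

lemma IsControlSol.eq_controlFlow (hF : ControlledField F R L) {μ : Measure (ℝ × U)}
    (hμ : TimeDominated μ) {t₀ : ℝ} {y : E} {γ : ℝ → E} (hγ : IsControlSol F t₀ y μ γ)
    {t : ℝ} (ht : t₀ ≤ t) : γ t = controlFlow F t₀ y μ t := by
  refine tendsto_nhds_unique ?_ (tendsto_picardIter hF hμ t₀ y t)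
  rw [tendsto_iff_norm_sub_tendsto_zero]
  refine squeeze_zero (fun _ => norm_nonneg _)
    (fun n => norm_picardIter_sub_sol_le hF hμ hγ n ht) ?_
  have h : Filter.Tendsto (fun n : ℕ => ((1 : ℝ) / 2) ^ n) Filter.atTop (nhds 0) :=
    tendsto_pow_atTop_nhds_zero_of_lt_one (by norm_num) (by norm_num)
  simpa using (h.const_mul (R / (2 * L))).mul_const (Real.exp (2 * L * (t - t₀)))

lemma norm_picardIter_sub_controlFlow_le (hF : ControlledField F R L) {μ : Measure (ℝ × U)}
    (hμ : TimeDominated μ) {t₀ : ℝ} (y : E) (n : ℕ) {t : ℝ} (ht : t₀ ≤ t) :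
    ‖picardIter F t₀ y μ n t - controlFlow F t₀ y μ t‖
      ≤ R / (2 * L) * (1 / 2) ^ n * Real.exp (2 * L * (t - t₀)) :=
  norm_picardIter_sub_sol_le hF hμ (isControlSol_controlFlow hF hμ t₀ y) n ht

lemma norm_controlFlow_sub_controlFlow_le (hF : ControlledField F R L) {μ : Measure (ℝ × U)}
    (hμ : TimeDominated μ) {t₀ : ℝ} (y y' : E) {t : ℝ} (ht : t₀ ≤ t) :
    ‖controlFlow F t₀ y μ t - controlFlow F t₀ y' μ t‖
      ≤ ‖y - y'‖ * Real.exp (2 * L * (t - t₀)) := by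
  have hL := hF.L_pos
  have key : ∀ n t, t₀ ≤ t → ‖picardIter F t₀ y μ n t - picardIter F t₀ y' μ n t‖
      ≤ ‖y - y'‖ * Real.exp (2 * L * (t - t₀)) := by
    intro n
    induction n with
    | zero =>
      intro t ht
      exact le_mul_of_one_le_right (norm_nonneg _)
        (Real.one_le_exp (mul_nonneg (by positivity) (sub_nonneg.2 ht)))
    | succ n ih =>
      intro t ht
      rw [picardIter_succ, picardIter_succ]
      refine (norm_picardMap_sub_picardMap_le hF hμ (continuous_picardIter hF hμ _ _ _)
        (continuous_picardIter hF hμ _ _ _) y y' (norm_nonneg _) ht ih).trans ?_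
      have := Real.one_le_exp (mul_nonneg (by positivity : 0 ≤ 2 * L) (sub_nonneg.2 ht))
      nlinarith [norm_nonneg (y - y')]
  exact le_of_tendsto' ((tendsto_picardIter hF hμ t₀ y t).sub
    (tendsto_picardIter hF hμ t₀ y' t)).norm fun n => key n t ht

end CaratheodoryFlow

section ValueFunction

variable {E U : Type*} [NormedAddCommGroup E] [NormedSpace ℝ E] [MeasurableSpace U]

/-- The control that follows `μ` up to time `t₁` and `ν` afterwards. -/
def spliceControl (t₁ : ℝ) (μ ν : Measure (ℝ × U)) : Measure (ℝ × U) :=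
  μ.restrict (Iic t₁ ×ˢ univ) + ν.restrict (Ioi t₁ ×ˢ univ)

lemma spliceControl_restrict_left {t₁ b : ℝ} (hb : b ≤ t₁) (a : ℝ) (μ ν : Measure (ℝ × U)) :
    (spliceControl t₁ μ ν).restrict (Ioc a b ×ˢ univ) = μ.restrict (Ioc a b ×ˢ univ) := by
  have hm : MeasurableSet (Ioc a b ×ˢ univ : Set (ℝ × U)) :=
    measurableSet_Ioc.prod MeasurableSet.univ
  have h1 : (Ioc a b ×ˢ univ ∩ Iic t₁ ×ˢ univ : Set (ℝ × U)) = Ioc a b ×ˢ univ := by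
    ext p; simp only [mem_inter_iff, mem_prod, mem_Ioc, mem_Iic, mem_univ, and_true]
    exact ⟨fun h => h.1, fun h => ⟨h, h.2.trans hb⟩⟩
  have h2 : (Ioc a b ×ˢ univ ∩ Ioi t₁ ×ˢ univ : Set (ℝ × U)) = ∅ := by
    ext p; simp only [mem_inter_iff, mem_prod, mem_Ioc, mem_Ioi, mem_univ, and_true,
      mem_empty_iff_false, iff_false, not_and, not_lt]
    exact fun h => h.2.trans hb
  rw [spliceControl, Measure.restrict_add, Measure.restrict_restrict hm,
    Measure.restrict_restrict hm, h1, h2, Measure.restrict_empty, add_zero]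

lemma spliceControl_restrict_right {t₁ a : ℝ} (ha : t₁ ≤ a) (b : ℝ) (μ ν : Measure (ℝ × U)) :
    (spliceControl t₁ μ ν).restrict (Ioc a b ×ˢ univ) = ν.restrict (Ioc a b ×ˢ univ) := by
  have hm : MeasurableSet (Ioc a b ×ˢ univ : Set (ℝ × U)) :=
    measurableSet_Ioc.prod MeasurableSet.univ
  have h1 : (Ioc a b ×ˢ univ ∩ Ioi t₁ ×ˢ univ : Set (ℝ × U)) = Ioc a b ×ˢ univ := by
    ext p; simp only [mem_inter_iff, mem_prod, mem_Ioc, mem_Ioi, mem_univ, and_true]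
    exact ⟨fun h => h.1, fun h => ⟨h, ha.trans_lt h.1⟩⟩
  have h2 : (Ioc a b ×ˢ univ ∩ Iic t₁ ×ˢ univ : Set (ℝ × U)) = ∅ := by
    ext p; simp only [mem_inter_iff, mem_prod, mem_Ioc, mem_Iic, mem_univ, and_true,
      mem_empty_iff_false, iff_false, not_and, not_le]
    exact fun h => ha.trans_lt h.1
  rw [spliceControl, Measure.restrict_add, Measure.restrict_restrict hm,
    Measure.restrict_restrict hm, h1, h2, Measure.restrict_empty, zero_add]

lemma map_fst_restrict_prod_univ (μ : Measure (ℝ × U)) {S : Set ℝ} (hS : MeasurableSet S) :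
    (μ.restrict (S ×ˢ univ)).map Prod.fst = (μ.map Prod.fst).restrict S := by
  have : (S ×ˢ univ : Set (ℝ × U)) = Prod.fst ⁻¹' S := by ext; simp
  rw [this, Measure.restrict_map measurable_fst hS]

lemma map_fst_spliceControl {μ ν : Measure (ℝ × U)} (t₁ : ℝ) (hμ : μ.map Prod.fst = volume)
    (hν : ν.map Prod.fst = volume) : (spliceControl t₁ μ ν).map Prod.fst = volume := by
  rw [spliceControl, Measure.map_add _ _ measurable_fst,
    map_fst_restrict_prod_univ _ measurableSet_Iic, map_fst_restrict_prod_univ _ measurableSet_Ioi,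
    hμ, hν, ← compl_Iic, Measure.restrict_add_restrict_compl measurableSet_Iic]

/-- The control that is constantly equal to `u`. -/
def constControl (u : U) : Measure (ℝ × U) := volume.map fun t : ℝ => (t, u)

lemma map_fst_constControl (u : U) : (constControl u).map Prod.fst = volume := by
  rw [constControl, Measure.map_map measurable_fst (by fun_prop)]
  exact Measure.map_id

lemma restrict_prod_univ_congr {μ ν : Measure (ℝ × U)} {t₀ b t : ℝ}
    (h : μ.restrict (Ioc t₀ b ×ˢ univ) = ν.restrict (Ioc t₀ b ×ˢ univ)) (ht : t ≤ b) :
    μ.restrict (Ioc t₀ t ×ˢ univ) = ν.restrict (Ioc t₀ t ×ˢ univ) := by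
  have hm : MeasurableSet (Ioc t₀ t ×ˢ univ : Set (ℝ × U)) :=
    measurableSet_Ioc.prod MeasurableSet.univ
  have hs : (Ioc t₀ t ×ˢ univ : Set (ℝ × U)) ∩ Ioc t₀ b ×ˢ univ = Ioc t₀ t ×ˢ univ :=
    inter_eq_left.2 (prod_mono (Ioc_subset_Ioc_right ht) le_rfl)
  rw [← hs, ← Measure.restrict_restrict hm, h, Measure.restrict_restrict hm]

lemma picardMap_congr {F : ℝ → E → U → E} {μ ν : Measure (ℝ × U)} {t₀ t : ℝ} (y : E)
    (h : μ.restrict (Ioc t₀ t ×ˢ univ) = ν.restrict (Ioc t₀ t ×ˢ univ)) {γ γ' : ℝ → E}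
    (hγ : ∀ τ ∈ Ioc t₀ t, γ τ = γ' τ) : picardMap F t₀ y μ γ t = picardMap F t₀ y ν γ' t := by
  rw [picardMap, picardMap, h]
  congr 1
  refine setIntegral_congr_fun (measurableSet_Ioc.prod MeasurableSet.univ) fun p hp => ?_
  exact congrArg (fun z => F p.1 z p.2) (hγ p.1 hp.1)

lemma picardIter_congr {F : ℝ → E → U → E} {μ ν : Measure (ℝ × U)} {t₀ b : ℝ} (y : E)
    (h : μ.restrict (Ioc t₀ b ×ˢ univ) = ν.restrict (Ioc t₀ b ×ˢ univ)) (n : ℕ) {t : ℝ}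
    (ht : t ≤ b) : picardIter F t₀ y μ n t = picardIter F t₀ y ν n t := by
  induction n generalizing t with
  | zero => rw [picardIter_zero, picardIter_zero]
  | succ n ih =>
    rw [picardIter_succ, picardIter_succ]
    exact picardMap_congr y (restrict_prod_univ_congr h ht) fun τ hτ => ih (hτ.2.trans ht)

lemma TimeDominated.of_eq {μ : Measure (ℝ × U)} (h : μ.map Prod.fst = volume) :
    TimeDominated μ := h.le

variable [TopologicalSpace U] [BorelSpace U] [SecondCountableTopology U]
  [FiniteDimensional ℝ E]
variable {F : ℝ → E → U → E} {R L : ℝ}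

lemma controlFlow_congr (hF : ControlledField F R L) {μ ν : Measure (ℝ × U)}
    (hμ : TimeDominated μ) (hν : TimeDominated ν) {t₀ b : ℝ} (y : E)
    (h : μ.restrict (Ioc t₀ b ×ˢ univ) = ν.restrict (Ioc t₀ b ×ˢ univ)) {t : ℝ} (ht : t ≤ b) :
    controlFlow F t₀ y μ t = controlFlow F t₀ y ν t :=
  tendsto_nhds_unique ((tendsto_picardIter hF hμ t₀ y t).congr fun n => picardIter_congr y h n ht)
    (tendsto_picardIter hF hν t₀ y t)

lemma controlFlow_semigroup (hF : ControlledField F R L) {μ : Measure (ℝ × U)}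
    (hμ : TimeDominated μ) {t₀ t₁ t : ℝ} (y : E) (h₁ : t₀ ≤ t₁) (ht : t₁ ≤ t) :
    controlFlow F t₁ (controlFlow F t₀ y μ t₁) μ t = controlFlow F t₀ y μ t := by
  refine (IsControlSol.eq_controlFlow hF hμ ⟨continuous_controlFlow hF hμ t₀ y, ?_⟩ ht).symm
  intro τ hτ
  have h := picardMap_sub hF hμ (continuous_controlFlow hF hμ t₀ y) y h₁ hτ
  rw [← controlFlow_eq_picardMap hF hμ, ← controlFlow_eq_picardMap hF hμ] at h
  rw [picardMap, ← h]
  abel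

lemma constControl_timeDominated (u : U) : TimeDominated (constControl u) :=
  .of_eq (map_fst_constControl u)

lemma controlFlow_splice_left (hF : ControlledField F R L) {μ ν : Measure (ℝ × U)}
    (hμ : μ.map Prod.fst = volume) (hν : ν.map Prod.fst = volume) {t₀ t₁ t : ℝ} (y : E)
    (ht : t ≤ t₁) :
    controlFlow F t₀ y (spliceControl t₁ μ ν) t = controlFlow F t₀ y μ t :=
  controlFlow_congr hF (.of_eq (map_fst_spliceControl t₁ hμ hν)) (.of_eq hμ) y
    (spliceControl_restrict_left le_rfl _ _ _) ht

lemma controlFlow_splice_right (hF : ControlledField F R L) {μ ν : Measure (ℝ × U)}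
    (hμ : μ.map Prod.fst = volume) (hν : ν.map Prod.fst = volume) {t₁ t : ℝ} (y : E) :
    controlFlow F t₁ y (spliceControl t₁ μ ν) t = controlFlow F t₁ y ν t :=
  controlFlow_congr hF (.of_eq (map_fst_spliceControl t₁ hμ hν)) (.of_eq hν) y
    (spliceControl_restrict_right le_rfl _ _ _) le_rfl

/-- A running reward: a bounded Lipschitz function on space-time which vanishes outside of the
time interval `[s, r]` and outside of the ball of radius `A`. -/
structure RunningReward (φ : ℝ × E → ℝ) (s r ℓ M A : ℝ) : Prop where
  lip : ∀ p q, |φ p - φ q| ≤ ℓ * ‖p - q‖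
  bound : ∀ p, |φ p| ≤ M
  zero_time : ∀ t x, t ≤ s ∨ r ≤ t → φ (t, x) = 0
  zero_space : ∀ t x, A ≤ ‖x‖ → φ (t, x) = 0
  ell_nonneg : 0 ≤ ℓ
  M_nonneg : 0 ≤ M
  le : s ≤ r

variable {φ : ℝ × E → ℝ} {s r ℓ M A : ℝ}

lemma RunningReward.continuous (hφ : RunningReward φ s r ℓ M A) : Continuous φ := by
  refine (LipschitzWith.of_dist_le_mul (K := ℓ.toNNReal) fun a b => ?_).continuous
  rw [Real.dist_eq, dist_eq_norm, Real.coe_toNNReal _ hφ.ell_nonneg]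
  exact hφ.lip a b

/-- The reward collected along a controlled trajectory. -/
def reward (F : ℝ → E → U → E) (φ : ℝ × E → ℝ) (r t : ℝ) (x : E) (μ : Measure (ℝ × U)) : ℝ :=
  ∫ τ in t..r, φ (τ, controlFlow F t x μ τ)

lemma RunningReward.continuous_comp (hφ : RunningReward φ s r ℓ M A) (hF : ControlledField F R L)
    {μ : Measure (ℝ × U)} (hμ : TimeDominated μ) (t : ℝ) (x : E) :
    Continuous fun τ => φ (τ, controlFlow F t x μ τ) :=
  hφ.continuous.comp (continuous_id.prodMk (continuous_controlFlow hF hμ t x))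

lemma reward_split (hφ : RunningReward φ s r ℓ M A) (hF : ControlledField F R L)
    {μ : Measure (ℝ × U)} (hμ : TimeDominated μ) {t t₁ : ℝ} (x : E) (ht : t ≤ t₁) :
    reward F φ r t x μ = (∫ τ in t..t₁, φ (τ, controlFlow F t x μ τ)) +
      reward F φ r t₁ (controlFlow F t x μ t₁) μ := by
  rw [reward, ← intervalIntegral.integral_add_adjacent_intervals (b := t₁)
    ((hφ.continuous_comp hF hμ t x).intervalIntegrable _ _)
    ((hφ.continuous_comp hF hμ t x).intervalIntegrable _ _)]
  congr 1
  refine intervalIntegral.integral_congr fun τ hτ => ?_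
  rcases le_total t₁ r with h | h
  · rw [uIcc_of_le h] at hτ
    rw [controlFlow_semigroup hF hμ x ht hτ.1]
  · rw [uIcc_of_ge h] at hτ
    rw [hφ.zero_time _ _ (Or.inr hτ.1), hφ.zero_time _ _ (Or.inr hτ.1)]

lemma reward_of_ge (hφ : RunningReward φ s r ℓ M A) {t : ℝ} (h : r ≤ t) (x : E)
    (μ : Measure (ℝ × U)) : reward F φ r t x μ = 0 := by
  rw [reward, intervalIntegral.integral_congr (g := fun _ => 0), intervalIntegral.integral_zero]
  intro τ hτ
  rw [uIcc_of_ge h] at hτ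
  exact hφ.zero_time _ _ (Or.inr hτ.1)

lemma RunningReward.abs_integral_le (hφ : RunningReward φ s r ℓ M A) (γ : ℝ → E) {a b : ℝ}
    (hab : a ≤ b) : |∫ τ in a..b, φ (τ, γ τ)| ≤ M * (b - a) := by
  have := intervalIntegral.norm_integral_le_of_norm_le_const (a := a) (b := b) (C := M)
    (f := fun τ => φ (τ, γ τ)) fun τ _ => hφ.bound _
  rwa [abs_of_nonneg (sub_nonneg.2 hab), Real.norm_eq_abs] at this

lemma abs_reward_le (hφ : RunningReward φ s r ℓ M A) {t : ℝ} (hs : s ≤ t) (x : E)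
    (μ : Measure (ℝ × U)) : |reward F φ r t x μ| ≤ M * (r - s) := by
  rcases le_total t r with h | h
  · refine (hφ.abs_integral_le _ h).trans (mul_le_mul_of_nonneg_left (by linarith) hφ.M_nonneg)
  · rw [reward_of_ge hφ h, abs_zero]
    exact mul_nonneg hφ.M_nonneg (sub_nonneg.2 hφ.le)

lemma reward_lip (hφ : RunningReward φ s r ℓ M A) (hF : ControlledField F R L)
    {μ : Measure (ℝ × U)} (hμ : TimeDominated μ) {t : ℝ} (hs : s ≤ t) (x x' : E) :
    |reward F φ r t x μ - reward F φ r t x' μ|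
      ≤ ℓ * Real.exp (2 * L * (r - s)) * (r - s) * ‖x - x'‖ := by
  have hl := hφ.ell_nonneg
  have hrs := sub_nonneg.2 hφ.le
  have hL := hF.L_pos
  rcases le_total t r with h | h
  · rw [reward, reward, ← intervalIntegral.integral_sub
      ((hφ.continuous_comp hF hμ t x).intervalIntegrable _ _)
      ((hφ.continuous_comp hF hμ t x').intervalIntegrable _ _)]
    have := intervalIntegral.norm_integral_le_of_norm_le_const (a := t) (b := r)
      (C := ℓ * (‖x - x'‖ * Real.exp (2 * L * (r - s))))
      (f := fun τ => φ (τ, controlFlow F t x μ τ) - φ (τ, controlFlow F t x' μ τ)) fun τ hτ => by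
        rw [uIoc_of_le h] at hτ
        refine (hφ.lip _ _).trans (mul_le_mul_of_nonneg_left ?_ hl)
        rw [Prod.mk_sub_mk, sub_self, Prod.norm_mk, norm_zero, max_eq_right (norm_nonneg _)]
        refine (norm_controlFlow_sub_controlFlow_le hF hμ x x' hτ.1.le).trans ?_
        gcongr
        exact hτ.2
    rw [abs_of_nonneg (sub_nonneg.2 h), Real.norm_eq_abs] at this
    refine this.trans ?_
    calc ℓ * (‖x - x'‖ * Real.exp (2 * L * (r - s))) * (r - t)
        ≤ ℓ * (‖x - x'‖ * Real.exp (2 * L * (r - s))) * (r - s) := by gcongr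
      _ = _ := by ring
  · rw [reward_of_ge hφ h, reward_of_ge hφ h, sub_self, abs_zero]
    positivity

lemma reward_eq_zero (hφ : RunningReward φ s r ℓ M A) (hF : ControlledField F R L)
    {μ : Measure (ℝ × U)} (hμ : TimeDominated μ) {t : ℝ} (hs : s ≤ t) {x : E}
    (hx : A + R * (r - s) ≤ ‖x‖) : reward F φ r t x μ = 0 := by
  rcases le_total t r with h | h
  · rw [reward, intervalIntegral.integral_congr (g := fun _ => 0), intervalIntegral.integral_zero]
    intro τ hτ
    rw [uIcc_of_le h] at hτ
    refine hφ.zero_space _ _ ?_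
    have h1 := norm_controlFlow_sub_le hF hμ t x t τ
    rw [controlFlow_of_le hF hμ le_rfl, abs_of_nonneg (sub_nonneg.2 hτ.1)] at h1
    have h2 : R * (τ - t) ≤ R * (r - s) :=
      mul_le_mul_of_nonneg_left (by linarith [hτ.2]) hF.R_nonneg
    have h3 := norm_sub_norm_le x (controlFlow F t x μ τ)
    rw [norm_sub_rev] at h3
    linarith
  · exact reward_of_ge hφ h x μ

/-- The value function of the problem of maximizing the collected reward. -/
def valueFun (F : ℝ → E → U → E) (φ : ℝ × E → ℝ) (r t : ℝ) (x : E) : ℝ :=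
  ⨆ μ : {μ : Measure (ℝ × U) // μ.map Prod.fst = volume}, reward F φ r t x μ

/-- The Lipschitz constant of the value function in the state variable. -/
def valueLip (ℓ L s r : ℝ) : ℝ := ℓ * Real.exp (2 * L * (r - s)) * (r - s)

instance [Nonempty U] : Nonempty {μ : Measure (ℝ × U) // μ.map Prod.fst = volume} :=
  ⟨⟨constControl (Classical.arbitrary U), map_fst_constControl _⟩⟩

lemma bddAbove_reward (hφ : RunningReward φ s r ℓ M A) {t : ℝ} (hs : s ≤ t) (x : E) :
    BddAbove (range fun μ : {μ : Measure (ℝ × U) // μ.map Prod.fst = volume} =>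
      reward F φ r t x μ) := by
  refine ⟨M * (r - s), ?_⟩
  rintro _ ⟨μ, rfl⟩
  exact (le_abs_self _).trans (abs_reward_le hφ hs x _)

lemma reward_le_valueFun (hφ : RunningReward φ s r ℓ M A) {t : ℝ} (hs : s ≤ t) (x : E)
    {μ : Measure (ℝ × U)} (hμ : μ.map Prod.fst = volume) :
    reward F φ r t x μ ≤ valueFun F φ r t x :=
  le_ciSup (bddAbove_reward hφ hs x)
    (⟨μ, hμ⟩ : {μ : Measure (ℝ × U) // μ.map Prod.fst = volume})

variable [Nonempty U]

lemma valueFun_le {t : ℝ} {x : E} {c : ℝ}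
    (h : ∀ μ : Measure (ℝ × U), μ.map Prod.fst = volume → reward F φ r t x μ ≤ c) :
    valueFun F φ r t x ≤ c :=
  ciSup_le fun μ => h μ.1 μ.2

lemma valueFun_of_ge (hφ : RunningReward φ s r ℓ M A) {t : ℝ} (h : r ≤ t) (x : E) :
    valueFun F φ r t x = 0 := by
  simp [valueFun, reward_of_ge hφ h]

lemma valueFun_eq_zero (hφ : RunningReward φ s r ℓ M A) (hF : ControlledField F R L)
    {t : ℝ} (hs : s ≤ t) {x : E} (hx : A + R * (r - s) ≤ ‖x‖) : valueFun F φ r t x = 0 := by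
  have : ∀ μ : {μ : Measure (ℝ × U) // μ.map Prod.fst = volume}, reward F φ r t x μ = 0 :=
    fun μ => reward_eq_zero hφ hF (.of_eq μ.2) hs hx
  simp [valueFun, this]

lemma valueFun_dpp (hφ : RunningReward φ s r ℓ M A) (hF : ControlledField F R L)
    {μ : Measure (ℝ × U)} (hμ : μ.map Prod.fst = volume) {t t₁ : ℝ} (hs : s ≤ t) (x : E)
    (ht : t ≤ t₁) :
    (∫ τ in t..t₁, φ (τ, controlFlow F t x μ τ)) + valueFun F φ r t₁ (controlFlow F t x μ t₁)
      ≤ valueFun F φ r t x := by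
  rw [← le_sub_iff_add_le']
  refine valueFun_le fun ν hν => ?_
  rw [le_sub_iff_add_le']
  have hsp := map_fst_spliceControl t₁ hμ hν
  refine le_trans (le_of_eq ?_) (reward_le_valueFun hφ hs x hsp)
  rw [reward_split hφ hF (.of_eq hsp) x ht, controlFlow_splice_left hF hμ hν x le_rfl]
  congr 1
  · refine intervalIntegral.integral_congr fun τ hτ => ?_
    rw [uIcc_of_le ht] at hτ
    rw [controlFlow_splice_left hF hμ hν x hτ.2]
  · simp only [reward, controlFlow_splice_right hF hμ hν]

lemma valueFun_sub_le (hφ : RunningReward φ s r ℓ M A) (hF : ControlledField F R L)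
    {t : ℝ} (hs : s ≤ t) (x x' : E) :
    valueFun F φ r t x - valueFun F φ r t x' ≤ valueLip ℓ L s r * ‖x - x'‖ := by
  rw [sub_le_iff_le_add]
  refine valueFun_le fun μ hμ => ?_
  have h1 := le_of_abs_le (reward_lip hφ hF (.of_eq hμ) hs x x')
  have h2 := reward_le_valueFun (F := F) hφ hs x' hμ
  unfold valueLip
  linarith

lemma valueLip_nonneg (hφ : RunningReward φ s r ℓ M A) : 0 ≤ valueLip ℓ L s r :=
  mul_nonneg (mul_nonneg hφ.ell_nonneg (Real.exp_pos _).le) (sub_nonneg.2 hφ.le)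

lemma abs_valueFun_sub_time_le (hφ : RunningReward φ s r ℓ M A) (hF : ControlledField F R L)
    {t t₁ : ℝ} (hs : s ≤ t) (ht : t ≤ t₁) (x : E) :
    |valueFun F φ r t x - valueFun F φ r t₁ x| ≤ (M + valueLip ℓ L s r * R) * (t₁ - t) := by
  have key : ∀ μ : Measure (ℝ × U), μ.map Prod.fst = volume →
      valueLip ℓ L s r * ‖controlFlow F t x μ t₁ - x‖ ≤ valueLip ℓ L s r * (R * (t₁ - t)) := by
    intro μ hμ
    have h3 := norm_controlFlow_sub_le hF (.of_eq hμ) t x t t₁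
    rw [controlFlow_of_le hF (.of_eq hμ) le_rfl, abs_of_nonneg (sub_nonneg.2 ht)] at h3
    exact mul_le_mul_of_nonneg_left h3 (valueLip_nonneg hφ)
  rw [abs_sub_le_iff]
  constructor
  · rw [sub_le_iff_le_add]
    refine valueFun_le fun μ hμ => ?_
    rw [reward_split hφ hF (.of_eq hμ) x ht]
    have h1 := le_of_abs_le (hφ.abs_integral_le (controlFlow F t x μ) ht)
    have h2 := reward_le_valueFun (F := F) hφ (hs.trans ht) (controlFlow F t x μ t₁) hμ
    have h3 := valueFun_sub_le hφ hF (hs.trans ht) (controlFlow F t x μ t₁) x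
    linarith [key μ hμ]
  · have u := Classical.arbitrary U
    have hμ := map_fst_constControl u
    have h0 := valueFun_dpp hφ hF hμ hs x ht
    have h1 := neg_le_of_abs_le (hφ.abs_integral_le (controlFlow F t x (constControl u)) ht)
    have h3 := valueFun_sub_le hφ hF (hs.trans ht) x (controlFlow F t x (constControl u) t₁)
    rw [norm_sub_rev] at h3
    linarith [key _ hμ]

/-- The Lipschitz constant of the value function in space and time. -/
def valueLip' (ℓ L s r M R : ℝ) : ℝ := valueLip ℓ L s r + (M + valueLip ℓ L s r * R)

lemma valueLip'_nonneg (hφ : RunningReward φ s r ℓ M A) (hR : 0 ≤ R) :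
    0 ≤ valueLip' ℓ L s r M R := by
  have hV := valueLip_nonneg (L := L) hφ
  have hM := hφ.M_nonneg
  unfold valueLip'
  positivity

lemma abs_valueFun_sub_le (hφ : RunningReward φ s r ℓ M A) (hF : ControlledField F R L)
    (p q : ℝ × E) : |valueFun F φ r (max s p.1) p.2 - valueFun F φ r (max s q.1) q.2|
      ≤ valueLip' ℓ L s r M R * ‖p - q‖ := by
  have hV := valueLip_nonneg (L := L) hφ
  have hR := hF.R_nonneg
  have hM := hφ.M_nonneg
  have h1 : |valueFun F φ r (max s p.1) p.2 - valueFun F φ r (max s p.1) q.2|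
      ≤ valueLip ℓ L s r * ‖p - q‖ := by
    have hle : valueLip ℓ L s r * ‖p.2 - q.2‖ ≤ valueLip ℓ L s r * ‖p - q‖ :=
      mul_le_mul_of_nonneg_left (norm_snd_le (p - q)) hV
    rw [abs_sub_le_iff]
    refine ⟨(valueFun_sub_le hφ hF (le_max_left _ _) _ _).trans hle, ?_⟩
    refine (valueFun_sub_le hφ hF (le_max_left _ _) _ _).trans ?_
    rwa [norm_sub_rev]
  have h2 : |valueFun F φ r (max s p.1) q.2 - valueFun F φ r (max s q.1) q.2|
      ≤ (M + valueLip ℓ L s r * R) * ‖p - q‖ := by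
    have h3 : |max s p.1 - max s q.1| ≤ ‖p - q‖ :=
      by
      rw [max_comm s, max_comm s]
      exact (abs_max_sub_max_le_abs p.1 q.1 s).trans (norm_fst_le (p - q))
    have hc : 0 ≤ M + valueLip ℓ L s r * R := by positivity
    rcases le_total (max s p.1) (max s q.1) with h | h
    · refine (abs_valueFun_sub_time_le hφ hF (le_max_left _ _) h _).trans
        (mul_le_mul_of_nonneg_left ?_ hc)
      rw [abs_sub_comm, abs_of_nonneg (sub_nonneg.2 h)] at h3
      exact h3
    · rw [abs_sub_comm]
      refine (abs_valueFun_sub_time_le hφ hF (le_max_left _ _) h _).trans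
        (mul_le_mul_of_nonneg_left ?_ hc)
      rw [abs_of_nonneg (sub_nonneg.2 h)] at h3
      exact h3
  calc _ ≤ _ := abs_sub_le _ (valueFun F φ r (max s p.1) q.2) _
    _ ≤ _ := add_le_add h1 h2
    _ = _ := by rw [valueLip']; ring

end ValueFunction

section Mollification

open scoped Convolution

lemma exists_contDiff_approx {G : Type*} [NormedAddCommGroup G] [NormedSpace ℝ G]
    [FiniteDimensional ℝ G] {V : G → ℝ} {Λ : ℝ} (hΛ : 0 ≤ Λ)
    (hV : ∀ p q, |V p - V q| ≤ Λ * ‖p - q‖) {ε : ℝ} (hε : 0 < ε) :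
    ∃ W : G → ℝ, ContDiff ℝ 1 W ∧ (∀ p, |W p - V p| ≤ Λ * ε) ∧
      (∀ p w c h₀, 0 < h₀ → (∀ q, ‖q - p‖ < ε → ∀ h, 0 < h → h < h₀ →
        V (q + h • w) - V q ≤ h * c) → fderiv ℝ W p w ≤ c) ∧
      (∀ p, (∀ q, ‖q - p‖ < ε → V q = 0) → W p = 0) := by
  let _ : MeasurableSpace G := borel G
  have : BorelSpace G := ⟨rfl⟩
  have hVc : Continuous V := by
    refine (LipschitzWith.of_dist_le_mul (K := Λ.toNNReal) fun a b => ?_).continuous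
    rw [Real.dist_eq, dist_eq_norm, Real.coe_toNNReal _ hΛ]
    exact hV a b
  let μ : Measure G := Measure.addHaar
  let ρ : ContDiffBump (0 : G) := ⟨ε / 2, ε, half_pos hε, half_lt_self hε⟩
  let k : G → ℝ := ρ.normed μ
  have hk0 : ∀ z, 0 ≤ k z := fun z => ρ.nonneg_normed z
  have hk1 : ∫ z, k z ∂μ = 1 := ρ.integral_normed
  have hks : ∀ z, ε ≤ ‖z‖ → k z = 0 := by
    intro z hz
    by_contra h
    have : z ∈ Function.support k := h
    rw [ρ.support_normed_eq, mem_ball_zero_iff] at this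
    exact absurd this (not_lt.2 hz)
  have hkc : Continuous k := ρ.continuous_normed
  have hkcs : HasCompactSupport k := ρ.hasCompactSupport_normed
  have hki : ∀ g : G → ℝ, Continuous g → Integrable (fun z => k z * g z) μ := fun g hg =>
    (hkc.mul hg).integrable_of_hasCompactSupport hkcs.mul_right
  have hmono : ∀ g g' : G → ℝ, Continuous g → Continuous g' →
      (∀ z, ‖z‖ < ε → g z ≤ g' z) → ∫ z, k z * g z ∂μ ≤ ∫ z, k z * g' z ∂μ := by
    intro g g' hg hg' h
    refine integral_mono (hki g hg) (hki g' hg') fun z => ?_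
    rcases lt_or_ge ‖z‖ ε with hz | hz
    · exact mul_le_mul_of_nonneg_left (h z hz) (hk0 z)
    · simp [hks z hz]
  have hconst : ∀ c : ℝ, ∫ z, k z * c ∂μ = c := fun c => by
    rw [integral_mul_const, hk1, one_mul]
  let W : G → ℝ := fun p => ∫ z, k z * V (p - z) ∂μ
  have hWV : ∀ p, Continuous fun z => V (p - z) := fun p =>
    hVc.comp (continuous_const.sub continuous_id)
  have hW1 : ContDiff ℝ 1 W :=
    hkcs.contDiff_convolution_left (ContinuousLinearMap.lsmul ℝ ℝ) (μ := μ) (n := 1)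
      ρ.contDiff_normed hVc.locallyIntegrable
  refine ⟨W, hW1, fun p => ?_, fun p w c h₀ hh₀ h => ?_, fun p h => ?_⟩
  · have h1 : ∀ z, ‖z‖ < ε → |V (p - z) - V p| ≤ Λ * ε := fun z hz => by
      refine (hV _ _).trans (mul_le_mul_of_nonneg_left ?_ hΛ)
      simpa using hz.le
    rw [abs_le]
    constructor
    · have := hmono (fun _ => V p - Λ * ε) (fun z => V (p - z)) continuous_const (hWV p)
        fun z hz => by linarith [neg_le_of_abs_le (h1 z hz)]
      rw [hconst] at this
      change _ ≤ W p at this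
      linarith
    · have := hmono (fun z => V (p - z)) (fun _ => V p + Λ * ε) (hWV p) continuous_const
        fun z hz => by linarith [le_of_abs_le (h1 z hz)]
      rw [hconst] at this
      change W p ≤ _ at this
      linarith
  · have hd : HasDerivAt (fun h : ℝ => W (p + h • w)) (fderiv ℝ W p w) 0 := by
      have hW : HasFDerivAt W (fderiv ℝ W p) (p + (0 : ℝ) • w) := by
        rw [zero_smul, add_zero]
        exact ((hW1.differentiable one_ne_zero) p).hasFDerivAt
      have hl : HasDerivAt (fun h : ℝ => p + h • w) w 0 := by
        simpa using ((hasDerivAt_id (0 : ℝ)).smul_const w).const_add p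
      exact hW.comp_hasDerivAt 0 hl
    have ht := (hasDerivAt_iff_tendsto_slope.1 hd).mono_left
      (nhdsWithin_mono (0 : ℝ) (fun x hx => (mem_Ioi.1 hx).ne') :
        nhdsWithin (0 : ℝ) (Ioi 0) ≤ nhdsWithin (0 : ℝ) {0}ᶜ)
    refine le_of_tendsto ht ?_
    filter_upwards [Ioo_mem_nhdsGT hh₀] with h' hh'
    rw [slope_def_field, sub_zero, zero_smul, add_zero, div_le_iff₀ hh'.1]
    have h2 := hmono (fun z => V (p + h' • w - z)) (fun z => V (p - z) + h' * c) (hWV _)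
      ((hWV p).add continuous_const) fun z hz => by
        have := h (p - z) (by simpa using hz) h' hh'.1 hh'.2
        rw [sub_add_eq_add_sub] at this
        linarith
    have h3 : ∫ z, k z * (V (p - z) + h' * c) ∂μ = W p + h' * c := by
      simp only [mul_add]
      rw [integral_add (hki _ (hWV p)) (hki _ continuous_const), hconst]
    rw [h3] at h2
    change W (p + h' • w) ≤ _ at h2
    linarith
  · have : ∀ z, k z * V (p - z) = 0 := fun z => by
      rcases lt_or_ge ‖z‖ ε with hz | hz
      · rw [h (p - z) (by simpa using hz), mul_zero]
      · rw [hks z hz, zero_mul]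
    change ∫ z, k z * V (p - z) ∂μ = 0
    simp [this]

end Mollification

section LocalEstimate

variable {E U : Type*} [NormedAddCommGroup E] [NormedSpace ℝ E] [FiniteDimensional ℝ E]
  [MetricSpace U] [CompactSpace U] [MeasurableSpace U] [BorelSpace U] [Nonempty U]
variable {F : ℝ → E → U → E} {R L : ℝ} {φ : ℝ × E → ℝ} {s r ℓ M A : ℝ}

lemma norm_controlFlow_const_sub_le (hF : ControlledField F R L) (u : U) {t h : ℝ} (hh : 0 ≤ h)
    (x z : E) {e : ℝ} (hz : ∀ τ ∈ Ioc t (t + h), ∀ ξ, ‖ξ - x‖ ≤ R * h → ‖F τ ξ u - z‖ ≤ e) :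
    ‖x + h • z - controlFlow F t x (constControl u) (t + h)‖ ≤ e * h := by
  have hμ := constControl_timeDominated (U := U) u
  have hX := continuous_controlFlow hF hμ t x
  set X := controlFlow F t x (constControl u) with hXdef
  have hc : Continuous fun p : ℝ × U => F p.1 (X p.1) p.2 :=
    hF.cont.comp (continuous_fst.prodMk ((hX.comp continuous_fst).prodMk continuous_snd))
  have hcu : Continuous fun τ : ℝ => F τ (X τ) u := hc.comp (continuous_id.prodMk continuous_const)
  have hpre : (fun τ : ℝ => (τ, u)) ⁻¹' (Ioc t (t + h) ×ˢ univ) = Ioc t (t + h) := by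
    ext; simp
  have h1 : X (t + h) = x + ∫ τ in Ioc t (t + h), F τ (X τ) u := by
    rw [hXdef, controlFlow_eq_picardMap hF hμ, ← hXdef, picardMap, constControl,
      setIntegral_map (measurableSet_Ioc.prod MeasurableSet.univ) hc.aestronglyMeasurable
        (by fun_prop), hpre]
  have hvol : volume.real (Ioc t (t + h)) = h := by simp [hh]
  have h2 : ∫ τ in Ioc t (t + h), (F τ (X τ) u - z) =
      (∫ τ in Ioc t (t + h), F τ (X τ) u) - h • z := by
    rw [integral_sub (hcu.integrableOn_Icc.mono_set Ioc_subset_Icc_self) (by simp),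
      setIntegral_const, hvol]
  have h3 : x + h • z - X (t + h) = -∫ τ in Ioc t (t + h), (F τ (X τ) u - z) := by
    rw [h1, h2]; abel
  rw [h3, norm_neg]
  refine (norm_setIntegral_le_of_norm_le_const (C := e) (by simp) fun τ hτ => ?_).trans
    (by rw [hvol])
  refine hz τ hτ _ ?_
  have := norm_controlFlow_sub_le hF hμ t x t τ
  rw [controlFlow_of_le hF hμ le_rfl, abs_of_nonneg (sub_nonneg.2 hτ.1.le)] at this
  exact this.trans (mul_le_mul_of_nonneg_left (by linarith [hτ.2]) hF.R_nonneg)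

lemma valueFun_increment_le (hφ : RunningReward φ s r ℓ M A) (hF : ControlledField F R L)
    (u : U) {t h : ℝ} (hs : s ≤ t) (hh : 0 ≤ h) (x z : E) {a e e' : ℝ}
    (hz : ∀ τ ∈ Ioc t (t + h), ∀ ξ, ‖ξ - x‖ ≤ R * h → ‖F τ ξ u - z‖ ≤ e)
    (ha : ∀ τ ∈ Icc t (t + h), ∀ ξ, ‖ξ - x‖ ≤ R * h → a - e' ≤ φ (τ, ξ)) :
    valueFun F φ r (t + h) (x + h • z) - valueFun F φ r t x
      ≤ h * (-a + (e' + valueLip ℓ L s r * e)) := by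
  have hμ := constControl_timeDominated (U := U) u
  have h1 := valueFun_dpp hφ hF (map_fst_constControl u) hs x (le_add_of_nonneg_right hh)
  have h2 := valueFun_sub_le hφ hF (hs.trans (le_add_of_nonneg_right hh)) (x + h • z)
    (controlFlow F t x (constControl u) (t + h))
  have h3 := mul_le_mul_of_nonneg_left (norm_controlFlow_const_sub_le hF u hh x z hz)
    (valueLip_nonneg (L := L) hφ)
  have h4 : h * (a - e') ≤ ∫ τ in t..t + h, φ (τ, controlFlow F t x (constControl u) τ) := by
    have : ∫ _ in t..t + h, (a - e') = h * (a - e') := by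
      rw [intervalIntegral.integral_const, add_sub_cancel_left, smul_eq_mul]
    rw [← this]
    refine intervalIntegral.integral_mono_on (le_add_of_nonneg_right hh) (by simp)
      ((hφ.continuous_comp hF hμ t x).intervalIntegrable _ _) fun τ hτ => ha τ hτ _ ?_
    have := norm_controlFlow_sub_le hF hμ t x t τ
    rw [controlFlow_of_le hF hμ le_rfl, abs_of_nonneg (sub_nonneg.2 hτ.1)] at this
    exact this.trans (mul_le_mul_of_nonneg_left (by linarith [hτ.2]) hF.R_nonneg)
  linarith

lemma ControlledField.exists_modulus (hF : ControlledField F R L) (a b B : ℝ) {η : ℝ}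
    (hη : 0 < η) : ∃ δ > 0, ∀ t ∈ Icc a b, ∀ t' ∈ Icc a b, ∀ x x' : E, ‖x‖ ≤ B → ‖x'‖ ≤ B →
      |t - t'| < δ → ‖x - x'‖ < δ → ∀ u, ‖F t x u - F t' x' u‖ ≤ η := by
  have hK : IsCompact (Icc a b ×ˢ (Metric.closedBall (0 : E) B ×ˢ (univ : Set U))) :=
    isCompact_Icc.prod ((isCompact_closedBall 0 B).prod isCompact_univ)
  have := hK.uniformContinuousOn_of_continuous hF.cont.continuousOn
  rw [Metric.uniformContinuousOn_iff] at this
  obtain ⟨δ, hδ, h⟩ := this η hη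
  refine ⟨δ, hδ, fun t ht t' ht' x x' hx hx' htt hxx u => ?_⟩
  have := h (t, x, u) ⟨ht, by simpa using hx, mem_univ _⟩ (t', x', u)
    ⟨ht', by simpa using hx', mem_univ _⟩ (by
      rw [Prod.dist_eq, Prod.dist_eq, dist_self, Real.dist_eq, dist_eq_norm]
      simp [htt, hxx])
  rw [dist_eq_norm] at this
  exact this.le

lemma exists_valueFun_increment_le (hφ : RunningReward φ s r ℓ M A) (hF : ControlledField F R L)
    {b κ : ℝ} (hκ : 0 < κ) : ∃ ε₀ > 0, ∀ ε, 0 < ε → ε ≤ ε₀ → ∀ t x u, s + ε ≤ t → t ≤ b →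
      ∀ q : ℝ × E, ‖q - (t, x)‖ < ε → ∀ h, 0 < h → h < ε →
        valueFun F φ r (max s (q + h • ((1 : ℝ), F t x u)).1) (q + h • ((1 : ℝ), F t x u)).2
          - valueFun F φ r (max s q.1) q.2 ≤ h * (-φ (t, x) + κ) := by
  have hR := hF.R_nonneg
  have hl := hφ.ell_nonneg
  have hΛ := valueLip_nonneg (L := L) hφ
  set Λ := valueLip ℓ L s r with hΛdef
  set B := A + R * (r - s) + 2 with hB
  obtain ⟨δ, hδ, hmod⟩ := hF.exists_modulus s (b + 2) B (η := κ / (2 * (Λ + 1))) (by positivity)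
  set c := δ / (2 * (R + 2)) with hc
  set c' := κ / (2 * (R + 2) * (ℓ + 1)) with hc'
  refine ⟨min (1 / (R + 1)) (min c c'), by positivity, ?_⟩
  intro ε hε hε₀ t x u hst htb q hq h hh hhε
  have hε1 : ε * (R + 1) ≤ 1 := by
    rw [← le_div_iff₀ (by positivity)]; exact hε₀.trans (min_le_left _ _)
  have hε2 : ε * (2 * (R + 2)) ≤ δ := by
    rw [← le_div_iff₀ (by positivity)]
    exact hε₀.trans ((min_le_right _ _).trans (min_le_left _ _))
  have hε3 : ε * (2 * (R + 2) * (ℓ + 1)) ≤ κ := by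
    rw [← le_div_iff₀ (by positivity)]
    exact hε₀.trans ((min_le_right _ _).trans (min_le_right _ _))
  have hRε : 0 ≤ R * ε := mul_nonneg hR hε.le
  have hX : 0 ≤ R * ε + 2 * ε := by linarith
  have e1 : R * ε + ε ≤ 1 := by linarith
  have e2 : 2 * (R * ε) + 4 * ε ≤ δ := by linarith
  have e3 : ℓ * (R * ε + 2 * ε) ≤ κ / 2 := by
    have : ε * (2 * (R + 2) * (ℓ + 1)) = 2 * (ℓ * (R * ε + 2 * ε)) + 2 * (R * ε + 2 * ε) := by ring
    linarith
  clear hε1 hε2 hε3 hε₀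
  obtain ⟨t', x'⟩ := q
  rw [Prod.mk_sub_mk, Prod.norm_mk, max_lt_iff] at hq
  obtain ⟨hq1, hq2⟩ := hq
  rw [Real.norm_eq_abs, abs_lt] at hq1
  have hst' : s ≤ t' := by linarith
  have hFu := hF.bound t x u
  have hhF : ‖h • F t x u‖ ≤ R * ε := by
    rw [norm_smul, Real.norm_of_nonneg hh.le, mul_comm]
    exact mul_le_mul hFu hhε.le hh.le hR
  simp only [Prod.smul_mk, Prod.mk_add_mk, smul_eq_mul, mul_one]
  rw [max_eq_right hst', max_eq_right (by linarith : s ≤ t' + h)]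
  have hxx' := norm_sub_norm_le x x'
  rw [norm_sub_rev] at hxx'
  rcases le_total (A + R * (r - s) + 1) ‖x‖ with hx | hx
  · have hx1 : A + R * (r - s) ≤ ‖x'‖ := by linarith
    have hx2 : A + R * (r - s) ≤ ‖x' + h • F t x u‖ := by
      have := norm_sub_le_norm_add x' (h • F t x u)
      linarith
    have hx3 : A ≤ ‖x‖ := by
      have := mul_nonneg hR (sub_nonneg.2 hφ.le)
      linarith
    rw [valueFun_eq_zero hφ hF (by linarith) hx1, valueFun_eq_zero hφ hF (by linarith) hx2,
      hφ.zero_space _ _ hx3]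
    have := mul_pos hh hκ
    simp only [sub_zero, neg_zero, zero_add]
    exact this.le
  · have hball : ∀ ξ, ‖ξ - x'‖ ≤ R * h → ‖ξ - x‖ ≤ R * ε + ε := fun ξ hξ => by
      have h1 := norm_sub_le_norm_sub_add_norm_sub ξ x' x
      have h2 := mul_le_mul_of_nonneg_left hhε.le hR
      linarith
    have key := valueFun_increment_le hφ hF u hst' hh.le x' (F t x u) (a := φ (t, x))
      (e := κ / (2 * (Λ + 1))) (e' := κ / 2) ?_ ?_
    · refine key.trans (mul_le_mul_of_nonneg_left ?_ hh.le)
      have : Λ * (κ / (2 * (Λ + 1))) ≤ κ / 2 := by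
        rw [mul_div_assoc', div_le_div_iff₀ (by positivity) (by positivity)]
        nlinarith
      linarith
    · intro τ hτ ξ hξ
      have h1 := hball ξ hξ
      have h2 := norm_sub_norm_le ξ x
      refine hmod τ ⟨by linarith [hτ.1], by linarith [hτ.2]⟩ t ⟨by linarith, by linarith⟩ ξ x
        (by linarith) (by linarith) ?_ (by linarith) u
      rw [abs_lt]
      constructor <;> linarith [hτ.1, hτ.2]
    · intro τ hτ ξ hξ
      have h1 := hball ξ hξ
      have h3 : ‖((t, x) : ℝ × E) - (τ, ξ)‖ ≤ R * ε + 2 * ε := by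
        rw [Prod.mk_sub_mk, Prod.norm_mk, max_le_iff]
        refine ⟨?_, by rw [norm_sub_rev]; linarith⟩
        rw [Real.norm_eq_abs, abs_le]
        constructor <;> linarith [hτ.1, hτ.2]
      have h4 := le_of_abs_le (hφ.lip (t, x) (τ, ξ))
      have h5 := mul_le_mul_of_nonneg_left h3 hl
      linarith

end LocalEstimate

section KeyInequality

/-- A smooth step from `0` on `(-∞, a]` to `1` on `[a + δ, ∞)`. -/
def smoothStep (a δ t : ℝ) : ℝ := Real.smoothTransition ((t - a) / δ)

lemma smoothStep_contDiff (a δ : ℝ) : ContDiff ℝ 1 (smoothStep a δ) :=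
  Real.smoothTransition.contDiff.comp (by fun_prop)

lemma smoothStep_nonneg (a δ t : ℝ) : 0 ≤ smoothStep a δ t := Real.smoothTransition.nonneg _

lemma smoothStep_le_one (a δ t : ℝ) : smoothStep a δ t ≤ 1 := Real.smoothTransition.le_one _

lemma smoothStep_of_le {a δ t : ℝ} (hδ : 0 < δ) (h : t ≤ a) : smoothStep a δ t = 0 :=
  Real.smoothTransition.zero_of_nonpos (div_nonpos_of_nonpos_of_nonneg (by linarith) hδ.le)

lemma smoothStep_of_ge {a δ t : ℝ} (hδ : 0 < δ) (h : a + δ ≤ t) : smoothStep a δ t = 1 :=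
  Real.smoothTransition.one_of_one_le ((one_le_div hδ).2 (by linarith))

lemma monotone_smoothStep (a : ℝ) {δ : ℝ} (hδ : 0 < δ) : Monotone (smoothStep a δ) := by
  intro t t' h
  exact Real.smoothTransition.monotone (by gcongr)

lemma deriv_smoothStep_nonneg (a : ℝ) {δ : ℝ} (hδ : 0 < δ) (t : ℝ) :
    0 ≤ deriv (smoothStep a δ) t := (monotone_smoothStep a hδ).deriv_nonneg

lemma deriv_smoothStep_of_gt {a δ t : ℝ} (hδ : 0 < δ) (h : a + δ < t) :
    deriv (smoothStep a δ) t = 0 := by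
  have : smoothStep a δ =ᶠ[nhds t] fun _ => 1 := by
    filter_upwards [lt_mem_nhds h] with t' ht' using smoothStep_of_ge hδ ht'.le
  rw [this.deriv_eq, deriv_const]

variable {E U : Type*} [NormedAddCommGroup E] [NormedSpace ℝ E] [FiniteDimensional ℝ E]
  [MeasurableSpace E] [BorelSpace E]

lemma integrable_fderiv_of_bound {N : Measure (ℝ × E)} [IsFiniteMeasure N] {v : ℝ × E → E}
    (hvm : Measurable v) {R : ℝ} (hR : ∀ᵐ p ∂N, ‖v p‖ ≤ R) {ψ : ℝ × E → ℝ}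
    (hψ : ContDiff ℝ 1 ψ) (hψc : HasCompactSupport ψ) :
    Integrable (fun p => fderiv ℝ ψ p (1, v p)) N := by
  have hc : Continuous (fderiv ℝ ψ) := hψ.continuous_fderiv one_ne_zero
  obtain ⟨C, hC⟩ := hc.bounded_above_of_compact_support (hψc.fderiv (𝕜 := ℝ))
  have hm : Measurable fun p => fderiv ℝ ψ p (1, v p) := by
    have h1 : Continuous fun q : ((ℝ × E) →L[ℝ] ℝ) × (ℝ × E) => q.1 q.2 := by fun_prop
    exact h1.measurable.comp (hc.measurable.prodMk (measurable_const.prodMk hvm))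
  refine Integrable.of_bound (C := C * max 1 R) hm.aestronglyMeasurable ?_
  filter_upwards [hR] with p hp
  refine ((fderiv ℝ ψ p).le_opNorm _).trans ?_
  have : ‖((1 : ℝ), v p)‖ ≤ max 1 R := by
    rw [Prod.norm_mk, norm_one]; exact max_le_max le_rfl hp
  exact mul_le_mul (hC p) this (norm_nonneg _) ((norm_nonneg _).trans (hC p))

lemma isFiniteMeasure_of_map_fst_eq {X : Type*} [MeasurableSpace X] {N : Measure (ℝ × X)} {s r : ℝ}
    (hN : N.map Prod.fst = volume.restrict (Icc s r)) : IsFiniteMeasure N := by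
  constructor
  have : N univ = N.map Prod.fst univ := by
    rw [Measure.map_apply measurable_fst MeasurableSet.univ, preimage_univ]
  rw [this, hN]
  simp

variable [MetricSpace U] [CompactSpace U] [MeasurableSpace U] [BorelSpace U] [Nonempty U]
variable {F : ℝ → E → U → E} {R L : ℝ} {φ : ℝ × E → ℝ} {s r r₁ ℓ M A : ℝ}

/-- A measure on space-time which solves, in the weak sense, the continuity equation for a velocity
field selected from the convexified controlled field. -/
structure IsWeakSolution (F : ℝ → E → U → E) (s r : ℝ) (N : Measure (ℝ × E)) (v : ℝ × E → E) :
    Prop where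
  map_fst : N.map Prod.fst = volume.restrict (Icc s r)
  measurable : Measurable v
  mem_hull : ∀ S : Set (ℝ × E), MeasurableSet S →
    (∀ p, v p ∈ convexHull ℝ (range (F p.1 p.2)) → p ∈ S) → ∀ᵐ p ∂N, p ∈ S
  continuity : ∀ ψ : ℝ × E → ℝ, ContDiff ℝ 1 ψ → HasCompactSupport ψ →
    tsupport ψ ⊆ Ioo s r ×ˢ univ → ∫ p, fderiv ℝ ψ p (1, v p) ∂N = 0

namespace IsWeakSolution

variable {N : Measure (ℝ × E)} {v : ℝ × E → E}

lemma norm_le (hN : IsWeakSolution F s r N v) (hF : ControlledField F R L) :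
    ∀ᵐ p ∂N, ‖v p‖ ≤ R := by
  refine hN.mem_hull {p | ‖v p‖ ≤ R} (measurableSet_le hN.measurable.norm measurable_const) ?_
  intro p hp
  have : convexHull ℝ (range (F p.1 p.2)) ⊆ Metric.closedBall 0 R := by
    refine convexHull_min ?_ (convex_closedBall 0 R)
    rintro _ ⟨u, rfl⟩
    simpa using hF.bound p.1 p.2 u
  simpa using this hp

lemma integral_comp_fst (hN : IsWeakSolution F s r N v) {g : ℝ → ℝ} (hg : Continuous g) :
    ∫ p, g p.1 ∂N = ∫ t in Icc s r, g t := by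
  rw [← hN.map_fst, integral_map measurable_fst.aemeasurable hg.aestronglyMeasurable]

/-- If the reward of every controlled trajectory is at most `c` then so is the integral of the
reward against a weak solution. -/
theorem integral_le (hN : IsWeakSolution F s r N v) (hF : ControlledField F R L) (hsr : s < r)
    (hφ : RunningReward φ s r₁ ℓ M A) (hr₁ : r₁ < r) {δ₀ : ℝ} (hδ₀ : 0 < δ₀)
    (h0 : ∀ t x, t ≤ s + δ₀ → φ (t, x) = 0) {c : ℝ}
    (hc : ∀ y, ∀ μ : Measure (ℝ × U), μ.map Prod.fst = volume → reward F φ r₁ s y μ ≤ c) :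
    ∫ p, φ p ∂N ≤ c := by
  have : IsFiniteMeasure N := isFiniteMeasure_of_map_fst_eq hN.map_fst
  have hsr₁ := hφ.le
  have hRn := hF.R_nonneg
  suffices h : ∀ κ > 0, ∫ p, φ p ∂N ≤ c + κ * (1 + (r - s)) by
    refine le_of_forall_pos_le_add fun η hη => (h (η / (1 + (r - s))) (by
      have : 0 < 1 + (r - s) := by linarith
      positivity)).trans (le_of_eq ?_)
    have : 1 + (r - s) ≠ 0 := by linarith
    field_simp
  intro κ hκ
  set Λ := valueLip' ℓ L s r₁ M R with hΛdef
  have hΛ : 0 ≤ Λ := valueLip'_nonneg hφ hRn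
  set V : ℝ × E → ℝ := fun p => valueFun F φ r₁ (max s p.1) p.2 with hVdef
  obtain ⟨ε₀, hε₀, hinc⟩ := exists_valueFun_increment_le (b := r) hφ hF hκ
  set δ := min (min (δ₀ / 2) ((r - s) / 2)) (κ / (3 * (Λ + 1))) with hδdef
  have hδ : 0 < δ := by
    have : 0 < (r - s) / 2 := by linarith
    positivity
  have hδ1 : 2 * δ ≤ δ₀ := by
    have : δ ≤ δ₀ / 2 := (min_le_left _ _).trans (min_le_left _ _)
    linarith
  have hδ3 : s + 2 * δ ≤ r := by
    have : δ ≤ (r - s) / 2 := (min_le_left _ _).trans (min_le_right _ _)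
    linarith
  have hδ2 : Λ * (3 * δ) ≤ κ := by
    have : δ ≤ κ / (3 * (Λ + 1)) := min_le_right _ _
    rw [le_div_iff₀ (by positivity)] at this
    linarith
  set ε := min ε₀ (min δ ((r - r₁) / 2)) with hεdef
  have hε : 0 < ε := by
    have : 0 < (r - r₁) / 2 := by linarith
    positivity
  have hε1 : ε ≤ ε₀ := min_le_left _ _
  have hε2 : ε ≤ δ := (min_le_right _ _).trans (min_le_left _ _)
  have hε3 : ε ≤ (r - r₁) / 2 := (min_le_right _ _).trans (min_le_right _ _)
  obtain ⟨W, hW1, hWV, hWd, hW0⟩ :=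
    exists_contDiff_approx hΛ (abs_valueFun_sub_le hφ hF) hε
  set χ := smoothStep (s + δ) δ with hχdef
  have hχ1 : ContDiff ℝ 1 χ := smoothStep_contDiff _ _
  set ψ : ℝ × E → ℝ := fun p => χ p.1 * W p with hψdef
  have hψ1 : ContDiff ℝ 1 ψ := (hχ1.comp contDiff_fst).mul hW1
  have hψs : tsupport ψ ⊆
      Icc (s + δ) (r₁ + ε) ×ˢ Metric.closedBall (0 : E) (A + R * (r₁ - s) + ε) := by
    refine closure_minimal ?_ (isClosed_Icc.prod Metric.isClosed_closedBall)
    intro p hp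
    have hp1 : χ p.1 ≠ 0 := left_ne_zero_of_mul hp
    have hp2 : W p ≠ 0 := right_ne_zero_of_mul hp
    refine ⟨⟨?_, ?_⟩, ?_⟩
    · by_contra h
      exact hp1 (smoothStep_of_le hδ (not_le.1 h).le)
    · by_contra h
      refine hp2 (hW0 p fun q hq => valueFun_of_ge hφ (le_max_of_le_right ?_) _)
      have := (norm_fst_le (q - p)).trans_lt hq
      rw [Real.norm_eq_abs, Prod.fst_sub, abs_lt] at this
      linarith [not_le.1 h]
    · by_contra h
      refine hp2 (hW0 p fun q hq => valueFun_eq_zero hφ hF (le_max_left _ _) ?_)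
      have h1 := (norm_snd_le (q - p)).trans_lt hq
      rw [mem_closedBall_zero_iff, not_le] at h
      have h2 := norm_sub_norm_le p.2 q.2
      rw [norm_sub_rev] at h2
      rw [Prod.snd_sub] at h1
      linarith
  have hψc : HasCompactSupport ψ :=
    (isCompact_Icc.prod (isCompact_closedBall _ _)).of_isClosed_subset (isClosed_tsupport ψ) hψs
  have hψt : tsupport ψ ⊆ Ioo s r ×ˢ univ := hψs.trans
    (prod_mono (Icc_subset_Ioo (by linarith) (by linarith)) (subset_univ _))
  have hψd : ∀ p w, fderiv ℝ ψ p (1, w) = deriv χ p.1 * W p + χ p.1 * fderiv ℝ W p (1, w) := by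
    intro p w
    have h1 : HasFDerivAt (fun p : ℝ × E => χ p.1)
        (deriv χ p.1 • ContinuousLinearMap.fst ℝ ℝ E) p :=
      ((hχ1.differentiable one_ne_zero p.1).hasDerivAt).comp_hasFDerivAt p hasFDerivAt_fst
    have h2 := (hW1.differentiable one_ne_zero p).hasFDerivAt
    have h3 : HasFDerivAt ψ _ p := h1.mul h2
    rw [h3.fderiv]
    simp
    ring
  set M₀ := c + Λ * (3 * δ) with hM₀
  have hVc : ∀ p : ℝ × E, s ≤ p.1 → p.1 ≤ s + 2 * δ → W p ≤ M₀ := by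
    intro p hp hp'
    have h1 := le_of_abs_le (hWV p)
    have h2 := le_of_abs_le (abs_valueFun_sub_le hφ hF p (s, p.2))
    have h3 : ‖p - (s, p.2)‖ ≤ 2 * δ := by
      obtain ⟨a, b⟩ := p
      rw [Prod.mk_sub_mk, sub_self, Prod.norm_mk, norm_zero, Real.norm_eq_abs,
        max_eq_left (abs_nonneg _), abs_of_nonneg (sub_nonneg.2 hp)]
      linarith
    have h4 := mul_le_mul_of_nonneg_left h3 hΛ
    have h5 : valueFun F φ r₁ (max s s) p.2 ≤ c := by
      rw [max_self]; exact valueFun_le fun μ hμ => hc _ μ hμ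
    have h6 := mul_le_mul_of_nonneg_left hε2 hΛ
    dsimp only at h2
    linarith
  have hmem : ∀ᵐ p ∂N, p.1 ∈ Icc s r := by
    refine ae_of_ae_map measurable_fst.aemeasurable ?_
    rw [hN.map_fst]
    exact ae_restrict_mem measurableSet_Icc
  have hsub : ∀ᵐ p ∂N, s + δ ≤ p.1 → p.1 ≤ r → fderiv ℝ W p (1, v p) ≤ -φ p + κ := by
    refine hN.mem_hull {p | s + δ ≤ p.1 → p.1 ≤ r → fderiv ℝ W p (1, v p) ≤ -φ p + κ} ?_ ?_
    · have h1 : Continuous fun q : ((ℝ × E) →L[ℝ] ℝ) × (ℝ × E) => q.1 q.2 := by fun_prop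
      have h2 : Measurable fun p => fderiv ℝ W p (1, v p) :=
        h1.measurable.comp ((hW1.continuous_fderiv one_ne_zero).measurable.prodMk
          (measurable_const.prodMk hN.measurable))
      have h3 : MeasurableSet {p | fderiv ℝ W p (1, v p) ≤ -φ p + κ} :=
        measurableSet_le h2 (hφ.continuous.measurable.neg.add_const κ)
      have h4 : MeasurableSet {p : ℝ × E | s + δ ≤ p.1} :=
        measurableSet_le measurable_const measurable_fst
      have h5 : MeasurableSet {p : ℝ × E | p.1 ≤ r} :=
        measurableSet_le measurable_fst measurable_const
      exact h4.imp (h5.imp h3)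
    · intro p hp h1 h2
      have hconv : Convex ℝ {w : E | fderiv ℝ W p (1, w) ≤ -φ p + κ} := by
        have : {w : E | fderiv ℝ W p (1, w) ≤ -φ p + κ} =
            {w : E | (fderiv ℝ W p).comp (ContinuousLinearMap.inr ℝ ℝ E) w
              ≤ -φ p + κ - fderiv ℝ W p (1, 0)} := by
          ext w
          have : ((1 : ℝ), w) = (1, 0) + (0, w) := by simp
          simp only [mem_ofPred_eq, ContinuousLinearMap.comp_apply, ContinuousLinearMap.inr_apply]
          rw [this, map_add, le_sub_iff_add_le']
        rw [this]
        exact convex_halfSpace_le (IsLinearMap.mk (map_add _) (map_smul _)) _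
      refine convexHull_min ?_ hconv hp
      rintro _ ⟨u, rfl⟩
      refine hWd p (1, F p.1 p.2 u) (-φ p + κ) ε hε fun q hq h hh hh' => ?_
      exact hinc ε hε hε1 p.1 p.2 u (by linarith) h2 q hq h hh hh'
  have hpt : ∀ᵐ p ∂N, fderiv ℝ ψ p (1, v p) ≤ deriv χ p.1 * M₀ + (κ - φ p) := by
    filter_upwards [hmem, hsub] with p hp hp'
    rw [hψd]
    refine add_le_add ?_ ?_
    · rcases le_or_gt p.1 (s + 2 * δ) with h | h
      · exact mul_le_mul_of_nonneg_left (hVc p hp.1 h) (deriv_smoothStep_nonneg _ hδ _)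
      · rw [hχdef, deriv_smoothStep_of_gt hδ (by linarith), zero_mul, zero_mul]
    · have hχφ : χ p.1 * φ p = φ p := by
        rcases le_total p.1 (s + δ₀) with h | h
        · rw [show φ p = 0 from h0 p.1 p.2 h, mul_zero]
        · rw [hχdef, smoothStep_of_ge hδ (by linarith), one_mul]
      rcases le_total (s + δ) p.1 with h | h
      · calc χ p.1 * fderiv ℝ W p (1, v p) ≤ χ p.1 * (-φ p + κ) :=
              mul_le_mul_of_nonneg_left (hp' h hp.2) (smoothStep_nonneg _ _ _)
          _ = χ p.1 * κ - φ p := by rw [mul_add, mul_neg, hχφ]; ring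
          _ ≤ 1 * κ - φ p := by
              have := mul_le_mul_of_nonneg_right (smoothStep_le_one (s + δ) δ p.1) hκ.le
              linarith
          _ = κ - φ p := by ring
      · rw [hχdef, smoothStep_of_le hδ h, zero_mul, show φ p = 0 from h0 p.1 p.2 (by linarith)]
        linarith
  have hdχ : Continuous (deriv χ) := hχ1.continuous_deriv le_rfl
  have hχi : Integrable (fun p : ℝ × E => deriv χ p.1) N := by
    have : Integrable (deriv χ) (N.map Prod.fst) := by
      rw [hN.map_fst]; exact hdχ.integrableOn_Icc
    exact (integrable_map_measure hdχ.aestronglyMeasurable measurable_fst.aemeasurable).1 this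
  have hφi : Integrable φ N :=
    Integrable.of_bound hφ.continuous.aestronglyMeasurable M (Filter.Eventually.of_forall hφ.bound)
  have hinteg := integral_mono_ae (integrable_fderiv_of_bound hN.measurable (hN.norm_le hF) hψ1 hψc)
    ((hχi.mul_const M₀).add ((integrable_const κ).sub hφi)) hpt
  rw [hN.continuity ψ hψ1 hψc hψt] at hinteg
  have e1 : ∫ p, deriv χ p.1 ∂N = χ r - χ s := by
    rw [hN.integral_comp_fst hdχ, integral_Icc_eq_integral_Ioc,
      ← intervalIntegral.integral_of_le hsr.le]
    exact intervalIntegral.integral_deriv_eq_sub (fun t _ => hχ1.differentiable one_ne_zero t)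
      (hdχ.intervalIntegrable _ _)
  have e2 : ∫ _ : ℝ × E, κ ∂N = κ * (r - s) := by
    have := hN.integral_comp_fst (g := fun _ => κ) continuous_const
    rw [this]
    simp [hsr.le, mul_comm]
  have e3 : ∫ p, (deriv χ p.1 * M₀ + (κ - φ p)) ∂N
      = (χ r - χ s) * M₀ + (κ * (r - s) - ∫ p, φ p ∂N) := by
    rw [integral_add (g := fun p => κ - φ p) (hχi.mul_const M₀) ((integrable_const κ).sub hφi),
      integral_sub (integrable_const κ) hφi, integral_mul_const, e1, e2]
  have e4 : χ s = 0 := smoothStep_of_le hδ (by linarith)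
  have e5 : χ r = 1 := smoothStep_of_ge hδ (by linarith)
  simp only [Pi.add_apply, Pi.sub_apply] at hinteg
  rw [e3, e4, e5] at hinteg
  linarith

end IsWeakSolution

end KeyInequality

section Wasserstein

variable {d : ℕ}

lemma MemP2.integrable_norm_sq {m : Measure (Euc d)} (hm : MemP2 m) :
    Integrable (fun x => ‖x‖ ^ 2) m := by
  refine ⟨by fun_prop, ?_⟩
  rw [hasFiniteIntegral_iff_enorm]
  refine lt_of_eq_of_lt (lintegral_congr fun x => ?_) hm.2
  rw [enorm_pow, enorm_norm]
  rfl

lemma integrable_norm_sub_sq_of_coupling {m₁ m₂ : Measure (Euc d)} (h₁ : MemP2 m₁) (h₂ : MemP2 m₂)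
    {π : Measure (Euc d × Euc d)} (hπ : π ∈ Couplings m₁ m₂) :
    Integrable (fun p => ‖p.1 - p.2‖ ^ 2) π := by
  obtain ⟨-, rfl, rfl⟩ := hπ
  have e1 := (integrable_map_measure (by fun_prop) (by fun_prop)).1 h₁.integrable_norm_sq
  have e2 := (integrable_map_measure (by fun_prop) (by fun_prop)).1 h₂.integrable_norm_sq
  refine ((e1.add e2).const_mul 2).mono' (by fun_prop) (Filter.Eventually.of_forall fun p => ?_)
  simp only [Function.comp, Pi.add_apply]
  rw [Real.norm_of_nonneg (by positivity)]
  have := norm_sub_le p.1 p.2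
  nlinarith [norm_nonneg (p.1 - p.2), sq_nonneg (‖p.1‖ - ‖p.2‖), norm_nonneg p.1, norm_nonneg p.2]

lemma exists_coupling_of_W2_lt {m₁ m₂ : Measure (Euc d)} (h₁ : MemP2 m₁) (h₂ : MemP2 m₂) {ε : ℝ}
    (hε : W2 m₁ m₂ < ε) :
    ∃ π ∈ Couplings m₁ m₂, ∫ p, ‖p.1 - p.2‖ ^ 2 ∂π < ε ^ 2 := by
  have := h₁.1
  have := h₂.1
  have hne : (Couplings m₁ m₂).Nonempty := ⟨m₁.prod m₂, inferInstance, by simp, by simp⟩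
  have h0 : 0 ≤ W2 m₁ m₂ := Real.sqrt_nonneg _
  have hlt : W2sq m₁ m₂ < ε ^ 2 := (Real.sqrt_lt' (h0.trans_lt hε)).1 hε
  obtain ⟨_, ⟨π, hπ, rfl⟩, h⟩ := exists_lt_of_csInf_lt (hne.image _) hlt
  exact ⟨π, hπ, h⟩

lemma abs_integral_sub_le_of_W2_lt {m₁ m₂ : Measure (Euc d)} (h₁ : MemP2 m₁) (h₂ : MemP2 m₂)
    {ε : ℝ} (hε : W2 m₁ m₂ < ε) {g : Euc d → ℝ} {ℓ : ℝ≥0} (hg : LipschitzWith ℓ g) {C : ℝ}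
    (hC : ∀ x, ‖g x‖ ≤ C) : |∫ x, g x ∂m₁ - ∫ x, g x ∂m₂| ≤ ℓ * ε := by
  obtain ⟨π, hπ, h⟩ := exists_coupling_of_W2_lt h₁ h₂ hε
  have hi := integrable_norm_sub_sq_of_coupling h₁ h₂ hπ
  obtain ⟨hp, rfl, rfl⟩ := hπ
  have hε0 : 0 < ε := (Real.sqrt_nonneg _).trans_lt hε
  have hgc := hg.continuous
  rw [integral_map (by fun_prop) (by fun_prop), integral_map (by fun_prop) (by fun_prop),
    ← integral_sub (Integrable.of_bound (by fun_prop) C (Filter.Eventually.of_forall fun p => hC _))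
      (Integrable.of_bound (by fun_prop) C (Filter.Eventually.of_forall fun p => hC _))]
  have hi2 : Integrable (fun p : Euc d × Euc d => ℓ * (‖p.1 - p.2‖ ^ 2 / ε + ε) / 2) π :=
    (((hi.div_const ε).add (integrable_const ε)).const_mul (ℓ : ℝ)).div_const 2
  have h3 : |∫ p, (g p.1 - g p.2) ∂π| ≤ ∫ p, ℓ * (‖p.1 - p.2‖ ^ 2 / ε + ε) / 2 ∂π := by
    rw [← Real.norm_eq_abs]
    refine norm_integral_le_of_norm_le hi2 (Filter.Eventually.of_forall fun p => ?_)
    have h4 := hg.norm_sub_le p.1 p.2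
    refine h4.trans ?_
    rw [mul_div_assoc]
    refine mul_le_mul_of_nonneg_left ?_ ℓ.2
    rw [le_div_iff₀ two_pos, ← sub_nonneg]
    have : ‖p.1 - p.2‖ ^ 2 / ε + ε - ‖p.1 - p.2‖ * 2 = (‖p.1 - p.2‖ - ε) ^ 2 / ε := by
      field_simp
      ring
    rw [this]
    positivity
  refine h3.trans ?_
  rw [integral_div, integral_const_mul, integral_add (hi.div_const ε) (integrable_const ε),
    integral_div, integral_const, probReal_univ, one_smul, mul_div_assoc]
  refine mul_le_mul_of_nonneg_left ?_ ℓ.2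
  rw [div_le_iff₀ two_pos]
  have : (∫ p, ‖p.1 - p.2‖ ^ 2 ∂π) / ε ≤ ε := by
    rw [div_le_iff₀ hε0]
    nlinarith
  linarith

end Wasserstein

section FrozenField

variable {d : ℕ} {U : Type} [MetricSpace U] {T R Cf : ℝ} {K : Set (Euc d)}
  {f : ℝ → Euc d → Measure (Euc d) → U → Euc d} {s r : ℝ} {m : ℝ → Measure (Euc d)}

/-- The controlled field obtained from the mean field dynamics by freezing the flow of measures. -/
def frozenField (f : ℝ → Euc d → Measure (Euc d) → U → Euc d) (m : ℝ → Measure (Euc d))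
    {s r : ℝ} (h : s ≤ r) (t : ℝ) (x : Euc d) (u : U) : Euc d :=
  f (projIcc s r h t) x (m (projIcc s r h t)) u

lemma frozenField_of_mem (h : s ≤ r) {t : ℝ} (ht : t ∈ Icc s r) (x : Euc d) (u : U) :
    frozenField f m h t x u = f t x (m t) u := by
  rw [frozenField, projIcc_of_mem h ht]

lemma W2Continuous.self_nonpos (hmC : W2Continuous s r m) {t : ℝ} (ht : t ∈ Icc s r) :
    W2 (m t) (m t) ≤ 0 := by
  refine le_of_forall_pos_le_add fun ε hε => ?_
  obtain ⟨δ, hδ, h⟩ := hmC t ht ε hε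
  simpa using (h t ht (by simpa using hδ)).le

lemma DynHyp.norm_sub_le (hf : DynHyp T R Cf K f) {t : ℝ} (ht : t ∈ Icc 0 T)
    {μ ν : Measure (Euc d)} (hμ : MemP2K K μ) (hν : MemP2K K ν) (hCf : 0 < Cf)
    (x : Euc d) (u : U) : ‖f t x μ u - f t x ν u‖ ≤ Cf * W2 μ ν := by
  by_cases hx : x ∈ K
  · simpa using hf.lipschitz t x x μ ν u ht hx hx hμ hν
  · rw [hf.zero_outside t x μ u hμ.2 hx, hf.zero_outside t x ν u hν.2 hx, sub_self, norm_zero]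
    exact mul_nonneg hCf.le (Real.sqrt_nonneg _)

lemma DynHyp.norm_sub_le_of_mem_of_notMem (hf : DynHyp T R Cf K f) (hK : IsClosed K) {t : ℝ}
    (ht : t ∈ Icc 0 T) {μ : Measure (Euc d)} (hμ : MemP2K K μ) (hμμ : W2 μ μ ≤ 0) (hCf : 0 < Cf)
    {x x' : Euc d} (hx : x ∈ K) (hx' : x' ∉ K) (u : U) :
    ‖f t x μ u - f t x' μ u‖ ≤ Cf * ‖x - x'‖ := by
  obtain ⟨z, hz, hzK, hzc⟩ : (segment ℝ x x' ∩ (K ∩ closure Kᶜ)).Nonempty :=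
    isPreconnected_closed_iff.1 (convex_segment x x').isPreconnected K (closure Kᶜ) hK
      isClosed_closure (fun y _ => (em (y ∈ K)).imp id fun h => subset_closure h)
      ⟨x, left_mem_segment ℝ x x', hx⟩ ⟨x', right_mem_segment ℝ x x', subset_closure hx'⟩
  have hcont : Continuous fun y => f t y μ u :=
    (hf.cont μ).comp (by fun_prop : Continuous fun y : Euc d => (t, y, u))
  have hz0 : f t z μ u = 0 := by
    have hcl : IsClosed {y | f t y μ u = 0} := isClosed_eq hcont continuous_const
    have hsub : Kᶜ ⊆ {y | f t y μ u = 0} := fun y hy => hf.zero_outside t y μ u hμ.2 hy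
    exact closure_minimal hsub hcl hzc
  rw [hf.zero_outside t x' μ u hμ.2 hx', ← hz0]
  refine (hf.lipschitz t x z μ μ u ht hx hzK hμ hμ).trans ?_
  refine mul_le_mul_of_nonneg_left ?_ hCf.le
  have h1 : ‖x - z‖ ≤ ‖x - x'‖ := by
    obtain ⟨θ, hθ, rfl⟩ := (segment_eq_image' ℝ x x').subset hz
    rw [sub_add_cancel_left, norm_neg, norm_smul, norm_sub_rev, Real.norm_of_nonneg hθ.1]
    exact mul_le_of_le_one_left (norm_nonneg _) hθ.2
  linarith

lemma controlledField_frozenField (hf : DynHyp T R Cf K f) (hR : 0 < R) (hCf : 0 < Cf)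
    (hK : IsClosed K) (hs : 0 ≤ s) (hsr : s < r) (hrT : r ≤ T)
    (hmP : ∀ t ∈ Icc s r, MemP2K K (m t)) (hmC : W2Continuous s r m) :
    ControlledField (frozenField f m hsr.le) R Cf := by
  have hmem : ∀ t, (projIcc s r hsr.le t : ℝ) ∈ Icc (0 : ℝ) T := fun t =>
    ⟨hs.trans (projIcc s r hsr.le t).2.1, (projIcc s r hsr.le t).2.2.trans hrT⟩
  have hself : ∀ t, W2 (m (projIcc s r hsr.le t)) (m (projIcc s r hsr.le t)) ≤ 0 := fun t =>
    hmC.self_nonpos (projIcc s r hsr.le t).2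
  have hP : ∀ t, MemP2K K (m (projIcc s r hsr.le t)) := fun t => hmP _ (projIcc s r hsr.le t).2
  refine ⟨?_, fun t x u => ?_, fun t x x' u => ?_, hR.le, hCf⟩
  · refine continuous_iff_continuousAt.2 fun p₀ => ?_
    obtain ⟨t₀, x₀, u₀⟩ := p₀
    have h1 : Continuous fun p : ℝ × Euc d × U =>
        f (projIcc s r hsr.le p.1) p.2.1 (m (projIcc s r hsr.le t₀)) p.2.2 :=
      (hf.cont _).comp (by fun_prop :
        Continuous fun p : ℝ × Euc d × U => ((projIcc s r hsr.le p.1 : ℝ), p.2.1, p.2.2))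
    rw [Metric.continuousAt_iff]
    intro ε hε
    obtain ⟨δ₁, hδ₁, h2⟩ := Metric.continuousAt_iff.1 (h1.continuousAt (x := (t₀, x₀, u₀))) (ε / 2)
      (half_pos hε)
    obtain ⟨δ₂, hδ₂, h3⟩ := hmC _ (projIcc s r hsr.le t₀).2 (ε / 2 / Cf) (by positivity)
    have h4 : Continuous fun p : ℝ × Euc d × U => (projIcc s r hsr.le p.1 : ℝ) := by fun_prop
    obtain ⟨δ₃, hδ₃, h5⟩ := Metric.continuousAt_iff.1 (h4.continuousAt (x := (t₀, x₀, u₀))) δ₂ hδ₂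
    refine ⟨min δ₁ δ₃, lt_min hδ₁ hδ₃, fun {p} hp => ?_⟩
    have h6 := h2 (hp.trans_le (min_le_left _ _))
    have h7 := h3 _ (projIcc s r hsr.le p.1).2 (h5 (hp.trans_le (min_le_right _ _)))
    have h8 := hf.norm_sub_le (hmem p.1) (hP t₀) (hP p.1) hCf p.2.1 p.2.2
    rw [lt_div_iff₀ hCf] at h7
    rw [← dist_eq_norm, dist_comm] at h8
    calc dist (frozenField f m hsr.le p.1 p.2.1 p.2.2) (frozenField f m hsr.le t₀ x₀ u₀)
        ≤ Cf * W2 (m (projIcc s r hsr.le t₀)) (m (projIcc s r hsr.le p.1)) + ε / 2 :=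
          (dist_triangle _ _ _).trans (add_le_add h8 h6.le)
      _ < ε := by linarith
  · by_cases hx : x ∈ K
    · exact hf.bounded _ _ _ _ (hmem t) hx (hP t)
    · rw [frozenField, hf.zero_outside _ _ _ _ (hP t).2 hx, norm_zero]
      exact hR.le
  · by_cases hx : x ∈ K <;> by_cases hx' : x' ∈ K
    · refine (hf.lipschitz _ _ _ _ _ u (hmem t) hx hx' (hP t) (hP t)).trans ?_
      refine mul_le_mul_of_nonneg_left ?_ hCf.le
      linarith [hself t]
    · exact hf.norm_sub_le_of_mem_of_notMem hK (hmem t) (hP t) (hself t) hCf hx hx' u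
    · rw [norm_sub_rev, norm_sub_rev x]
      exact hf.norm_sub_le_of_mem_of_notMem hK (hmem t) (hP t) (hself t) hCf hx' hx u
    · rw [frozenField, frozenField, hf.zero_outside _ _ _ _ (hP t).2 hx,
        hf.zero_outside _ _ _ _ (hP t).2 hx', sub_zero, norm_zero]
      positivity

end FrozenField

lemma measurable_measure_of_forall_lipschitz {X E : Type*} [MeasurableSpace X]
    [PseudoEMetricSpace E] [MeasurableSpace E] [BorelSpace E] {μ : X → Measure E}
    [∀ a, IsFiniteMeasure (μ a)]
    (h : ∀ (g : E → ℝ) (ℓ : ℝ≥0), LipschitzWith ℓ g → (∀ x, g x ∈ Icc (0 : ℝ) 1) →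
      Measurable fun a => ∫ x, g x ∂(μ a)) : Measurable μ := by
  have key : ∀ F : Set E, IsClosed F → Measurable fun a => μ a F := by
    intro F hF
    have hpos : ∀ n : ℕ, (0 : ℝ) < 1 / ((n : ℝ) + 1) := fun n => Nat.one_div_pos_of_nat
    have hlim := fun a => tendsto_integral_thickenedIndicator_of_isClosed (μ a) hF hpos
      tendsto_one_div_add_atTop_nhds_zero_nat
    have hm : Measurable fun a => (μ a).real F := by
      refine measurable_of_tendsto_metrizable (fun n => ?_) (tendsto_pi_nhds.2 hlim)
      refine h _ _ (NNReal.isometry_coe.lipschitz.comp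
        (lipschitzWith_thickenedIndicator (hpos n) F)) ?_
      intro x
      refine ⟨NNReal.coe_nonneg _, ?_⟩
      exact_mod_cast thickenedIndicator_le_one (hpos n) F x
    have : (fun a => μ a F) = fun a => ENNReal.ofReal ((μ a).real F) := by
      ext a; exact (ofReal_measureReal (measure_ne_top _ _)).symm
    rw [this]
    exact hm.ennreal_ofReal
  refine Measurable.measure_of_isPiSystem (S := {F : Set E | IsClosed F}) ?_ ?_ key
    (key _ isClosed_univ)
  · rw [BorelSpace.measurable_eq (α := E), borel_eq_generateFrom_isClosed]
  · intro A hA B hB _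
    exact hA.inter hB

section FrozenField

open ProbabilityTheory

variable {d : ℕ} {U : Type} [MetricSpace U] {T R Cf : ℝ} {K : Set (Euc d)}
  {f : ℝ → Euc d → Measure (Euc d) → U → Euc d} {s r : ℝ} {m : ℝ → Measure (Euc d)}
  {v : ℝ → Euc d → Euc d}

lemma continuousOn_integral_of_W2Continuous (hmP : ∀ t ∈ Icc s r, MemP2 (m t))
    (hmC : W2Continuous s r m) {g : Euc d → ℝ} {ℓ : ℝ≥0} (hg : LipschitzWith ℓ g) {C : ℝ}
    (hC : ∀ x, ‖g x‖ ≤ C) : ContinuousOn (fun t => ∫ x, g x ∂(m t)) (Icc s r) := by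
  rw [Metric.continuousOn_iff]
  intro t ht ε hε
  have hε' : 0 < ε / (ℓ + 1) := by positivity
  obtain ⟨δ, hδ, h⟩ := hmC t ht _ hε'
  refine ⟨δ, hδ, fun t' ht' hd => ?_⟩
  rw [dist_comm, Real.dist_eq]
  refine (abs_integral_sub_le_of_W2_lt (hmP t ht) (hmP t' ht') (h t' ht' hd) hg hC).trans_lt ?_
  rw [mul_div_assoc', div_lt_iff₀ (by positivity)]
  nlinarith

lemma measurable_flow_projIcc (h : s ≤ r) (hmP : ∀ t ∈ Icc s r, MemP2 (m t))
    (hmC : W2Continuous s r m) : Measurable fun t => m (projIcc s r h t) := by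
  have : ∀ t, IsFiniteMeasure (m (projIcc s r h t)) := fun t => by
    have := (hmP _ (projIcc s r h t).2).1
    infer_instance
  refine measurable_measure_of_forall_lipschitz fun g ℓ hg h01 => ?_
  have h1 := (continuousOn_integral_of_W2Continuous hmP hmC hg (C := 1) fun x => by
    rw [Real.norm_of_nonneg (h01 x).1]; exact (h01 x).2).domRestrict
  exact (h1.comp (continuous_projIcc (h := h))).measurable

/-- A flow of measures as a Markov kernel. -/
def flowKernel (h : s ≤ r) (hmP : ∀ t ∈ Icc s r, MemP2 (m t)) (hmC : W2Continuous s r m) :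
    Kernel ℝ (Euc d) where
  toFun t := m (projIcc s r h t)
  measurable' := measurable_flow_projIcc h hmP hmC

lemma isMarkovKernel_flowKernel (h : s ≤ r) (hmP : ∀ t ∈ Icc s r, MemP2 (m t))
    (hmC : W2Continuous s r m) : IsMarkovKernel (flowKernel h hmP hmC) :=
  ⟨fun t => (hmP _ (projIcc s r h t).2).1⟩

lemma flowKernel_of_mem (h : s ≤ r) (hmP : ∀ t ∈ Icc s r, MemP2 (m t))
    (hmC : W2Continuous s r m) {t : ℝ} (ht : t ∈ Icc s r) : flowKernel h hmP hmC t = m t := by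
  change m (projIcc s r h t) = m t
  rw [projIcc_of_mem h ht]

/-- The space-time measure `m(t, dx) dt` on `[s, r] × ℝ^d`. -/
def flowMeasure (h : s ≤ r) (hmP : ∀ t ∈ Icc s r, MemP2 (m t)) (hmC : W2Continuous s r m) :
    Measure (ℝ × Euc d) :=
  (volume.restrict (Icc s r)) ⊗ₘ flowKernel h hmP hmC

lemma integral_flowMeasure (h : s ≤ r) (hmP : ∀ t ∈ Icc s r, MemP2 (m t))
    (hmC : W2Continuous s r m) {g : ℝ × Euc d → ℝ} (hg : Integrable g (flowMeasure h hmP hmC)) :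
    ∫ p, g p ∂(flowMeasure h hmP hmC) = ∫ t in Icc s r, ∫ x, g (t, x) ∂(m t) := by
  have := isMarkovKernel_flowKernel h hmP hmC
  rw [flowMeasure, Measure.integral_compProd hg]
  refine setIntegral_congr_fun measurableSet_Icc fun t ht => ?_
  simp only [flowKernel_of_mem h hmP hmC ht]

lemma map_fst_flowMeasure (h : s ≤ r) (hmP : ∀ t ∈ Icc s r, MemP2 (m t))
    (hmC : W2Continuous s r m) :
    (flowMeasure h hmP hmC).map Prod.fst = volume.restrict (Icc s r) := by
  have := isMarkovKernel_flowKernel h hmP hmC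
  exact Measure.fst_compProd _ _

lemma isWeakSolution_flowMeasure (hsr : s < r) (hmP : ∀ t ∈ Icc s r, MemP2 (m t))
    (hmC : W2Continuous s r m) (hFb : ControlledField (frozenField f m hsr.le) R Cf)
    (hv : Measurable (fun p : ℝ × Euc d => v p.1 p.2))
    (hV1 : ∀ᵐ t ∂(volume.restrict (Icc s r)), ∀ᵐ x ∂(m t),
      v t x ∈ convexHull ℝ (Set.range fun u : U => f t x (m t) u))
    (hV2 : ∀ φ : ℝ × Euc d → ℝ, ContDiff ℝ 1 φ → HasCompactSupport φ →
      tsupport φ ⊆ (Ioo s r ×ˢ (univ : Set (Euc d))) →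
      ∫ t in Icc s r, ∫ x, fderiv ℝ φ (t, x) (1, v t x) ∂(m t) = 0) :
    IsWeakSolution (frozenField f m hsr.le) s r (flowMeasure hsr.le hmP hmC)
      fun p => v p.1 p.2 := by
  have := isMarkovKernel_flowKernel hsr.le hmP hmC
  have hhull : ∀ S : Set (ℝ × Euc d), MeasurableSet S →
      (∀ p : ℝ × Euc d, v p.1 p.2 ∈ convexHull ℝ (range (frozenField f m hsr.le p.1 p.2)) → p ∈ S) →
      ∀ᵐ p ∂(flowMeasure hsr.le hmP hmC), p ∈ S := by
    intro S hS hmem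
    refine Measure.ae_compProd_of_ae_ae hS ?_
    filter_upwards [hV1, ae_restrict_mem measurableSet_Icc] with t ht htm
    rw [flowKernel_of_mem hsr.le hmP hmC htm]
    filter_upwards [ht] with x hx
    refine hmem (t, x) ?_
    have : frozenField f m hsr.le t x = fun u => f t x (m t) u := by
      ext1 u; exact frozenField_of_mem hsr.le htm x u
    simpa only [this] using hx
  refine ⟨map_fst_flowMeasure hsr.le hmP hmC, hv, hhull, fun ψ hψ hψc hψs => ?_⟩
  have hfin : IsFiniteMeasure (flowMeasure hsr.le hmP hmC) := by
    unfold flowMeasure; infer_instance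
  have hvR : ∀ᵐ p ∂(flowMeasure hsr.le hmP hmC), ‖v p.1 p.2‖ ≤ R := by
    refine hhull {p | ‖v p.1 p.2‖ ≤ R} (measurableSet_le hv.norm measurable_const) fun p hp => ?_
    have : convexHull ℝ (range (frozenField f m hsr.le p.1 p.2)) ⊆ Metric.closedBall 0 R := by
      refine convexHull_min ?_ (convex_closedBall 0 R)
      rintro _ ⟨u, rfl⟩
      simpa using hFb.bound p.1 p.2 u
    simpa using this hp
  rw [integral_flowMeasure hsr.le hmP hmC (integrable_fderiv_of_bound hv hvR hψ hψc)]
  exact hV2 ψ hψ hψc hψs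

lemma nonempty_of_mem_convexHull (hsr : s < r) (hmP : ∀ t ∈ Icc s r, MemP2 (m t))
    (hV1 : ∀ᵐ t ∂(volume.restrict (Icc s r)), ∀ᵐ x ∂(m t),
      v t x ∈ convexHull ℝ (Set.range fun u : U => f t x (m t) u)) : Nonempty U := by
  by_contra h
  rw [not_nonempty_iff] at h
  have h0 : ∀ᵐ t ∂(volume.restrict (Icc s r)), False := by
    filter_upwards [hV1, ae_restrict_mem measurableSet_Icc] with t ht htm
    have := (hmP t htm).1
    simp only [range_eq_empty, convexHull_empty, mem_empty_iff_false] at ht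
    obtain ⟨_, h⟩ := ht.exists
    exact h
  have : Filter.NeBot (ae ((volume : Measure ℝ).restrict (Icc s r))) := by
    rw [ae_neBot, Ne, Measure.restrict_eq_zero, Real.volume_Icc]
    simp [hsr]
  obtain ⟨_, h⟩ := h0.exists
  exact h

end FrozenField

section ControlSpace

open Filter Topology

variable {E U : Type*} [NormedAddCommGroup E] [NormedSpace ℝ E]
  [MetricSpace U] [CompactSpace U] [MeasurableSpace U] [BorelSpace U]
variable {F : ℝ → E → U → E} {R L : ℝ} {s r : ℝ}

/-- The space of relaxed controls on `[s, r]`, as finite measures on `[s, r] × U`. -/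
def controlSpace (U : Type*) [MetricSpace U] [MeasurableSpace U] (s r : ℝ) :
    Set (FiniteMeasure (Icc s r × U)) :=
  {ξ | (ξ : Measure (Icc s r × U)).map (fun p => (p.1 : ℝ)) = volume.restrict (Icc s r)}

/-- A relaxed control on `[s, r]` as a measure on `ℝ × U`. -/
def extendControl (ξ : controlSpace U s r) : Measure (ℝ × U) :=
  ((ξ : FiniteMeasure (Icc s r × U)) : Measure (Icc s r × U)).map fun p => ((p.1 : ℝ), p.2)

lemma measurable_coe_prod : Measurable fun p : Icc s r × U => ((p.1 : ℝ), p.2) :=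
  (measurable_subtype_coe.comp measurable_fst).prodMk measurable_snd

lemma extendControl_map_fst (ξ : controlSpace U s r) :
    (extendControl ξ).map Prod.fst = volume.restrict (Icc s r) := by
  rw [extendControl, Measure.map_map measurable_fst measurable_coe_prod]
  exact ξ.2

lemma extendControl_timeDominated (ξ : controlSpace U s r) : TimeDominated (extendControl ξ) := by
  rw [TimeDominated, extendControl_map_fst]
  exact Measure.restrict_le_self

instance (ξ : controlSpace U s r) : IsFiniteMeasure (extendControl ξ) := by
  unfold extendControl; infer_instance

lemma isClosed_controlSpace : IsClosed (controlSpace U s r) := by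
  have h : controlSpace U s r = ⋂ g : BoundedContinuousFunction ℝ ℝ,
      {ξ : FiniteMeasure (Icc s r × U) |
        ∫ p, g p.1 ∂(ξ : Measure (Icc s r × U)) = ∫ t in Icc s r, g t} := by
    ext ξ
    simp only [controlSpace, mem_ofPred_eq, mem_iInter]
    have hm : Measurable fun p : Icc s r × U => (p.1 : ℝ) :=
      measurable_subtype_coe.comp measurable_fst
    have e : ∀ g : BoundedContinuousFunction ℝ ℝ,
        ∫ t, g t ∂((ξ : Measure (Icc s r × U)).map fun p => (p.1 : ℝ)) =
          ∫ p, g p.1 ∂(ξ : Measure (Icc s r × U)) := fun g =>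
      integral_map hm.aemeasurable g.continuous.aestronglyMeasurable
    constructor
    · intro hξ g
      rw [← hξ, e]
    · intro hξ
      refine ext_of_forall_integral_eq_of_IsFiniteMeasure fun g => ?_
      rw [e, hξ]
  rw [h]
  refine isClosed_iInter fun g => isClosed_eq ?_ continuous_const
  exact FiniteMeasure.continuous_integral_continuousMap
    (⟨fun p : Icc s r × U => g p.1, by fun_prop⟩ : C(Icc s r × U, ℝ))

instance : CompactSpace (controlSpace U s r) := by
  refine isCompact_iff_compactSpace.1 ?_
  refine (isCompact_setOfPred_finiteMeasure_eq_of_compactSpace (Icc s r × U)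
    (r - s).toNNReal).of_isClosed_subset isClosed_controlSpace fun ξ hξ => ?_
  have h1 : (ξ : Measure (Icc s r × U)) univ = ENNReal.ofReal (r - s) := by
    have : (ξ : Measure (Icc s r × U)).map (fun p => (p.1 : ℝ)) univ
        = volume.restrict (Icc s r) univ := by rw [show _ = _ from hξ]
    have hm : Measurable fun p : Icc s r × U => (p.1 : ℝ) :=
      measurable_subtype_coe.comp measurable_fst
    rw [Measure.map_apply hm MeasurableSet.univ] at this
    simpa using this
  change ξ.mass = _
  change ((ξ : Measure (Icc s r × U)) univ).toNNReal = _
  rw [h1]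
  rfl

lemma continuous_of_forall_clm [FiniteDimensional ℝ E] {X : Type*} [TopologicalSpace X] {g : X → E}
    (h : ∀ ℓ : E →L[ℝ] ℝ, Continuous fun x => ℓ (g x)) : Continuous g := by
  set e := (Module.finBasis ℝ E).equivFunL
  have : Continuous fun x => e (g x) := continuous_pi fun i => by
    have := h ((ContinuousLinearMap.proj (R := ℝ) (φ := fun _ => ℝ) i).comp
      (e : E →L[ℝ] (_ → ℝ)))
    exact this
  exact (e.symm.continuous.comp this).congr fun x => e.symm_apply_apply _

lemma continuous_integral_extendControl [FiniteDimensional ℝ E] {h : ℝ × U → E}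
    (hh : Continuous h) : Continuous fun ξ : controlSpace U s r => ∫ p, h p ∂(extendControl ξ) := by
  have hcoe : Continuous fun p : Icc s r × U => ((p.1 : ℝ), p.2) := by fun_prop
  have e : ∀ ξ : controlSpace U s r, ∫ p, h p ∂(extendControl ξ) =
      ∫ p : Icc s r × U, h (p.1, p.2) ∂((ξ : FiniteMeasure (Icc s r × U)) : Measure _) := fun ξ =>
    integral_map measurable_coe_prod.aemeasurable hh.aestronglyMeasurable
  simp only [e]
  refine continuous_of_forall_clm fun ℓ => ?_
  have hi : ∀ ξ : controlSpace U s r, Integrable (fun p : Icc s r × U => h (p.1, p.2))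
      ((ξ : FiniteMeasure (Icc s r × U)) : Measure _) := fun ξ =>
    (hh.comp hcoe).integrable_of_hasCompactSupport (HasCompactSupport.of_compactSpace _)
  simp only [← fun ξ => ℓ.integral_comp_comm (hi ξ)]
  exact (FiniteMeasure.continuous_integral_continuousMap
    (⟨fun p : Icc s r × U => ℓ (h (p.1, p.2)), by fun_prop⟩ : C(Icc s r × U, ℝ))).comp
    continuous_subtype_val

/-- A continuous cutoff: `1` on `(-∞, t - ε]` and `0` on `[t, ∞)`. -/
def timeCutoff (t ε τ : ℝ) : ℝ := max 0 (min 1 ((t - τ) / ε))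

lemma continuous_timeCutoff (t ε : ℝ) : Continuous (timeCutoff t ε) := by
  unfold timeCutoff; fun_prop

lemma timeCutoff_mem (t ε τ : ℝ) : timeCutoff t ε τ ∈ Icc (0 : ℝ) 1 :=
  ⟨le_max_left _ _, max_le zero_le_one (min_le_left _ _)⟩

lemma timeCutoff_of_ge {t ε τ : ℝ} (hε : 0 < ε) (h : t ≤ τ) : timeCutoff t ε τ = 0 :=
  max_eq_left ((min_le_right _ _).trans (div_nonpos_of_nonpos_of_nonneg (by linarith) hε.le))

lemma timeCutoff_of_le {t ε τ : ℝ} (hε : 0 < ε) (h : τ ≤ t - ε) : timeCutoff t ε τ = 1 := by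
  rw [timeCutoff, min_eq_left ((one_le_div hε).2 (by linarith)), max_eq_right zero_le_one]

lemma norm_setIntegral_sub_cutoff_le {h : ℝ × U → E} [FiniteDimensional ℝ E] (hh : Continuous h)
    (hR0 : 0 ≤ R)
    (hR : ∀ p, ‖h p‖ ≤ R) (t : ℝ) {ε : ℝ} (hε : 0 < ε) (ξ : controlSpace U s r) :
    ‖(∫ p in Ioc s t ×ˢ univ, h p ∂(extendControl ξ)) -
      ∫ p, timeCutoff t ε p.1 • h p ∂(extendControl ξ)‖ ≤ R * ε := by
  have hmeas : MeasurableSet (Ioc s t ×ˢ univ : Set (ℝ × U)) :=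
    measurableSet_Ioc.prod MeasurableSet.univ
  have hi : Integrable h (extendControl ξ) :=
    Integrable.of_bound hh.aestronglyMeasurable R (Eventually.of_forall hR)
  have hc : Continuous fun p : ℝ × U => timeCutoff t ε p.1 • h p :=
    ((continuous_timeCutoff t ε).comp continuous_fst).smul hh
  have hi2 : Integrable (fun p : ℝ × U => timeCutoff t ε p.1 • h p) (extendControl ξ) := by
    refine Integrable.of_bound hc.aestronglyMeasurable R (Eventually.of_forall fun p => ?_)
    rw [norm_smul, Real.norm_of_nonneg (timeCutoff_mem t ε p.1).1]
    exact (mul_le_of_le_one_left (norm_nonneg _) (timeCutoff_mem t ε p.1).2).trans (hR p)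
  rw [← integral_indicator hmeas, ← integral_sub (hi.indicator hmeas) hi2]
  set A : Set ℝ := Ioc (t - ε) t ∪ {s} with hA
  have hAm : MeasurableSet A := measurableSet_Ioc.union (measurableSet_singleton s)
  have hAm' : MeasurableSet (Prod.fst ⁻¹' A : Set (ℝ × U)) := measurable_fst hAm
  have hvol : (extendControl ξ).real (Prod.fst ⁻¹' A) ≤ ε := by
    refine ENNReal.toReal_le_of_le_ofReal hε.le ?_
    rw [← Measure.map_apply measurable_fst hAm]
    refine (extendControl_timeDominated ξ A).trans ((measure_union_le _ _).trans ?_)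
    simp
  have hmem : ∀ᵐ p ∂(extendControl ξ), p.1 ∈ Icc s r := by
    refine ae_of_ae_map measurable_fst.aemeasurable ?_
    rw [extendControl_map_fst]
    exact ae_restrict_mem measurableSet_Icc
  have hb : ∀ᵐ p ∂(extendControl ξ), ‖(Ioc s t ×ˢ univ).indicator h p - timeCutoff t ε p.1 • h p‖
      ≤ (Prod.fst ⁻¹' A).indicator (fun _ => R) p := by
    filter_upwards [hmem] with p hp
    by_cases hpA : p.1 ∈ A
    · rw [indicator_of_mem (show p ∈ Prod.fst ⁻¹' A from hpA)]
      have h1 := timeCutoff_mem t ε p.1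
      by_cases hp1 : p ∈ (Ioc s t ×ˢ univ : Set (ℝ × U))
      · rw [indicator_of_mem hp1]
        have : h p - timeCutoff t ε p.1 • h p = (1 - timeCutoff t ε p.1) • h p := by
          rw [sub_smul, one_smul]
        rw [this, norm_smul, Real.norm_of_nonneg (by linarith [h1.2])]
        exact (mul_le_of_le_one_left (norm_nonneg _) (by linarith [h1.1])).trans (hR p)
      · rw [indicator_of_notMem hp1, zero_sub, norm_neg, norm_smul, Real.norm_of_nonneg h1.1]
        exact (mul_le_of_le_one_left (norm_nonneg _) h1.2).trans (hR p)
    · rw [indicator_of_notMem (show p ∉ Prod.fst ⁻¹' A from hpA)]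
      simp only [hA, mem_union, mem_Ioc, mem_singleton_iff, not_or, not_and, not_le] at hpA
      have hsp : s < p.1 := lt_of_le_of_ne hp.1 (Ne.symm hpA.2)
      rcases le_or_gt p.1 (t - ε) with hle | hgt
      · rw [indicator_of_mem (show p ∈ (Ioc s t ×ˢ univ : Set (ℝ × U)) from
          ⟨⟨hsp, by linarith⟩, mem_univ _⟩), timeCutoff_of_le hε hle, one_smul,
          sub_self, norm_zero]
      · have := hpA.1 hgt
        rw [indicator_of_notMem (fun hh => by linarith [hh.1.2]), timeCutoff_of_ge hε this.le,
          zero_smul, sub_self, norm_zero]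
  have hiA : Integrable ((Prod.fst ⁻¹' A : Set (ℝ × U)).indicator fun _ => R) (extendControl ξ) :=
    (integrable_const R).indicator hAm'
  refine (norm_integral_le_of_norm_le hiA hb).trans ?_
  rw [integral_indicator hAm', setIntegral_const, smul_eq_mul, mul_comm]
  exact mul_le_mul_of_nonneg_left hvol hR0

lemma continuous_setIntegral_extendControl [FiniteDimensional ℝ E] {h : ℝ × U → E}
    (hh : Continuous h) (hR0 : 0 ≤ R) (hR : ∀ p, ‖h p‖ ≤ R) (t : ℝ) :
    Continuous fun ξ : controlSpace U s r => ∫ p in Ioc s t ×ˢ univ, h p ∂(extendControl ξ) := by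
  have hpos : ∀ n : ℕ, (0 : ℝ) < 1 / ((n : ℝ) + 1) := fun n => Nat.one_div_pos_of_nat
  have hu : TendstoUniformly (fun (n : ℕ) (ξ : controlSpace U s r) =>
      ∫ p, timeCutoff t (1 / ((n : ℝ) + 1)) p.1 • h p ∂(extendControl ξ))
      (fun ξ => ∫ p in Ioc s t ×ˢ univ, h p ∂(extendControl ξ)) atTop := by
    rw [Metric.tendstoUniformly_iff]
    intro ε hε
    have h0 : Tendsto (fun n : ℕ => R * (1 / ((n : ℝ) + 1))) atTop (𝓝 0) := by
      simpa using tendsto_one_div_add_atTop_nhds_zero_nat.const_mul R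
    filter_upwards [h0.eventually (gt_mem_nhds hε)] with n hn ξ
    rw [dist_eq_norm]
    exact (norm_setIntegral_sub_cutoff_le hh hR0 hR t (hpos n) ξ).trans_lt hn
  refine hu.continuous (Eventually.of_forall fun n => ?_).frequently
  exact continuous_integral_extendControl
    (((continuous_timeCutoff t _).comp continuous_fst).smul hh)

end ControlSpace

section FlowContinuity

open Filter Topology

variable {E U : Type*} [NormedAddCommGroup E] [NormedSpace ℝ E] [FiniteDimensional ℝ E]
  [MeasurableSpace E] [BorelSpace E]
  [MetricSpace U] [CompactSpace U] [MeasurableSpace U] [BorelSpace U]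
variable {F : ℝ → E → U → E} {R L : ℝ} {s r : ℝ}

lemma continuous_uncurry_of_norm_sub_le {X : Type*} [TopologicalSpace X] {g : X → ℝ → E}
    (hR : 0 ≤ R) (hg : ∀ t, Continuous fun x => g x t)
    (hl : ∀ x a b, ‖g x b - g x a‖ ≤ R * |b - a|) : Continuous (Function.uncurry g) := by
  refine continuous_prod_of_continuous_lipschitzWith' _ R.toNNReal (fun x => ?_) hg
  refine LipschitzWith.of_dist_le_mul fun a b => ?_
  rw [dist_eq_norm, Real.coe_toNNReal _ hR, dist_eq_norm, Real.norm_eq_abs]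
  exact hl x b a

lemma continuous_picardIter_controlSpace (hF : ControlledField F R L) (n : ℕ) (t : ℝ) :
    Continuous fun x : E × controlSpace U s r => picardIter F s x.1 (extendControl x.2) n t := by
  induction n generalizing t with
  | zero => exact continuous_fst
  | succ n ih =>
    simp only [picardIter_succ]
    rcases le_total t s with ht | ht
    · simp only [picardMap_of_le ht]
      exact continuous_fst
    set γ : E × controlSpace U s r → ℝ → E := fun x => picardIter F s x.1 (extendControl x.2) n
    have hγ : Continuous (Function.uncurry γ) :=
      continuous_uncurry_of_norm_sub_le hF.R_nonneg ih fun x a b =>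
        norm_picardIter_sub_le hF (extendControl_timeDominated x.2) s x.1 n a b
    have hγt : ∀ x, Continuous (γ x) := fun x => hγ.comp (by fun_prop : Continuous fun t => (x, t))
    refine continuous_iff_continuousAt.2 fun x₀ => ?_
    have hB : Continuous fun x : E × controlSpace U s r =>
        ∫ p in Ioc s t ×ˢ univ, F p.1 (γ x₀ p.1) p.2 ∂(extendControl x.2) :=
      (continuous_setIntegral_extendControl
        (hF.cont.comp (continuous_fst.prodMk (((hγt x₀).comp continuous_fst).prodMk
          continuous_snd)))
        hF.R_nonneg (fun p => hF.bound _ _ _) t).comp continuous_snd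
    have hA : Tendsto (fun x : E × controlSpace U s r =>
        (∫ p in Ioc s t ×ˢ univ, F p.1 (γ x p.1) p.2 ∂(extendControl x.2)) -
          ∫ p in Ioc s t ×ˢ univ, F p.1 (γ x₀ p.1) p.2 ∂(extendControl x.2)) (𝓝 x₀) (𝓝 0) := by
      have hc : Continuous fun x => ∫ τ in s..t, L * ‖γ x τ - γ x₀ τ‖ := by
        refine intervalIntegral.continuous_parametric_intervalIntegral_of_continuous' ?_ _ _
        exact continuous_const.mul (hγ.sub ((hγt x₀).comp continuous_snd)).norm
      have h0 := hc.tendsto x₀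
      simp only [sub_self, norm_zero, mul_zero, intervalIntegral.integral_zero] at h0
      refine squeeze_zero_norm (fun x => ?_) h0
      have hμ := extendControl_timeDominated x.2
      rw [← integral_sub (hF.integrableOn hμ (hγt x) s t) (hF.integrableOn hμ (hγt x₀) s t),
        intervalIntegral.integral_of_le ht]
      exact hμ.norm_integral_le s t (continuous_const.mul ((hγt x).sub (hγt x₀)).norm)
        (fun τ _ => mul_nonneg hF.L_pos.le (norm_nonneg _)) fun p _ => hF.lip _ _ _ _
    have h : Tendsto (fun x : E × controlSpace U s r => x.1 +
        (((∫ p in Ioc s t ×ˢ univ, F p.1 (γ x p.1) p.2 ∂(extendControl x.2)) -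
          ∫ p in Ioc s t ×ˢ univ, F p.1 (γ x₀ p.1) p.2 ∂(extendControl x.2)) +
          ∫ p in Ioc s t ×ˢ univ, F p.1 (γ x₀ p.1) p.2 ∂(extendControl x.2))) (𝓝 x₀)
        (𝓝 (x₀.1 + (0 + ∫ p in Ioc s t ×ˢ univ, F p.1 (γ x₀ p.1) p.2 ∂(extendControl x₀.2)))) :=
      (continuous_fst.tendsto x₀).add (hA.add (hB.tendsto x₀))
    simp only [sub_add_cancel, zero_add] at h
    exact h

lemma continuous_controlFlow_controlSpace (hF : ControlledField F R L) (t : ℝ) :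
    Continuous fun x : E × controlSpace U s r => controlFlow F s x.1 (extendControl x.2) t := by
  rcases le_total t s with ht | ht
  · simp only [fun x : E × controlSpace U s r =>
      controlFlow_of_le hF (extendControl_timeDominated x.2) ht x.1]
    exact continuous_fst
  have hu : TendstoUniformly (fun (n : ℕ) (x : E × controlSpace U s r) =>
      picardIter F s x.1 (extendControl x.2) n t)
      (fun x => controlFlow F s x.1 (extendControl x.2) t) atTop := by
    rw [Metric.tendstoUniformly_iff]
    intro ε hε
    have h0 : Tendsto (fun n : ℕ => R / (2 * L) * (1 / 2) ^ n * Real.exp (2 * L * (t - s)))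
        atTop (𝓝 0) := by
      simpa using ((tendsto_pow_atTop_nhds_zero_of_lt_one (r := (1 / 2 : ℝ)) (by norm_num)
        (by norm_num)).const_mul (R / (2 * L))).mul_const (Real.exp (2 * L * (t - s)))
    filter_upwards [h0.eventually (gt_mem_nhds hε)] with n hn x
    rw [dist_comm, dist_eq_norm]
    exact (norm_picardIter_sub_controlFlow_le hF (extendControl_timeDominated x.2) x.1 n
      ht).trans_lt hn
  exact hu.continuous (Eventually.of_forall fun n =>
    continuous_picardIter_controlSpace hF n t).frequently

lemma continuous_uncurry_controlFlow (hF : ControlledField F R L) :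
    Continuous fun x : (E × controlSpace U s r) × ℝ =>
      controlFlow F s x.1.1 (extendControl x.1.2) x.2 :=
  continuous_uncurry_of_norm_sub_le (g := fun (x : E × controlSpace U s r) t =>
      controlFlow F s x.1 (extendControl x.2) t) hF.R_nonneg
    (continuous_controlFlow_controlSpace hF) fun x a b =>
    norm_controlFlow_sub_le hF (extendControl_timeDominated x.2) s x.1 a b

/-- Every control on the whole line has the same flow on `[s, r]` as an element of
`controlSpace U s r`. -/
lemma exists_controlSpace_controlFlow_eq (hF : ControlledField F R L) {μ : Measure (ℝ × U)}
    (hμ : μ.map Prod.fst = volume) (y : E) : ∃ ξ : controlSpace U s r,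
    ∀ t ≤ r, controlFlow F s y (extendControl ξ) t = controlFlow F s y μ t := by
  set ν : Measure (ℝ × U) := μ.restrict (Icc s r ×ˢ univ) with hν
  have hνfst : ν.map Prod.fst = volume.restrict (Icc s r) := by
    rw [hν, map_fst_restrict_prod_univ μ measurableSet_Icc, hμ]
  have hemb : MeasurableEmbedding fun p : Icc s r × U => ((p.1 : ℝ), p.2) :=
    (MeasurableEmbedding.subtype_coe measurableSet_Icc).prodMap MeasurableEmbedding.id
  have hrange : range (fun p : Icc s r × U => ((p.1 : ℝ), p.2)) = Icc s r ×ˢ univ := by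
    ext p; constructor
    · rintro ⟨q, rfl⟩
      exact ⟨q.1.2, mem_univ _⟩
    · intro hp
      exact ⟨(⟨p.1, hp.1⟩, p.2), rfl⟩
  have : IsFiniteMeasure ν := by
    refine ⟨?_⟩
    have : ν univ = ν.map Prod.fst univ := by
      rw [Measure.map_apply measurable_fst MeasurableSet.univ, preimage_univ]
    rw [this, hνfst]
    exact measure_lt_top _ _
  have hfin : IsFiniteMeasure (ν.comap fun p : Icc s r × U => ((p.1 : ℝ), p.2)) := by
    refine ⟨?_⟩
    rw [hemb.comap_apply]
    exact measure_lt_top _ _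
  have hmap : (ν.comap fun p : Icc s r × U => ((p.1 : ℝ), p.2)).map
      (fun p : Icc s r × U => ((p.1 : ℝ), p.2)) = ν := by
    rw [hemb.map_comap, hrange, hν, Measure.restrict_restrict
      (measurableSet_Icc.prod MeasurableSet.univ), inter_self]
  refine ⟨⟨⟨_, hfin⟩, ?_⟩, fun t ht => ?_⟩
  · refine Eq.trans ?_ ((congrArg (Measure.map Prod.fst) hmap).trans hνfst)
    exact (Measure.map_map measurable_fst hemb.measurable).symm
  · refine controlFlow_congr hF (extendControl_timeDominated _) (TimeDominated.of_eq hμ) y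
      (b := r) ?_ ht
    change ((ν.comap _).map _).restrict _ = _
    rw [hmap, hν, Measure.restrict_restrict (measurableSet_Ioc.prod MeasurableSet.univ),
      inter_eq_left.2 (prod_mono Ioc_subset_Icc_self subset_rfl)]

end FlowContinuity

section RieszExtensionMeasure

open Filter Topology
open scoped BoundedContinuousFunction CompactlySupported ZeroAtInfty

variable {X W : Type*} [TopologicalSpace X] [AddCommGroup W] [Module ℝ W]

/-- A functional which is monotone along a linear family of bounded continuous functions containing
the constants extends to a positive functional on all bounded continuous functions. -/
lemma exists_positive_extension (G : W →ₗ[ℝ] (X →ᵇ ℝ)) (ℓ : W →ₗ[ℝ] ℝ)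
    (hpos : ∀ w, (∀ x, 0 ≤ G w x) → 0 ≤ ℓ w) (hone : ∃ w, (∀ x, G w x = 1) ∧ ℓ w = 1) :
    ∃ Λ : (X →ᵇ ℝ) →ₗ[ℝ] ℝ, (∀ w, Λ (G w) = ℓ w) ∧ (∀ g, (∀ x, 0 ≤ g x) → 0 ≤ Λ g) ∧
      ∀ g, (∀ x, g x ≤ 1) → Λ g ≤ 1 := by
  have hker : ℓ ∈ LinearMap.range (LinearMap.dualMap G) := by
    rw [LinearMap.range_dualMap_eq_dualAnnihilator_ker, Submodule.mem_dualAnnihilator]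
    intro w hw
    have hw' : G w = 0 := hw
    have h1 := hpos w (by simp [hw'])
    have h2 := hpos (-w) (by simp [hw'])
    rw [map_neg] at h2
    linarith
  obtain ⟨h, hh⟩ := hker
  have hh' : ∀ w, h (G w) = ℓ w := fun w => by rw [← hh]; rfl
  let C : PointedCone ℝ (X →ᵇ ℝ) :=
    { carrier := {g | ∀ x, 0 ≤ g x}
      add_mem' := fun {a b} ha hb x => add_nonneg (ha x) (hb x)
      zero_mem' := fun x => le_rfl
      smul_mem' := fun c g hg x => mul_nonneg c.2 (hg x) }
  obtain ⟨w₁, hG₁, hℓ₁⟩ := hone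
  obtain ⟨Λ, hΛ, hΛpos⟩ := riesz_extension C ⟨LinearMap.range G, h.domRestrict _⟩
    (by
      rintro ⟨_, w, rfl⟩ hw
      have := hpos w hw
      rw [← hh'] at this
      exact this)
    (by
      intro g
      refine ⟨⟨‖g‖ • G w₁, Submodule.smul_mem _ _ ⟨w₁, rfl⟩⟩, fun x => ?_⟩
      have h2 : (‖g‖ • G w₁ + g) x = ‖g‖ * G w₁ x + g x := rfl
      have h3 := (abs_le.1 (g.norm_coe_le_norm x)).1
      change 0 ≤ (‖g‖ • G w₁ + g) x
      rw [h2, hG₁]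
      linarith)
  have hΛG : ∀ w, Λ (G w) = ℓ w := fun w => by
    rw [← hh']
    exact hΛ ⟨G w, w, rfl⟩
  refine ⟨Λ, hΛG, hΛpos, fun g hg => ?_⟩
  have := hΛpos (G w₁ - g) fun x => by
    have : (G w₁ - g) x = G w₁ x - g x := rfl
    rw [this, hG₁]
    linarith [hg x]
  rw [map_sub, hΛG, hℓ₁] at this
  linarith

variable [T2Space X] [LocallyCompactSpace X] [MeasurableSpace X] [BorelSpace X]

lemma exists_measure_of_positive (G : W →ₗ[ℝ] (X →ᵇ ℝ)) (ℓ : W →ₗ[ℝ] ℝ)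
    (hpos : ∀ w, (∀ x, 0 ≤ G w x) → 0 ≤ ℓ w) (hone : ∃ w, (∀ x, G w x = 1) ∧ ℓ w = 1) :
    ∃ η : Measure X, IsFiniteMeasure η ∧
      ∀ w, HasCompactSupport (G w) → ∫ x, G w x ∂η = ℓ w := by
  obtain ⟨Λ, hΛG, hΛpos, hΛone⟩ := exists_positive_extension G ℓ hpos hone
  let ι : C_c(X, ℝ) →ₗ[ℝ] (X →ᵇ ℝ) :=
    { toFun := fun f => (⟨⟨f, f.continuous⟩, zero_at_infty f⟩ : C₀(X, ℝ)).toBCF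
      map_add' := fun f g => rfl
      map_smul' := fun c f => rfl }
  let Φ : C_c(X, ℝ) →ₚ[ℝ] ℝ := PositiveLinearMap.mk₀ (Λ.comp ι) fun f hf => hΛpos _ hf
  refine ⟨RealRMK.rieszMeasure Φ, ⟨?_⟩, fun w hw => ?_⟩
  · rw [isOpen_univ.measure_eq_iSup_isCompact]
    refine lt_of_le_of_lt (iSup₂_le fun K _ => iSup_le fun hK => ?_) ENNReal.one_lt_top
    obtain ⟨f, hf1, hf2, -, hf3⟩ :=
      exists_continuousMap_one_of_isCompact_subset_isOpen hK isOpen_univ (subset_univ K)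
    refine (RealRMK.rieszMeasure_le_of_eq_one Φ (f := ⟨f, hf2⟩) (fun x => (hf3 x).1) hK
      hf1).trans ?_
    rw [← ENNReal.ofReal_one]
    exact ENNReal.ofReal_le_ofReal (hΛone _ fun x => (hf3 x).2)
  · have := RealRMK.integral_rieszMeasure Φ ⟨(G w).toContinuousMap, hw⟩
    rw [← hΛG w]
    exact this

end RieszExtensionMeasure

section Superposition

open Filter Topology
open scoped BoundedContinuousFunction

/-- Lipschitz functions on space-time with compact support in `(s, r) × E`. -/
def testRewards (E : Type*) [NormedAddCommGroup E] [NormedSpace ℝ E] (s r : ℝ) :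
    Submodule ℝ (ℝ × E → ℝ) where
  carrier := {φ | (∃ ℓ, LipschitzWith ℓ φ) ∧ HasCompactSupport φ ∧ tsupport φ ⊆ Ioo s r ×ˢ univ}
  add_mem' := fun {φ ψ} ⟨⟨ℓ, hℓ⟩, hc, hs⟩ ⟨⟨ℓ', hℓ'⟩, hc', hs'⟩ =>
    ⟨⟨_, hℓ.add hℓ'⟩, hc.add hc', (tsupport_add φ ψ).trans (union_subset hs hs')⟩
  zero_mem' := ⟨⟨0, LipschitzWith.const 0⟩, HasCompactSupport.zero, by
    rw [tsupport_eq_empty_iff.2 rfl]; exact empty_subset _⟩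
  smul_mem' := fun c φ ⟨⟨ℓ, hℓ⟩, hc, hs⟩ =>
    ⟨⟨_, (lipschitzWith_smul c).comp hℓ⟩, hc.smul_left (f := fun _ => c),
      (tsupport_smul_subset_right (fun _ => c) φ).trans hs⟩

variable {E U : Type*} [NormedAddCommGroup E] [NormedSpace ℝ E]
variable {F : ℝ → E → U → E} {R L : ℝ} {s r : ℝ} {φ : ℝ × E → ℝ}

lemma continuous_of_mem_testRewards (hφ : φ ∈ testRewards E s r) : Continuous φ :=
  hφ.1.choose_spec.continuous

lemma exists_bound_of_mem_testRewards (hφ : φ ∈ testRewards E s r) :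
    ∃ M, 0 ≤ M ∧ ∀ p, |φ p| ≤ M := by
  obtain ⟨C, hC⟩ := (continuous_of_mem_testRewards hφ).bounded_above_of_compact_support hφ.2.1
  exact ⟨C, (norm_nonneg _).trans (hC (0, 0)), hC⟩

lemma exists_runningReward (hsr : s < r) (hφ : φ ∈ testRewards E s r) :
    ∃ r₁ δ₀ ℓ M A, r₁ < r ∧ 0 < δ₀ ∧ RunningReward φ s r₁ ℓ M A ∧
      ∀ t x, t ≤ s + δ₀ → φ (t, x) = 0 := by
  obtain ⟨M, hM0, hM⟩ := exists_bound_of_mem_testRewards hφ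
  obtain ⟨⟨ℓ, hℓ⟩, hc, hs⟩ := hφ
  have hK : IsCompact (image Prod.fst (tsupport φ)) := IsCompact.image hc continuous_fst
  have hab : ∃ a b, s < a ∧ b < r ∧ ∀ p ∈ tsupport φ, a ≤ p.1 ∧ p.1 ≤ b := by
    rcases (tsupport φ).eq_empty_or_nonempty with he | hne
    · exact ⟨r, s, hsr, hsr, by simp [he]⟩
    · obtain ⟨_, ⟨p, hp, rfl⟩, hpl⟩ := hK.exists_isLeast (hne.image _)
      obtain ⟨_, ⟨q, hq, rfl⟩, hqg⟩ := hK.exists_isGreatest (hne.image _)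
      exact ⟨p.1, q.1, (hs hp).1.1, (hs hq).1.2, fun x hx =>
        ⟨hpl ⟨x, hx, rfl⟩, hqg ⟨x, hx, rfl⟩⟩⟩
  obtain ⟨a, b, ha, hb, hK'⟩ := hab
  obtain ⟨A, hA⟩ := (IsCompact.isBounded hc).exists_norm_le
  have hout : ∀ p, p ∉ tsupport φ → φ p = 0 := fun p hp => image_eq_zero_of_notMem_tsupport hp
  have hmax : max b s < r := max_lt hb hsr
  have hb' := le_max_left b s
  have hs' := le_max_right b s
  refine ⟨(max b s + r) / 2, (a - s) / 2, ℓ, M, A + 1, by linarith, by linarith,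
    ⟨fun p q => ?_, hM, fun t x ht => ?_, fun t x hx => ?_, ℓ.2, hM0, by linarith⟩,
    fun t x ht => ?_⟩
  · have := hℓ.dist_le_mul p q
    rwa [Real.dist_eq, dist_eq_norm] at this
  · refine hout _ fun hp => ?_
    have h := hK' _ hp
    dsimp only at h
    rcases ht with ht | ht <;> linarith
  · refine hout _ fun hp => ?_
    have h := (norm_snd_le _).trans (hA _ hp)
    dsimp only at h
    linarith
  · refine hout _ fun hp => ?_
    have h := hK' _ hp
    dsimp only at h
    linarith

variable [MetricSpace U] [CompactSpace U] [MeasurableSpace U] [BorelSpace U]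

/-- Pairs of an initial position and a relaxed control on `[s, r]`. -/
def TrajSpace (E U : Type*) [MetricSpace U] [MeasurableSpace U] (s r : ℝ) : Type _ :=
  E × controlSpace U s r

instance : TopologicalSpace (TrajSpace E U s r) :=
  inferInstanceAs (TopologicalSpace (E × controlSpace U s r))

instance : T2Space (TrajSpace E U s r) :=
  inferInstanceAs (T2Space (E × controlSpace U s r))

instance [FiniteDimensional ℝ E] : LocallyCompactSpace (TrajSpace E U s r) := by
  have := FiniteDimensional.proper_real E
  exact inferInstanceAs (LocallyCompactSpace (E × controlSpace U s r))

instance : MeasurableSpace (TrajSpace E U s r) := borel _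

instance : BorelSpace (TrajSpace E U s r) := ⟨rfl⟩

/-- The trajectory determined by an initial position and a relaxed control. -/
def trajFlow (F : ℝ → E → U → E) (x : TrajSpace E U s r) (t : ℝ) : E :=
  controlFlow F s x.1 (extendControl x.2) t

variable [FiniteDimensional ℝ E] [MeasurableSpace E] [BorelSpace E]

lemma continuous_trajFlow (hF : ControlledField F R L) :
    Continuous fun p : TrajSpace E U s r × ℝ => trajFlow F p.1 p.2 :=
  continuous_uncurry_controlFlow (s := s) (r := r) hF

lemma continuous_trajFlow_left (hF : ControlledField F R L) (t : ℝ) :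
    Continuous fun x : TrajSpace E U s r => trajFlow F x t :=
  (continuous_trajFlow hF).comp (by fun_prop : Continuous fun x : TrajSpace E U s r => (x, t))

lemma continuous_trajFlow_right (hF : ControlledField F R L) (x : TrajSpace E U s r) :
    Continuous (trajFlow F x) :=
  (continuous_trajFlow hF).comp (by fun_prop : Continuous fun t : ℝ => (x, t))

lemma continuous_comp_trajFlow (hF : ControlledField F R L) (hφ : φ ∈ testRewards E s r) :
    Continuous fun p : TrajSpace E U s r × ℝ => φ (p.2, trajFlow F p.1 p.2) :=
  (continuous_of_mem_testRewards hφ).comp (continuous_snd.prodMk (continuous_trajFlow hF))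

/-- The reward collected along trajectories plus a constant, as a linear family of bounded
continuous functions. -/
def trajReward (hF : ControlledField F R L) (s r : ℝ) :
    (testRewards E s r × ℝ) →ₗ[ℝ] (TrajSpace E U s r →ᵇ ℝ) where
  toFun w :=
    ⟨⟨fun x => (∫ t in s..r, (w.1 : ℝ × E → ℝ) (t, trajFlow F x t)) + w.2,
      (intervalIntegral.continuous_parametric_intervalIntegral_of_continuous'
        (continuous_comp_trajFlow hF w.1.2) _ _).add continuous_const⟩, by
      obtain ⟨M, hM0, hM⟩ := exists_bound_of_mem_testRewards w.1.2
      have h : ∀ x : TrajSpace E U s r,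
          ‖∫ t in s..r, (w.1 : ℝ × E → ℝ) (t, trajFlow F x t)‖ ≤ M * |r - s| := fun x =>
        intervalIntegral.norm_integral_le_of_norm_le_const fun t _ => hM _
      refine ⟨M * |r - s| + M * |r - s|, fun x y => ?_⟩
      change dist (_ + _) (_ + _) ≤ _
      rw [dist_add_right, dist_eq_norm]
      exact (norm_sub_le _ _).trans (add_le_add (h x) (h y))⟩
  map_add' w w' := by
    ext x
    have hi : ∀ w : testRewards E s r × ℝ, IntervalIntegrable
        (fun t => (w.1 : ℝ × E → ℝ) (t, trajFlow F x t)) volume s r := fun w =>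
      ((continuous_comp_trajFlow hF w.1.2).comp
        (by fun_prop : Continuous fun t : ℝ => (x, t))).intervalIntegrable _ _
    change (∫ t in s..r, ((w.1 : ℝ × E → ℝ) (t, trajFlow F x t) +
      (w'.1 : ℝ × E → ℝ) (t, trajFlow F x t))) + (w.2 + w'.2) = (_ + _) + (_ + _)
    rw [intervalIntegral.integral_add (hi w) (hi w')]
    ring
  map_smul' c w := by
    ext x
    change (∫ t in s..r, c * (w.1 : ℝ × E → ℝ) (t, trajFlow F x t)) + c * w.2 = c * (_ + _)
    rw [intervalIntegral.integral_const_mul]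
    ring

lemma trajReward_apply (hF : ControlledField F R L) (w : testRewards E s r × ℝ)
    (x : TrajSpace E U s r) : trajReward hF s r w x =
      (∫ t in s..r, (w.1 : ℝ × E → ℝ) (t, trajFlow F x t)) + w.2 := rfl

lemma hasCompactSupport_trajReward (hF : ControlledField F R L) (hsr : s < r)
    (φ : testRewards E s r) :
    HasCompactSupport (trajReward (U := U) hF s r (φ, 0)) := by
  have := FiniteDimensional.proper_real E
  obtain ⟨r₁, δ₀, ℓ, M, A, -, -, hφ, -⟩ := exists_runningReward hsr φ.2
  refine HasCompactSupport.of_support_subset_isCompact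
    (K := (Metric.closedBall (0 : E) (A + R * (r - s)) ×ˢ (univ : Set (controlSpace U s r))))
    ((isCompact_closedBall _ _).prod isCompact_univ) fun x hx => ?_
  by_contra hx'
  refine hx ?_
  have hx1 : A + R * (r - s) < ‖x.1‖ := by
    by_contra! h
    exact hx' ⟨mem_closedBall_zero_iff.2 h, mem_univ _⟩
  rw [trajReward_apply, add_zero]
  refine (intervalIntegral.integral_congr (g := fun _ => 0) fun t ht => ?_).trans (by simp)
  rw [uIcc_of_le hsr.le] at ht
  refine hφ.zero_space _ _ ?_
  have h1 := norm_controlFlow_sub_le hF (extendControl_timeDominated x.2) s x.1 s t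
  rw [controlFlow_of_le hF (extendControl_timeDominated x.2) le_rfl,
    abs_of_nonneg (by linarith [ht.1])] at h1
  have h2 : ‖x.1‖ - ‖trajFlow F x t‖ ≤ ‖trajFlow F x t - x.1‖ := by
    rw [norm_sub_rev]; exact norm_sub_norm_le _ _
  have h3 : R * (t - s) ≤ R * (r - s) :=
    mul_le_mul_of_nonneg_left (by linarith [ht.2]) hF.R_nonneg
  have h4 : ‖trajFlow F x t - x.1‖ ≤ R * (t - s) := h1
  linarith

/-- **Superposition**: a weak solution of the continuity equation is carried by controlled
trajectories. -/
lemma exists_measure_trajSpace [Nonempty U] {N : Measure (ℝ × E)} {v : ℝ × E → E}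
    (hN : IsWeakSolution F s r N v) (hF : ControlledField F R L) (hsr : s < r) :
    ∃ η : Measure (TrajSpace E U s r), IsFiniteMeasure η ∧ ∀ φ ∈ testRewards E s r,
      ∫ x, (∫ t in s..r, φ (t, trajFlow F x t)) ∂η = ∫ p, φ p ∂N := by
  have : IsFiniteMeasure N := isFiniteMeasure_of_map_fst_eq hN.map_fst
  have hinteg : ∀ φ : testRewards E s r, Integrable (φ : ℝ × E → ℝ) N := fun φ => by
    obtain ⟨M, -, hM⟩ := exists_bound_of_mem_testRewards φ.2
    exact Integrable.of_bound (continuous_of_mem_testRewards φ.2).aestronglyMeasurable M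
      (Eventually.of_forall hM)
  let ℓ : (testRewards E s r × ℝ) →ₗ[ℝ] ℝ :=
    { toFun := fun w => (∫ p, (w.1 : ℝ × E → ℝ) p ∂N) + w.2
      map_add' := fun w w' => by
        change (∫ p, ((w.1 : ℝ × E → ℝ) p + (w'.1 : ℝ × E → ℝ) p) ∂N) + (w.2 + w'.2) = _
        rw [integral_add (hinteg w.1) (hinteg w'.1)]
        ring
      map_smul' := fun c w => by
        change (∫ p, c * (w.1 : ℝ × E → ℝ) p ∂N) + c * w.2 = c * (_ + _)
        rw [integral_const_mul]
        ring }
  have hpos : ∀ w, (∀ x, 0 ≤ trajReward (U := U) hF s r w x) → 0 ≤ ℓ w := by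
    intro w hw
    obtain ⟨r₁, δ₀, ℓ₁, M, A, hr₁, hδ₀, hφ, h0⟩ :=
      exists_runningReward hsr (testRewards E s r |>.neg_mem w.1.2)
    have key := hN.integral_le hF hsr hφ hr₁ hδ₀ h0 (c := w.2) fun y μ hμ => ?_
    · simp only [Pi.neg_apply, integral_neg] at key
      change 0 ≤ (∫ p, (w.1 : ℝ × E → ℝ) p ∂N) + w.2
      linarith
    · obtain ⟨ξ, hξ⟩ := exists_controlSpace_controlFlow_eq (s := s) (r := r) hF hμ y
      let x : TrajSpace E U s r := (y, ξ)
      have hw' := hw x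
      rw [trajReward_apply] at hw'
      have e : ∫ t in s..r, (w.1 : ℝ × E → ℝ) (t, trajFlow F x t) =
          ∫ t in s..r₁, (w.1 : ℝ × E → ℝ) (t, controlFlow F s y μ t) := by
        have hcont : Continuous fun t => (w.1 : ℝ × E → ℝ) (t, controlFlow F s y μ t) :=
          (continuous_of_mem_testRewards w.1.2).comp (continuous_id.prodMk
            (continuous_controlFlow hF (TimeDominated.of_eq hμ) s y))
        have e1 : ∫ t in s..r, (w.1 : ℝ × E → ℝ) (t, trajFlow F x t) =
            ∫ t in s..r, (w.1 : ℝ × E → ℝ) (t, controlFlow F s y μ t) := by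
          refine intervalIntegral.integral_congr fun t ht => ?_
          rw [uIcc_of_le hsr.le] at ht
          have : trajFlow F x t = controlFlow F s y μ t := hξ t ht.2
          simp only [this]
        have e2 : ∫ t in r₁..r, (w.1 : ℝ × E → ℝ) (t, controlFlow F s y μ t) = 0 := by
          refine (intervalIntegral.integral_congr (g := fun _ => 0) fun t ht => ?_).trans (by simp)
          rw [uIcc_of_le hr₁.le] at ht
          have := hφ.zero_time t (controlFlow F s y μ t) (Or.inr ht.1)
          simpa using this
        rw [e1, ← intervalIntegral.integral_add_adjacent_intervals
          (hcont.intervalIntegrable s r₁) (hcont.intervalIntegrable r₁ r), e2, add_zero]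
      rw [e] at hw'
      simp only [reward, Pi.neg_apply, intervalIntegral.integral_neg]
      linarith
  have hone : ∃ w, (∀ x, trajReward (U := U) hF s r w x = 1) ∧ ℓ w = 1 := by
    refine ⟨(0, 1), fun x => ?_, ?_⟩
    · rw [trajReward_apply]
      simp
    · change (∫ p, ((0 : testRewards E s r) : ℝ × E → ℝ) p ∂N) + 1 = 1
      simp
  obtain ⟨η, hη, h⟩ := exists_measure_of_positive (trajReward (U := U) hF s r) ℓ hpos hone
  refine ⟨η, hη, fun φ hφ => ?_⟩
  have h1 := h (⟨φ, hφ⟩, 0) (hasCompactSupport_trajReward hF hsr ⟨φ, hφ⟩)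
  simp only [trajReward_apply, add_zero] at h1
  rw [h1]
  exact add_zero _

end Superposition

section Marginals

open Filter Topology

lemma ext_of_forall_lipschitz_hasCompactSupport {E : Type*} [MetricSpace E] [ProperSpace E]
    [MeasurableSpace E] [BorelSpace E] {μ ν : Measure E} [IsFiniteMeasure μ] [IsFiniteMeasure ν]
    (h : ∀ (g : E → ℝ) (ℓ : ℝ≥0), LipschitzWith ℓ g → HasCompactSupport g →
      ∫ x, g x ∂μ = ∫ x, g x ∂ν) : μ = ν := by
  have key : ∀ F : Set E, IsCompact F → μ F = ν F := by
    intro F hF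
    have hpos : ∀ n : ℕ, (0 : ℝ) < 1 / ((n : ℝ) + 1) := fun n => Nat.one_div_pos_of_nat
    have hμ := tendsto_integral_thickenedIndicator_of_isClosed μ hF.isClosed hpos
      tendsto_one_div_add_atTop_nhds_zero_nat
    have hν := tendsto_integral_thickenedIndicator_of_isClosed ν hF.isClosed hpos
      tendsto_one_div_add_atTop_nhds_zero_nat
    have heq : ∀ n : ℕ, ∫ x, (thickenedIndicator (hpos n) F x : ℝ) ∂μ =
        ∫ x, (thickenedIndicator (hpos n) F x : ℝ) ∂ν := fun n => by
      refine h _ _ (NNReal.isometry_coe.lipschitz.comp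
        (lipschitzWith_thickenedIndicator (hpos n) F)) ?_
      refine HasCompactSupport.of_support_subset_isCompact
        (hF.cthickening (r := 1 / ((n : ℝ) + 1))) fun x hx => ?_
      by_contra hx'
      refine hx ?_
      exact congrArg NNReal.toReal (thickenedIndicator_zero (hpos n) F
        fun hx1 => hx' (Metric.thickening_subset_cthickening _ _ hx1))
    have e : μ.real F = ν.real F := tendsto_nhds_unique hμ (by simpa only [heq] using hν)
    rwa [measureReal_def, measureReal_def,
      ENNReal.toReal_eq_toReal_iff' (measure_ne_top _ _) (measure_ne_top _ _)] at e
  ext A hA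
  rw [hA.measure_eq_iSup_isCompact_of_ne_top (measure_ne_top μ A),
    hA.measure_eq_iSup_isCompact_of_ne_top (measure_ne_top ν A)]
  exact iSup_congr fun K => iSup_congr fun _ => iSup_congr fun hK => key K hK

lemma mul_mem_testRewards {E : Type*} [NormedAddCommGroup E] [NormedSpace ℝ E] {s r : ℝ}
    {a : ℝ → ℝ} {b : E → ℝ} {ℓ ℓ' : ℝ≥0} (ha : LipschitzWith ℓ a) (hac : HasCompactSupport a)
    (has : tsupport a ⊆ Ioo s r) (hb : LipschitzWith ℓ' b) (hbc : HasCompactSupport b) :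
    (fun p : ℝ × E => a p.1 * b p.2) ∈ testRewards E s r := by
  obtain ⟨A, hA⟩ := ha.continuous.bounded_above_of_compact_support hac
  obtain ⟨B, hB⟩ := hb.continuous.bounded_above_of_compact_support hbc
  have hA0 := (norm_nonneg _).trans (hA 0)
  have hB0 := (norm_nonneg _).trans (hB 0)
  have hsub : Function.support (fun p : ℝ × E => a p.1 * b p.2) ⊆ tsupport a ×ˢ tsupport b := by
    intro p hp
    exact ⟨subset_tsupport a (left_ne_zero_of_mul hp), subset_tsupport b (right_ne_zero_of_mul hp)⟩
  refine ⟨⟨(ℓ * B + A * ℓ' : ℝ).toNNReal, ?_⟩,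
    HasCompactSupport.of_support_subset_isCompact (hac.isCompact.prod hbc.isCompact) hsub, ?_⟩
  · refine LipschitzWith.of_dist_le_mul fun p q => ?_
    rw [Real.coe_toNNReal _ (by positivity), Real.dist_eq]
    have h1 := ha.dist_le_mul p.1 q.1
    have h2 := hb.dist_le_mul p.2 q.2
    rw [Real.dist_eq] at h1 h2
    have h3 : dist p.1 q.1 ≤ dist p q := le_max_left _ _
    have h4 : dist p.2 q.2 ≤ dist p q := le_max_right _ _
    calc |a p.1 * b p.2 - a q.1 * b q.2|
        = |(a p.1 - a q.1) * b p.2 + a q.1 * (b p.2 - b q.2)| := by ring_nf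
      _ ≤ |a p.1 - a q.1| * |b p.2| + |a q.1| * |b p.2 - b q.2| := by
        rw [← abs_mul, ← abs_mul]; exact abs_add_le _ _
      _ ≤ (ℓ * dist p q) * B + A * (ℓ' * dist p q) := by
        gcongr
        · exact h1.trans (by gcongr)
        · exact hB _
        · exact hA _
        · exact h2.trans (by gcongr)
      _ = (ℓ * B + A * ℓ') * dist p q := by ring
  · exact (closure_minimal hsub ((isClosed_tsupport a).prod (isClosed_tsupport b))).trans
      (prod_mono has (subset_univ _))

variable {d : ℕ} {U : Type} [MetricSpace U] [CompactSpace U] [MeasurableSpace U] [BorelSpace U]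
  {F : ℝ → Euc d → U → Euc d} {R L s r : ℝ} {m : ℝ → Measure (Euc d)}

lemma continuous_integral_comp_trajFlow (hF : ControlledField F R L)
    (η : Measure (TrajSpace (Euc d) U s r)) [IsFiniteMeasure η] {b : Euc d → ℝ}
    (hb : Continuous b) {B : ℝ} (hB : ∀ x, ‖b x‖ ≤ B) :
    Continuous fun t => ∫ x, b (trajFlow F x t) ∂η :=
  continuous_of_dominated (F := fun t (x : TrajSpace (Euc d) U s r) => b (trajFlow F x t))
    (bound := fun _ => B)
    (fun t => (hb.comp (continuous_trajFlow_left hF t)).aestronglyMeasurable)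
    (fun _ => Eventually.of_forall fun _ => hB _) (integrable_const B)
    (Eventually.of_forall fun x => hb.comp (continuous_trajFlow_right hF x))

lemma integral_trajFlow_eq_of_testRewards (hF : ControlledField F R L) (hsr : s < r)
    (hmP : ∀ t ∈ Icc s r, MemP2 (m t)) (hmC : W2Continuous s r m)
    {η : Measure (TrajSpace (Euc d) U s r)} [IsFiniteMeasure η]
    (hη : ∀ φ ∈ testRewards (Euc d) s r, ∫ x, (∫ t in s..r, φ (t, trajFlow F x t)) ∂η =
      ∫ p, φ p ∂(flowMeasure hsr.le hmP hmC))
    {b : Euc d → ℝ} {ℓ : ℝ≥0} (hb : LipschitzWith ℓ b) (hbc : HasCompactSupport b)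
    {t : ℝ} (ht : t ∈ Icc s r) : ∫ x, b (trajFlow F x t) ∂η = ∫ x, b x ∂(m t) := by
  obtain ⟨B, hB⟩ := hb.continuous.bounded_above_of_compact_support hbc
  have hcη := continuous_integral_comp_trajFlow hF η hb.continuous hB
  have hcm := continuousOn_integral_of_W2Continuous hmP hmC hb hB
  have hN : IsFiniteMeasure (flowMeasure hsr.le hmP hmC) :=
    isFiniteMeasure_of_map_fst_eq (map_fst_flowMeasure hsr.le hmP hmC)
  have hae : ∀ᵐ t ∂volume, t ∈ Ioo s r →
      ∫ x, b (trajFlow F x t) ∂η - ∫ x, b x ∂(m t) = 0 := by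
    refine isOpen_Ioo.ae_eq_zero_of_integral_contDiff_smul_eq_zero ?_ fun a ha hac has => ?_
    · exact ContinuousOn.locallyIntegrableOn
        ((hcη.continuousOn.sub hcm).mono Ioo_subset_Icc_self) measurableSet_Ioo
    · obtain ⟨A, hA⟩ := ha.lipschitzWith_of_hasCompactSupport hac (by simp)
      have hmem := mul_mem_testRewards hA hac has hb hbc
      have e := hη _ hmem
      have hzero : ∀ t, t ∉ Ioo s r → a t = 0 := fun t ht =>
        image_eq_zero_of_notMem_tsupport fun h => ht (has h)
      obtain ⟨A', hA'⟩ := ha.continuous.bounded_above_of_compact_support hac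
      have hA0 := (norm_nonneg _).trans (hA' 0)
      rw [integral_flowMeasure] at e
      · simp only at e
        simp only [intervalIntegral.integral_of_le hsr.le, ← integral_Icc_eq_integral_Ioc] at e
        rw [integral_integral_swap] at e
        · simp only [integral_const_mul] at e
          rw [← setIntegral_eq_integral_of_forall_compl_eq_zero (s := Icc s r)]
          · simp only [smul_eq_mul, mul_sub]
            rw [integral_sub, e, sub_self]
            · exact (ha.continuous.mul hcη).continuousOn.integrableOn_Icc
            · exact (ha.continuous.continuousOn.mul hcm).integrableOn_Icc
          · intro t ht
            rw [hzero t fun h => ht (Ioo_subset_Icc_self h), zero_smul]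
        · refine Integrable.of_bound
            (continuous_comp_trajFlow hF hmem).aestronglyMeasurable (A' * B)
            (Eventually.of_forall fun p => ?_)
          simp only [Function.uncurry, norm_mul]
          exact mul_le_mul (hA' _) (hB _) (norm_nonneg _) hA0
      · obtain ⟨M, -, hM⟩ := exists_bound_of_mem_testRewards hmem
        exact Integrable.of_bound (continuous_of_mem_testRewards hmem).aestronglyMeasurable M
          (Eventually.of_forall hM)
  refine Measure.eqOn_Icc_of_ae_eq (μ := volume) hsr.ne ?_ hcη.continuousOn hcm ht
  rw [← restrict_Ioo_eq_restrict_Icc]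
  refine (ae_restrict_iff' measurableSet_Ioo).2 ?_
  filter_upwards [hae] with t h1 h2 using sub_eq_zero.1 (h1 h2)

lemma map_trajFlow_eq_of_testRewards (hF : ControlledField F R L) (hsr : s < r)
    (hmP : ∀ t ∈ Icc s r, MemP2 (m t)) (hmC : W2Continuous s r m)
    {η : Measure (TrajSpace (Euc d) U s r)} [IsFiniteMeasure η]
    (hη : ∀ φ ∈ testRewards (Euc d) s r, ∫ x, (∫ t in s..r, φ (t, trajFlow F x t)) ∂η =
      ∫ p, φ p ∂(flowMeasure hsr.le hmP hmC))
    {t : ℝ} (ht : t ∈ Icc s r) : η.map (fun x => trajFlow F x t) = m t := by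
  have := (hmP t ht).1
  refine ext_of_forall_lipschitz_hasCompactSupport fun b ℓ hb hbc => ?_
  rw [integral_map (continuous_trajFlow_left hF t).measurable.aemeasurable
    hb.continuous.aestronglyMeasurable]
  exact integral_trajFlow_eq_of_testRewards hF hsr hmP hmC hη hb hbc ht

end Marginals

section ControlDistributions

open Filter Topology ProbabilityTheory

lemma measurableSet_relaxedControls {U : Type} [MeasurableSpace U] (s r : ℝ) :
    MeasurableSet {ξ : Measure (ℝ × U) | ξ.map Prod.fst = volume.restrict (Icc s r)} := by
  have h : {ξ : Measure (ℝ × U) | ξ.map Prod.fst = volume.restrict (Icc s r)} =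
      ⋂ a : ℚ, ⋂ b : ℚ, {ξ : Measure (ℝ × U) |
        ξ.map Prod.fst (Ioo (a : ℝ) b) = volume.restrict (Icc s r) (Ioo (a : ℝ) b)} := by
    ext ξ
    simp only [mem_ofPred_eq, mem_iInter]
    refine ⟨fun h a b => by rw [h], fun h => ?_⟩
    have : IsLocallyFiniteMeasure (ξ.map Prod.fst) := by
      refine ⟨fun x => ?_⟩
      obtain ⟨a, ha⟩ := exists_rat_lt x
      obtain ⟨b, hb⟩ := exists_rat_gt x
      refine ⟨Ioo a b, Ioo_mem_nhds ha hb, ?_⟩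
      rw [h]
      exact measure_lt_top _ _
    exact Real.measure_ext_Ioo_rat h
  rw [h]
  refine MeasurableSet.iInter fun a => MeasurableSet.iInter fun b => ?_
  exact measurableSet_eq_fun ((Measure.measurable_coe measurableSet_Ioo).comp
    (Measure.measurable_map _ measurable_fst)) measurable_const

open scoped Classical in
/-- The kernel sending a relaxed control to itself and any other measure to `0`. -/
def relaxedKernel (U : Type) [MeasurableSpace U] (s r : ℝ) :
    Kernel (Measure (ℝ × U)) (ℝ × U) where
  toFun ξ := if ξ ∈ RelaxedControls s r then ξ else 0
  measurable' := Measurable.ite (measurableSet_relaxedControls s r) measurable_id measurable_const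

section Kernel

variable {U : Type} [MeasurableSpace U] {s r : ℝ}

lemma relaxedKernel_of_mem {ξ : Measure (ℝ × U)} (h : ξ ∈ RelaxedControls s r) :
    relaxedKernel U s r ξ = ξ := if_pos h

lemma relaxedKernel_map_fst_le (ξ : Measure (ℝ × U)) :
    (relaxedKernel U s r ξ).map Prod.fst ≤ volume.restrict (Icc s r) := by
  by_cases h : ξ ∈ RelaxedControls s r
  · rw [relaxedKernel_of_mem h]
    exact le_of_eq h
  · have : relaxedKernel U s r ξ = 0 := if_neg h
    rw [this, Measure.map_zero]
    exact Measure.zero_le _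

lemma relaxedKernel_timeDominated (ξ : Measure (ℝ × U)) :
    TimeDominated (relaxedKernel U s r ξ) :=
  (relaxedKernel_map_fst_le ξ).trans Measure.restrict_le_self

instance : IsFiniteKernel (relaxedKernel U s r) := by
  refine ⟨volume (Icc s r), by simp, fun ξ => ?_⟩
  have := relaxedKernel_map_fst_le (s := s) (r := r) ξ univ
  rwa [Measure.map_apply measurable_fst MeasurableSet.univ, preimage_univ,
    Measure.restrict_apply_univ] at this

variable {E : Type*} [NormedAddCommGroup E] [NormedSpace ℝ E] [FiniteDimensional ℝ E]
  [MeasurableSpace E] [BorelSpace E] [TopologicalSpace U] [BorelSpace U]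
  [SecondCountableTopology U] {F : ℝ → E → U → E} {R L : ℝ}

lemma stronglyMeasurable_picardIter_relaxedKernel (hF : ControlledField F R L) (n : ℕ) :
    StronglyMeasurable fun q : (E × Measure (ℝ × U)) × ℝ =>
      picardIter F s q.1.1 (relaxedKernel U s r q.1.2) n q.2 := by
  have : ProperSpace E := FiniteDimensional.proper_real E
  have : SecondCountableTopology E := inferInstance
  induction n with
  | zero =>
    simp only [picardIter_zero]
    exact (measurable_fst.comp measurable_fst).stronglyMeasurable
  | succ n ih =>
    simp only [picardIter_succ, picardMap]
    refine (measurable_fst.comp measurable_fst).stronglyMeasurable.add ?_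
    have hsnd : Measurable fun q : (E × Measure (ℝ × U)) × ℝ => q.1.2 :=
      measurable_snd.comp measurable_fst
    let κ := (relaxedKernel U s r).comap (fun q : (E × Measure (ℝ × U)) × ℝ => q.1.2) hsnd
    let G : ((E × Measure (ℝ × U)) × ℝ) × (ℝ × U) → E := fun z =>
      {z : ((E × Measure (ℝ × U)) × ℝ) × (ℝ × U) | z.2.1 ∈ Ioc s z.1.2}.indicator
        (fun z => F z.2.1 (picardIter F s z.1.1.1 (relaxedKernel U s r z.1.1.2) n z.2.1) z.2.2) z
    have hS : MeasurableSet {z : ((E × Measure (ℝ × U)) × ℝ) × (ℝ × U) | z.2.1 ∈ Ioc s z.1.2} :=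
      (measurableSet_lt measurable_const (measurable_fst.comp measurable_snd)).inter
        (measurableSet_le (measurable_fst.comp measurable_snd)
          (measurable_snd.comp measurable_fst))
    have hG : StronglyMeasurable G := by
      refine Measurable.stronglyMeasurable (Measurable.indicator ?_ hS)
      have h1 := ih.measurable.comp (by fun_prop : Measurable
        fun z : ((E × Measure (ℝ × U)) × ℝ) × (ℝ × U) => (z.1.1, z.2.1))
      exact hF.cont.measurable.comp ((measurable_fst.comp measurable_snd).prodMk
        (h1.prodMk (measurable_snd.comp measurable_snd)))
    have hI := hG.integral_kernel_prod_right' (κ := κ)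
    refine (congrArg StronglyMeasurable (funext fun q => ?_)).mp hI
    change ∫ p, G (q, p) ∂(relaxedKernel U s r q.1.2) = _
    rw [← integral_indicator (measurableSet_Ioc.prod MeasurableSet.univ)]
    refine integral_congr_ae (Eventually.of_forall fun p => ?_)
    simp only [G, indicator, mem_ofPred_eq, mem_prod, mem_univ, and_true]

lemma measurable_controlFlow_relaxedKernel (hF : ControlledField F R L) (t : ℝ) :
    Measurable fun p : E × Measure (ℝ × U) =>
      controlFlow F s p.1 (relaxedKernel U s r p.2) t :=
  measurable_of_tendsto_metrizable
    (fun n => (stronglyMeasurable_picardIter_relaxedKernel hF n).measurable.comp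
      measurable_prodMk_right)
    (tendsto_pi_nhds.2 fun p => tendsto_picardIter hF (relaxedKernel_timeDominated p.2) s p.1 t)

end Kernel

variable {d : ℕ} {U : Type} [MetricSpace U] [CompactSpace U] [MeasurableSpace U] [BorelSpace U]
  {T R Cf : ℝ} {K : Set (Euc d)} {f : ℝ → Euc d → Measure (Euc d) → U → Euc d} {s r : ℝ}
  {m : ℝ → Measure (Euc d)}

lemma measurable_prodMk_extendControl :
    Measurable fun x : TrajSpace (Euc d) U s r => (x.1, extendControl x.2) := by
  have h1 : Continuous fun x : TrajSpace (Euc d) U s r => x.1 := continuous_fst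
  have h2 : Continuous fun x : TrajSpace (Euc d) U s r => x.2 := continuous_snd
  refine h1.measurable.prodMk (measurable_measure_of_forall_lipschitz fun g ℓ hg _ => ?_)
  exact ((continuous_integral_extendControl hg.continuous).comp h2).measurable

lemma isTraj_controlFlow (h : s ≤ r) (hF : ControlledField (frozenField f m h) R Cf)
    {ξ : Measure (ℝ × U)} (hξ : ξ ∈ RelaxedControls s r) (y : Euc d) :
    IsTraj f s r m ξ y (controlFlow (frozenField f m h) s y ξ) := by
  have hμ : TimeDominated ξ := (le_of_eq hξ).trans Measure.restrict_le_self
  refine ⟨continuous_controlFlow hF hμ s y, controlFlow_of_le hF hμ le_rfl y, fun t ht => ?_⟩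
  rw [controlFlow_eq_picardMap hF hμ, picardMap]
  have hnull : ξ (({s} : Set ℝ) ×ˢ univ) = 0 := by
    have e : (({s} : Set ℝ) ×ˢ univ : Set (ℝ × U)) = Prod.fst ⁻¹' {s} := by ext; simp
    rw [e, ← Measure.map_apply measurable_fst (measurableSet_singleton s)]
    exact le_antisymm ((hμ {s}).trans (by simp)) zero_le
  have hset : (Ioc s t ×ˢ univ : Set (ℝ × U)) =ᵐ[ξ] (Icc s t ×ˢ univ : Set (ℝ × U)) := by
    have : (Ioc s t ×ˢ univ : Set (ℝ × U)) = (Icc s t ×ˢ univ) \ (({s} : Set ℝ) ×ˢ univ) := by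
      rw [← Icc_sdiff_left, prod_sdiff_prod, sdiff_self, prod_empty, empty_union]
    rw [this]
    exact sdiff_null_ae_eq_self hnull
  rw [← setIntegral_congr_set hset]
  congr 1
  refine setIntegral_congr_fun (measurableSet_Ioc.prod MeasurableSet.univ) fun p hp => ?_
  exact (frozenField_of_mem h ⟨hp.1.1.le, hp.1.2.trans ht.2⟩ _ _)

end ControlDistributions

/-- second half of Proposition 3: if a continuous curve
`m(·) : [s,r] → P²(K)` and a Borel velocity field `v` satisfy (V1) and (V2), then there is a
distribution of controls `α ∈ A_{s,r}[m(s)]` with `m(·) = m(·,s,α)`. -/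
theorem velocity_field_gives_motion
    {d : ℕ} {U : Type} [MetricSpace U] [CompactSpace U] [MeasurableSpace U] [BorelSpace U]
    (T R Cf : ℝ) (hT : 0 < T) (hR : 0 < R) (hCf : 0 < Cf)
    (K : Set (Euc d)) (hK : IsClosed K)
    (f : ℝ → Euc d → Measure (Euc d) → U → Euc d) (hf : DynHyp T R Cf K f)
    (s r : ℝ) (hs : 0 ≤ s) (hsr : s < r) (hrT : r ≤ T)
    (m : ℝ → Measure (Euc d)) (hmP : ∀ t ∈ Icc s r, MemP2K K (m t))
    (hmC : W2Continuous s r m)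
    (v : ℝ → Euc d → Euc d) (hv : Measurable (fun p : ℝ × Euc d => v p.1 p.2))
    (hV1 : ∀ᵐ t ∂(volume.restrict (Icc s r)), ∀ᵐ x ∂(m t),
      v t x ∈ convexHull ℝ (Set.range fun u : U => f t x (m t) u))
    (hV2 : ∀ φ : ℝ × Euc d → ℝ, ContDiff ℝ 1 φ → HasCompactSupport φ →
      tsupport φ ⊆ (Ioo s r ×ˢ (univ : Set (Euc d))) →
      ∫ t in Icc s r, ∫ x, fderiv ℝ φ (t, x) (1, v t x) ∂(m t) = 0) :
    ∃ α : Measure (Euc d × Measure (ℝ × U)),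
      α ∈ ControlDistrs U s r (m s) ∧ IsMotion f s r (m s) α m := by
  have hP : ∀ t ∈ Icc s r, MemP2 (m t) := fun t ht => (hmP t ht).1
  have hF := controlledField_frozenField hf hR hCf hK hs hsr hrT hmP hmC
  have hU := nonempty_of_mem_convexHull hsr hP hV1
  obtain ⟨η, hη, hη'⟩ := exists_measure_trajSpace
    (isWeakSolution_flowMeasure hsr hP hmC hF hv hV1 hV2) hF hsr
  have hmap := fun t ht => map_trajFlow_eq_of_testRewards hF hsr hP hmC hη' (t := t) ht
  have hΦ := measurable_prodMk_extendControl (d := d) (U := U) (s := s) (r := r)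
  have hss : s ∈ Icc s r := left_mem_Icc.2 hsr.le
  have hfst : (η.map fun x => (x.1, extendControl x.2)).map Prod.fst = m s := by
    rw [Measure.map_map measurable_fst hΦ, ← hmap s hss]
    congr 1
    funext x
    exact (controlFlow_of_le hF (extendControl_timeDominated x.2) le_rfl x.1).symm
  have hrel : ∀ᵐ p ∂(η.map fun x => (x.1, extendControl x.2)), p.2 ∈ RelaxedControls s r :=
    (ae_map_iff hΦ.aemeasurable (measurable_snd (measurableSet_relaxedControls s r))).2
      (Filter.Eventually.of_forall fun x => extendControl_map_fst x.2)
  refine ⟨η.map fun x => (x.1, extendControl x.2), ⟨?_, hfst, hrel⟩, rfl,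
    fun p => controlFlow (frozenField f m hsr.le) s p.1 (relaxedKernel U s r p.2), ?_, ?_⟩
  · have := (hP s hss).1
    refine ⟨?_⟩
    rw [← measure_univ (μ := m s), ← hfst, Measure.map_apply measurable_fst MeasurableSet.univ,
      preimage_univ]
  · filter_upwards [hrel] with p hp
    rw [relaxedKernel_of_mem hp]
    exact isTraj_controlFlow hsr.le hF hp p.1
  · intro t ht
    rw [Measure.map_map (measurable_controlFlow_relaxedKernel hF t) hΦ, ← hmap t ht]
    congr 1
    funext x
    simp only [Function.comp_apply, trajFlow]
    rw [relaxedKernel_of_mem (extendControl_map_fst x.2)]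
end
end

section
/- Assume the approximation conditions (A3) and (A4) hold with parameter ε>0, and that ‖f(t,x̄,I(μ),u)‖ ≤ R for all t∈[0,T], x̄∈S, μ∈Σ², u∈U. Then for all t∈[0,T], all x̄,z̄∈S, all μ∈Σ² and all u∈U: Σ_ȳ Q_{x̄,ȳ}(t,μ,u)·‖ȳ−z̄‖² ≤ ε² + 2(R+ε)·‖x̄−z̄‖. -/
open MeasureTheory Set
open scoped ENNReal NNReal

noncomputable section

/-- A signed-weight expansion of the square `‖v i - z‖ ^ 2` around `x`: when the weights sum to
zero, only the drift and the quadratic variation contribute. -/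
theorem tsum_mul_norm_sub_sq_expand {ι E : Type*} [NormedAddCommGroup E] [InnerProductSpace ℝ E]
    [CompleteSpace E] (q : ι → ℝ) (v : ι → E) (x z : E) (hq : HasSum q 0)
    (hs : Summable fun i => q i * ‖v i - z‖ ^ 2) :
    ∑' i, q i * ‖v i - z‖ ^ 2 =
      ∑' i, q i * ‖v i - x‖ ^ 2 + 2 * inner ℝ (x - z) (∑' i, q i • (v i - x)) := by
  have hqa : Summable fun i => |q i| := hq.summable.abs
  have hsq : Summable fun i => q i * ‖v i - x‖ ^ 2 := by
    refine Summable.of_norm_bounded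
      ((hs.abs.mul_left 2).add (hqa.mul_left (2 * ‖x - z‖ ^ 2))) fun i => ?_
    have htri : ‖v i - x‖ ≤ ‖v i - z‖ + ‖x - z‖ := by
      simpa [norm_sub_rev z x] using norm_sub_le_norm_sub_add_norm_sub (v i) z x
    have hbd : ‖v i - x‖ ^ 2 ≤ 2 * ‖v i - z‖ ^ 2 + 2 * ‖x - z‖ ^ 2 := by
      nlinarith [norm_nonneg (v i - x), sq_nonneg (‖v i - z‖ - ‖x - z‖)]
    rw [Real.norm_eq_abs, abs_mul, abs_mul, abs_of_nonneg (sq_nonneg ‖v i - x‖),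
      abs_of_nonneg (sq_nonneg ‖v i - z‖)]
    nlinarith [mul_le_mul_of_nonneg_left hbd (abs_nonneg (q i))]
  have hdrift : Summable fun i => q i • (v i - x) := by
    refine Summable.of_norm_bounded (hqa.add hsq.abs) fun i => ?_
    rw [norm_smul, Real.norm_eq_abs, abs_mul, abs_of_nonneg (sq_nonneg ‖v i - x‖)]
    have hbd : ‖v i - x‖ ≤ 1 + ‖v i - x‖ ^ 2 := by nlinarith [sq_nonneg (‖v i - x‖ - 1)]
    nlinarith [mul_le_mul_of_nonneg_left hbd (abs_nonneg (q i))]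
  have hsum := (hsq.hasSum.add
    (((innerSL ℝ (x - z)).hasSum hdrift.hasSum).mul_left 2)).add (hq.mul_right (‖x - z‖ ^ 2))
  rw [zero_mul, add_zero] at hsum
  refine HasSum.tsum_eq (hsum.congr_fun ?_)
  intro i
  have hexp : ‖v i - z‖ ^ 2 =
      ‖v i - x‖ ^ 2 + 2 * inner ℝ (x - z) (v i - x) + ‖x - z‖ ^ 2 := by
    rw [← sub_add_sub_cancel (v i) x z, norm_add_sq_real, real_inner_comm]
  simp only [innerSL_apply_apply, inner_smul_right, hexp]
  ring

/-- generator estimate inside the proof of Lemma 1: under (A3), (A4) and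
`‖f‖ ≤ R` on the chain, `Σ_ȳ Q_{x̄,ȳ}(t,μ,u) ‖ȳ−z̄‖² ≤ ε² + 2(R+ε)‖x̄−z̄‖`. -/
theorem chain_generator_quadratic_estimate
    {d : ℕ} {U : Type} [MetricSpace U] [CompactSpace U] [MeasurableSpace U] [BorelSpace U]
    (T R : ℝ) (hT : 0 < T) (hR : 0 < R)
    (K : Set (Euc d)) (hK : IsClosed K)
    (f : ℝ → Euc d → Measure (Euc d) → U → Euc d)
    (S : Set (Euc d)) (hS : S.Countable) (hSK : S ⊆ K)
    (Q : ℝ → (S → ℝ) → U → S → S → ℝ) (hQ : IsKolmogorov S T Q)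
    (ε : ℝ) (hε : 0 < ε)
    (hA3 : CondA3 S T f Q ε) (hA4 : CondA4 S T Q ε)
    (hfR : ∀ t ∈ Icc 0 T, ∀ μ : S → ℝ, InSigma2 S μ → ∀ (u : U) (x : S),
      ‖f t (x : Euc d) (Imeas S μ) u‖ ≤ R) :
    ∀ t ∈ Icc 0 T, ∀ (x z : S), ∀ μ : S → ℝ, InSigma2 S μ → ∀ u : U,
      ∑' y : S, Q t μ u x y * ‖(y : Euc d) - (z : Euc d)‖ ^ 2
        ≤ ε ^ 2 + 2 * (R + ε) * ‖(x : Euc d) - (z : Euc d)‖ := by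
  intro t ht x z μ hμ u
  by_cases hs : Summable fun y : S => Q t μ u x y * ‖(y : Euc d) - (z : Euc d)‖ ^ 2
  · rw [tsum_mul_norm_sub_sq_expand _ (fun y : S => (y : Euc d)) x z (hQ t ht μ hμ u x).2 hs]
    have hdrift := (norm_le_norm_add_norm_sub _ _).trans
      (add_le_add (hfR t ht μ hμ u x) (hA3 t ht μ hμ u x))
    have hinner := (real_inner_le_norm ((x : Euc d) - z) _).trans
      (mul_le_mul_of_nonneg_left hdrift (norm_nonneg ((x : Euc d) - z)))
    linarith [hA4 t ht μ hμ u x]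
  · rw [tsum_eq_zero_of_not_summable hs]
    positivity
end
end
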